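/- Let M ⊆ I^a and N ⊆ I^b be subcomplexes whose geometric realizations are compact topological manifolds without boundary of dimensions m = dim M and n = dim N respectively (in particular ℤ/2-homology manifolds, the paper's hypothesis), with m ≥ n ≥ 3. Suppose m = 2k is even and H_k(|M|; ℤ/2) = 0. If Skel_k M and Skel_k N are isomorphic, then M and N are isomorphic. -/

import Mathlib

/-- A face of the cube `I^n`: `none` marks a free coordinate. -/
def CubeFace (n : ℕ) : Type := Fin n → Option Bool

namespace CubeFace

/-- The order on faces of the cube: `F ≤ G` iff every coordinate of `G` is free
or agrees with the corresponding coordinate of `F`. -/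
instance (n : ℕ) : PartialOrder (CubeFace n) where
  le F G := ∀ i, G i = none ∨ F i = G i
  le_refl F i := Or.inr rfl
  le_trans F G H h1 h2 i := by
    rcases h2 i with h | h
    · exact Or.inl h
    · rcases h1 i with h' | h'
      · exact Or.inl (h ▸ h')
      · exact Or.inr (h' ▸ h)
  le_antisymm F G h1 h2 := by
    funext i
    rcases h1 i with h | h
    · rcases h2 i with h' | h'
      · rw [h, h']
      · rw [← h', h]
    · exact h

/-- The face of `I^n` corresponding to a vertex. -/
def toFace {n : ℕ} (v : Fin n → Bool) : CubeFace n := fun i => some (v i)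

/-- The vertex set of a face. -/
def verts {n : ℕ} (F : CubeFace n) : Set (Fin n → Bool) := {v | toFace v ≤ F}

/-- The dimension of a face: its number of free coordinates. -/
def dim {n : ℕ} (F : CubeFace n) : ℕ :=
  haveI : DecidablePred (fun i => F i = none) := fun i => decEq (α := Option Bool) (F i) none
  (Finset.univ.filter (fun i => F i = none)).card

/-- A subcomplex of `I^n`: a nonempty, downward closed set of faces. -/
def IsSubcomplex {n : ℕ} (K : Set (CubeFace n)) : Prop :=
  K.Nonempty ∧ ∀ F ∈ K, ∀ G : CubeFace n, G ≤ F → G ∈ K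

/-- The vertex set of a subcomplex. -/
def cvert {n : ℕ} (K : Set (CubeFace n)) : Set (Fin n → Bool) := {v | toFace v ∈ K}

/-- A subcomplex `Γ ⊆ K` is face-like if, for every face `F` of `K`, the set of vertices
of `F` belonging to `Γ` is empty or the vertex set of a face of `Γ`. -/
def FaceLike {n : ℕ} (K Γ : Set (CubeFace n)) : Prop :=
  ∀ F ∈ K, verts F ∩ cvert Γ = ∅ ∨ ∃ G ∈ Γ, verts F ∩ cvert Γ = verts G

/-- The deletion `K ∖ Γ`: the faces of `K` with no vertex in `Γ`. -/
def delete {n : ℕ} (K Γ : Set (CubeFace n)) : Set (CubeFace n) :=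
  {F | F ∈ K ∧ verts F ∩ cvert Γ = ∅}

/-- The geometric realization of a subcomplex of `I^n`, as a subset of `ℝ^n`. -/
def real {n : ℕ} (K : Set (CubeFace n)) : Set (Fin n → ℝ) :=
  ⋃ F ∈ K, {x | (∀ i, 0 ≤ x i ∧ x i ≤ 1) ∧
    ∀ i, (F i = some false → x i = 0) ∧ (F i = some true → x i = 1)}

/-- The boundary `∂F̂` of a face `F`: all faces strictly below `F`. -/
def bdryHat {n : ℕ} (F : CubeFace n) : Set (CubeFace n) := {G | G ≤ F ∧ G ≠ F}

/-- The boundary of the cube `I^k`: all faces except the top one. -/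
def boundaryCube (k : ℕ) : Set (CubeFace k) := {F | F ≠ fun _ => none}

/-- The `k`-skeleton of a subcomplex. -/
def skel {n : ℕ} (k : ℕ) (K : Set (CubeFace n)) : Set (CubeFace n) :=
  {F | F ∈ K ∧ dim F ≤ k}

/-- Isomorphism of cubical subcomplexes: a bijection between the vertex sets under which
vertex sets of faces correspond to vertex sets of faces. -/
def Iso {m n : ℕ} (K : Set (CubeFace m)) (L : Set (CubeFace n)) : Prop :=
  ∃ f : (Fin m → Bool) → (Fin n → Bool),
    Set.BijOn f (cvert K) (cvert L) ∧
    ∀ W : Set (Fin m → Bool), W ⊆ cvert K →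
      ((∃ F ∈ K, verts F = W) ↔ (∃ G ∈ L, verts G = f '' W))

/-- `K` has dimension `d`. -/
def HasDim {n : ℕ} (K : Set (CubeFace n)) (d : ℕ) : Prop :=
  (∀ F ∈ K, dim F ≤ d) ∧ ∃ F ∈ K, dim F = d

end CubeFace

open CategoryTheory in
/-- The `j`-th singular homology of a topological space with coefficients in `R`. -/
noncomputable def sHomology (R : Type) [CommRing R] (X : Type) [TopologicalSpace X]
    (j : ℕ) : ModuleCat R :=
  ((AlgebraicTopology.alternatingFaceMapComplex (ModuleCat R)).obj
    (((SimplicialObject.whiskering _ _).obj (ModuleCat.free R)).obj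
      (TopCat.toSSet.obj (TopCat.of X)))).homology j

/-- `X` is a compact topological `d`-manifold without boundary. -/
def IsCompactManifold (X : Type) [TopologicalSpace X] (d : ℕ) : Prop :=
  CompactSpace X ∧ Nonempty (ChartedSpace (EuclideanSpace ℝ (Fin d)) X)

/-! ### Part 1: algebra of mod 2 chains and acyclic carriers -/
namespace CM

open Module Submodule

lemma z2_add_self {D : Type*} [AddCommGroup D] [Module (ZMod 2) D] (x : D) : x + x = 0 := by
  have : ((1 : ZMod 2) + 1) • x = 0 := by
    have h : (1 : ZMod 2) + 1 = 0 := by decide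
    rw [h, zero_smul]
  rwa [add_smul, one_smul] at this

lemma z2_eq_of_add {D : Type*} [AddCommGroup D] [Module (ZMod 2) D] {x y : D} (h : x + y = 0) :
    x = y := by
  have := congrArg (· + y) h
  simpa [add_assoc, z2_add_self] using this

lemma z2_add_eq {D : Type*} [AddCommGroup D] [Module (ZMod 2) D] {x y z : D} (h : x + y = z) :
    x = y + z := by
  rw [← h, add_comm x y, ← add_assoc, z2_add_self, zero_add]

lemma z2_cases (a : ZMod 2) : a = 0 ∨ a = 1 := by
  revert a; decide

/-- The recursion behind acyclic carriers, for mod 2 chains. -/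
theorem carrier {B C D : Type*} [AddCommGroup C] [Module (ZMod 2) C] [AddCommGroup D]
    [Module (ZMod 2) D] (bs : Basis B (ZMod 2) C) (dC : C →ₗ[ZMod 2] C) (dD : D →ₗ[ZMod 2] D)
    (deg : B → ℕ) (s : ℕ) (P : Set B) (Φ : B → ℕ → Submodule (ZMod 2) D)
    (hbd : ∀ b ∈ P, dC (bs b) ∈
      span (ZMod 2) (bs '' {b' | b' ∈ P ∧ deg b' + 1 = deg b ∧ ∀ n, Φ b' n ≤ Φ b n}))
    (hdd : ∀ b ∈ P, dC (dC (bs b)) = 0)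
    (R : C →ₗ[ZMod 2] D) (hR : ∀ b ∈ P, dD (R (bs b)) = R (dC (bs b)))
    (hRm : ∀ b ∈ P, ∀ d, deg b = d + 1 → R (bs b) ∈ Φ b (d + s))
    (hac : ∀ b ∈ P, ∀ d, deg b = d + 1 → ∀ z ∈ Φ b (d + s), dD z = 0 →
      ∃ w ∈ Φ b (d + s + 1), dD w = z)
    (F0 : B → D) (h0 : ∀ b ∈ P, deg b = 0 → F0 b ∈ Φ b s ∧ dD (F0 b) = R (bs b)) :
    ∃ F : C →ₗ[ZMod 2] D, (∀ b ∈ P, dD (F (bs b)) = R (bs b) + F (dC (bs b))) ∧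
      (∀ b ∈ P, F (bs b) ∈ Φ b (deg b + s)) ∧ ∀ b ∈ P, deg b = 0 → F (bs b) = F0 b := by
  classical
  let Good : ℕ → (C →ₗ[ZMod 2] D) → Prop := fun n F => ∀ b ∈ P, deg b ≤ n →
    dD (F (bs b)) = R (bs b) + F (dC (bs b)) ∧ F (bs b) ∈ Φ b (deg b + s) ∧
      (deg b = 0 → F (bs b) = F0 b)
  have agree : ∀ (F G : C →ₗ[ZMod 2] D) (n : ℕ), (∀ b ∈ P, deg b ≤ n → F (bs b) = G (bs b)) →
      ∀ b ∈ P, deg b ≤ n + 1 → F (dC (bs b)) = G (dC (bs b)) := by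
    intro F G n h b hb hn
    have := hbd b hb
    refine LinearMap.eqOn_span (f := F) (g := G) ?_ this
    rintro _ ⟨b', ⟨hb', hd, -⟩, rfl⟩
    exact h b' hb' (by omega)
  have dzero : ∀ b ∈ P, deg b = 0 → dC (bs b) = 0 := by
    intro b hb h
    have h1 := hbd b hb
    have : {b' | b' ∈ P ∧ deg b' + 1 = deg b ∧ ∀ n, Φ b' n ≤ Φ b n} = ∅ := by
      ext b'; simp; omega
    rw [this] at h1
    simpa using h1
  have step : ∀ n F, Good n F → ∃ G, Good (n + 1) G ∧ ∀ b ∈ P, deg b ≤ n → G (bs b) = F (bs b) := by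
    intro n F hF
    have hex : ∀ b, ∃ w, b ∈ P → deg b = n + 1 →
        w ∈ Φ b (n + s + 1) ∧ dD w = R (bs b) + F (dC (bs b)) := by
      intro b
      by_cases hb : b ∈ P ∧ deg b = n + 1
      · obtain ⟨hb, hd⟩ := hb
        have m1 : F (dC (bs b)) ∈ Φ b (n + s) := by
          have : span (ZMod 2) (bs '' {b' | b' ∈ P ∧ deg b' + 1 = deg b ∧ ∀ n, Φ b' n ≤ Φ b n}) ≤
              (Φ b (n + s)).comap F := by
            rw [span_le]
            rintro _ ⟨b', ⟨hb', hd', hle⟩, rfl⟩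
            have := (hF b' hb' (by omega)).2.1
            have e : deg b' = n := by omega
            rw [e] at this
            exact hle _ this
          exact this (hbd b hb)
        have m2 : dD (F (dC (bs b))) = R (dC (bs b)) := by
          have : dD (F (dC (bs b))) = R (dC (bs b)) + F (dC (dC (bs b))) := by
            refine LinearMap.eqOn_span (f := dD ∘ₗ F) (g := R + F ∘ₗ dC) ?_ (hbd b hb)
            rintro _ ⟨b', ⟨hb', hd', hle⟩, rfl⟩
            exact (hF b' hb' (by omega)).1
          rw [this, hdd b hb, map_zero, add_zero]
        obtain ⟨w, hw, hw'⟩ := hac b hb n hd (R (bs b) + F (dC (bs b)))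
          (add_mem (hRm b hb n hd) m1) (by rw [map_add, m2, hR b hb, z2_add_self])
        exact ⟨w, fun _ _ => ⟨hw, hw'⟩⟩
      · exact ⟨0, fun h h' => absurd ⟨h, h'⟩ hb⟩
    choose W hW using hex
    let G : C →ₗ[ZMod 2] D := bs.constr (ZMod 2) (fun b => if deg b ≤ n then F (bs b) else W b)
    have G1 : ∀ b, deg b ≤ n → G (bs b) = F (bs b) := by
      intro b hb; simp [G, hb]
    have G2 : ∀ b, ¬ deg b ≤ n → G (bs b) = W b := by
      intro b hb; simp only [G, Basis.constr_basis, hb, if_false]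
    refine ⟨G, ?_, fun b _ h => G1 b h⟩
    intro b hb hn
    have ag := agree G F n (fun b _ h => G1 b h) b hb hn
    by_cases h : deg b ≤ n
    · rw [ag, G1 b h]
      exact hF b hb h
    · have hd : deg b = n + 1 := by omega
      rw [ag, G2 b h]
      obtain ⟨h1, h2⟩ := hW b hb hd
      refine ⟨h2, ?_, by omega⟩
      rw [hd, show n + 1 + s = n + s + 1 by omega]
      exact h1
  have base : Good 0 (bs.constr (ZMod 2) F0) := by
    intro b hb h
    have h' : deg b = 0 := by omega
    obtain ⟨h1, h2⟩ := h0 b hb h'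
    rw [dzero b hb h']
    simp [h1, h2, h']
  let Fs : (n : ℕ) → {F // Good n F} := fun n => Nat.rec ⟨_, base⟩
    (fun n F => ⟨(step n F.1 F.2).choose, (step n F.1 F.2).choose_spec.1⟩) n
  have Fs_succ : ∀ n, ∀ b ∈ P, deg b ≤ n → (Fs (n+1)).1 (bs b) = (Fs n).1 (bs b) := fun n =>
    (step n (Fs n).1 (Fs n).2).choose_spec.2
  have Fs_mono : ∀ n k, ∀ b ∈ P, deg b ≤ n → (Fs (n+k)).1 (bs b) = (Fs n).1 (bs b) := by
    intro n k b hb h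
    induction k with
    | zero => rfl
    | succ k ih => rw [← ih]; exact Fs_succ (n+k) b hb (by omega)
  let F : C →ₗ[ZMod 2] D := bs.constr (ZMod 2) (fun b => (Fs (deg b)).1 (bs b))
  have Fb : ∀ b, F (bs b) = (Fs (deg b)).1 (bs b) := fun b => by simp [F]
  refine ⟨F, ?_, ?_, ?_⟩
  · intro b hb
    rw [Fb]
    have h1 := ((Fs (deg b)).2 b hb le_rfl).1
    rw [h1]
    congr 1
    refine agree _ _ (deg b) ?_ b hb (by omega)
    intro b' hb' hd
    rw [Fb]
    obtain ⟨k, hk⟩ := Nat.exists_eq_add_of_le hd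
    rw [hk]
    exact (Fs_mono _ k b' hb' le_rfl)
  · intro b hb
    rw [Fb]
    exact ((Fs (deg b)).2 b hb le_rfl).2.1
  · intro b hb h
    rw [Fb]
    exact ((Fs (deg b)).2 b hb le_rfl).2.2 h

/-! #### chains of lists -/

/-- Mod 2 chains of lists of points. -/
abbrev LC (X : Type*) := List X →₀ ZMod 2

/-- The chain of one list. -/
noncomputable abbrev sg {X : Type*} (x : X) : X →₀ ZMod 2 := Finsupp.single x 1

/-- The cone operator. -/
noncomputable def lcons {X : Type*} (x : X) : LC X →ₗ[ZMod 2] LC X :=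
  Finsupp.lmapDomain _ _ (fun l => x :: l)

/-- Push-forward. -/
noncomputable def lmap {X Y : Type*} (f : X → Y) : LC X →ₗ[ZMod 2] LC Y :=
  Finsupp.lmapDomain _ _ (List.map f)

/-- The boundary of a list. -/
noncomputable def ldel {X : Type*} : List X → LC X
  | [] => 0
  | x :: l => sg l + lcons x (ldel l)

/-- The boundary. -/
noncomputable def lbd {X : Type*} : LC X →ₗ[ZMod 2] LC X :=
  Finsupp.linearCombination (ZMod 2) ldel

section lists
variable {X Y Z : Type*}

@[simp] lemma lcons_sg (x : X) (l : List X) : lcons x (sg l) = sg (x :: l) := by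
  simp [lcons]

@[simp] lemma lmap_sg (f : X → Y) (l : List X) : lmap f (sg l) = sg (l.map f) := by
  simp [lmap]

@[simp] lemma lbd_sg (l : List X) : lbd (sg l) = ldel l := by
  simp [lbd]

lemma lc_ext {D : Type*} [AddCommGroup D] [Module (ZMod 2) D] {B : Type*}
    {f g : (B →₀ ZMod 2) →ₗ[ZMod 2] D}
    (h : ∀ b, f (sg b) = g (sg b)) : f = g := by
  ext b
  simpa using h b

lemma lbd_lcons (x : X) (c : LC X) : lbd (lcons x c) = c + lcons x (lbd c) := by
  have : lbd ∘ₗ lcons x = LinearMap.id + lcons x ∘ₗ lbd := by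
    apply lc_ext
    intro l
    simp [ldel]
  exact LinearMap.congr_fun this c

lemma lbd_ldel (l : List X) : lbd (ldel l) = 0 := by
  induction l with
  | nil => simp [ldel]
  | cons x l ih => simp [ldel, lbd_lcons, ih, z2_add_self]

lemma lbd_lbd (c : LC X) : lbd (lbd c) = 0 := by
  have : lbd ∘ₗ lbd = (0 : LC X →ₗ[ZMod 2] LC X) := by
    apply lc_ext
    intro l
    simp [lbd_ldel]
  exact LinearMap.congr_fun this c

lemma lmap_lcons (f : X → Y) (x : X) (c : LC X) : lmap f (lcons x c) = lcons (f x) (lmap f c) := by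
  have : lmap f ∘ₗ lcons x = lcons (f x) ∘ₗ lmap f := by
    apply lc_ext; intro l; simp
  exact LinearMap.congr_fun this c

lemma lmap_ldel (f : X → Y) (l : List X) : lmap f (ldel l) = ldel (l.map f) := by
  induction l with
  | nil => simp [ldel]
  | cons x l ih => simp [ldel, lmap_lcons, ih]

lemma lmap_lbd (f : X → Y) (c : LC X) : lmap f (lbd c) = lbd (lmap f c) := by
  have : lmap f ∘ₗ lbd = lbd ∘ₗ lmap f := by
    apply lc_ext; intro l; simp [lmap_ldel]
  exact LinearMap.congr_fun this c

lemma lmap_lmap (f : X → Y) (g : Y → Z) (c : LC X) : lmap g (lmap f c) = lmap (g ∘ f) c := by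
  have : lmap g ∘ₗ lmap f = lmap (g ∘ f) := by
    apply lc_ext; intro l; simp
  exact LinearMap.congr_fun this c

/-- The prism operator on a list. -/
noncomputable def pris (f g : X → Y) : List X → LC Y
  | [] => 0
  | x :: l => lcons (f x) (sg (List.map g (x :: l)) + pris f g l)

/-- The prism operator. -/
noncomputable def prism (f g : X → Y) : LC X →ₗ[ZMod 2] LC Y :=
  Finsupp.linearCombination (ZMod 2) (pris f g)

@[simp] lemma prism_sg (f g : X → Y) (l : List X) : prism f g (sg l) = pris f g l := by
  simp [prism]

lemma prism_lcons (f g : X → Y) (x : X) (c : LC X) :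
    prism f g (lcons x c) = lcons (f x) (lcons (g x) (lmap g c) + prism f g c) := by
  have : prism f g ∘ₗ lcons x = lcons (f x) ∘ₗ (lcons (g x) ∘ₗ lmap g + prism f g) := by
    apply lc_ext; intro l; simp [pris]
  exact LinearMap.congr_fun this c

lemma prism_formula (f g : X → Y) (c : LC X) :
    lbd (prism f g c) = prism f g (lbd c) + (lmap f c + lmap g c) := by
  have : lbd ∘ₗ prism f g = prism f g ∘ₗ lbd + (lmap f + lmap g) := by
    apply lc_ext; intro l
    simp only [LinearMap.comp_apply, LinearMap.add_apply, prism_sg, lbd_sg, lmap_sg]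
    induction l with
    | nil => simp [pris, ldel, z2_add_self]
    | cons x l ih =>
      simp only [pris, ldel, lbd_lcons, map_add, ih, lbd_sg, prism_sg, prism_lcons,
        List.map_cons, lcons_sg, lmap_ldel]
      have h1 := z2_add_self (sg (f x :: List.map g l) : LC Y)
      have h2 := z2_add_self (lcons (f x) (lcons (g x) (ldel (List.map g l))))
      have h3 := z2_add_self (pris f g l)
      generalize (sg (f x :: List.map g l) : LC Y) = A at *
      generalize lcons (f x) (lcons (g x) (ldel (List.map g l))) = A' at *
      generalize lcons (f x) (prism f g (ldel l)) = A'' at *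
      generalize pris f g l = E at *
      generalize (sg (g x :: List.map g l) : LC Y) = U at *
      generalize (sg (f x :: List.map f l) : LC Y) = V at *
      calc _ = U + E + A'' + V + (A + A) + A' := by abel
        _ = _ := by rw [h1]; abel
  exact LinearMap.congr_fun this c

/-- chains supported on a set of lists -/
noncomputable abbrev LS {B : Type*} (A : Set B) : Submodule (ZMod 2) (B →₀ ZMod 2) :=
  Finsupp.supported (ZMod 2) (ZMod 2) A

lemma sg_mem {B : Type*} {A : Set B} {b : B} (h : b ∈ A) : sg b ∈ LS A :=
  Finsupp.single_mem_supported _ _ h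

lemma LS_map {B D : Type*} [AddCommGroup D] [Module (ZMod 2) D] {A : Set B}
    (T : (B →₀ ZMod 2) →ₗ[ZMod 2] D) (Q : Submodule (ZMod 2) D) (h : ∀ b ∈ A, T (sg b) ∈ Q)
    {c : B →₀ ZMod 2} (hc : c ∈ LS A) : T c ∈ Q := by
  rw [LS, Finsupp.supported_eq_span_single] at hc
  have : span (ZMod 2) ((fun i => Finsupp.single i (1 : ZMod 2)) '' A) ≤ Q.comap T := by
    rw [span_le]
    rintro _ ⟨b, hb, rfl⟩
    exact h b hb
  exact this hc

lemma lcons_mem {A A' : Set (List X)} {x : X} (h : ∀ l ∈ A, x :: l ∈ A') {c : LC X}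
    (hc : c ∈ LS A) : lcons x c ∈ LS A' :=
  LS_map _ _ (fun b hb => by rw [lcons_sg]; exact sg_mem (h b hb)) hc

lemma lmap_mem {f : X → Y} {A : Set (List X)} {A' : Set (List Y)} (h : ∀ l ∈ A, l.map f ∈ A')
    {c : LC X} (hc : c ∈ LS A) : lmap f c ∈ LS A' :=
  LS_map _ _ (fun b hb => by rw [lmap_sg]; exact sg_mem (h b hb)) hc

lemma ldel_mem (l : List X) : ldel l ∈ LS {l' | l'.length + 1 = l.length ∧ l' ⊆ l} := by
  induction l with
  | nil => simp [ldel]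
  | cons x l ih =>
    rw [ldel]
    refine add_mem (sg_mem ⟨by simp, by simp⟩) (lcons_mem ?_ ih)
    rintro l' ⟨h1, h2⟩
    exact ⟨by simp [h1], List.cons_subset_cons x h2⟩

lemma pris_mem (f g : X → Y) (l : List X) :
    pris f g l ∈ LS {l' | l'.length = l.length + 1 ∧ ∀ y ∈ l', ∃ x ∈ l, y = f x ∨ y = g x} := by
  induction l with
  | nil => simp [pris]
  | cons x l ih =>
    rw [pris]
    refine lcons_mem (A := {l' | l'.length = l.length + 1 ∧
      ∀ y ∈ l', ∃ z ∈ x :: l, y = f z ∨ y = g z}) ?_ (add_mem (sg_mem ?_)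
      (Finsupp.supported_mono ?_ ih))
    · rintro l' ⟨h1, h2⟩
      refine ⟨by simp [h1], ?_⟩
      intro y hy
      rcases List.mem_cons.1 hy with rfl | hy
      · exact ⟨x, by simp, Or.inl rfl⟩
      · exact h2 y hy
    · refine ⟨by simp, ?_⟩
      intro y hy
      obtain ⟨z, hz, rfl⟩ := List.mem_map.1 hy
      exact ⟨z, hz, Or.inr rfl⟩
    · rintro l' ⟨h1, h2⟩
      refine ⟨h1, fun y hy => ?_⟩
      obtain ⟨z, hz, h⟩ := h2 y hy
      exact ⟨z, List.mem_cons_of_mem _ hz, h⟩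

/-- The `ε`-small lists of length `n` in `K`. -/
def sml [PseudoMetricSpace X] (K : Set X) (ε : ℝ) (n : ℕ) : Set (List X) :=
  {l | l.length = n ∧ (∀ x ∈ l, x ∈ K) ∧ ∀ x ∈ l, ∀ y ∈ l, dist x y < ε}

lemma sml_mono [PseudoMetricSpace X] {K K' : Set X} {ε ε' : ℝ} {n : ℕ} (h : K ⊆ K') (h' : ε ≤ ε') :
    sml K ε n ⊆ sml K' ε' n := fun _ hl =>
  ⟨hl.1, fun x hx => h (hl.2.1 x hx), fun x hx y hy => lt_of_lt_of_le (hl.2.2 x hx y hy) h'⟩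

lemma lbd_small [PseudoMetricSpace X] {K : Set X} {ε : ℝ} {n : ℕ} {l : List X}
    (hl : l ∈ sml K ε (n + 1)) : ldel l ∈ LS (sml K ε n) := by
  refine Finsupp.supported_mono ?_ (ldel_mem l)
  rintro l' ⟨h1, h2⟩
  have := hl.1
  exact ⟨by omega, fun x hx => hl.2.1 x (h2 hx), fun x hx y hy => hl.2.2 x (h2 hx) y (h2 hy)⟩

lemma prism_small [PseudoMetricSpace X] [PseudoMetricSpace Y] {f g : X → Y} {K : Set X} {K' : Set Y}
    {δ ε : ℝ} {n : ℕ} (hf : ∀ x ∈ K, f x ∈ K') (hg : ∀ x ∈ K, g x ∈ K')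
    (hff : ∀ x ∈ K, ∀ y ∈ K, dist x y < δ → dist (f x) (f y) < ε)
    (hgg : ∀ x ∈ K, ∀ y ∈ K, dist x y < δ → dist (g x) (g y) < ε)
    (hfg : ∀ x ∈ K, ∀ y ∈ K, dist x y < δ → dist (f x) (g y) < ε)
    {c : LC X} (hc : c ∈ LS (sml K δ n)) : prism f g c ∈ LS (sml K' ε (n + 1)) := by
  refine LS_map _ _ (fun l hl => ?_) hc
  rw [prism_sg]
  refine Finsupp.supported_mono ?_ (pris_mem f g l)
  rintro l' ⟨h1, h2⟩
  refine ⟨by rw [h1, hl.1], ?_, ?_⟩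
  · intro y hy
    obtain ⟨x, hx, rfl | rfl⟩ := h2 y hy
    · exact hf x (hl.2.1 x hx)
    · exact hg x (hl.2.1 x hx)
  · intro y hy y' hy'
    obtain ⟨x, hx, rfl | rfl⟩ := h2 y hy <;> obtain ⟨x', hx', rfl | rfl⟩ := h2 y' hy'
    · exact hff x (hl.2.1 x hx) x' (hl.2.1 x' hx') (hl.2.2 x hx x' hx')
    · exact hfg x (hl.2.1 x hx) x' (hl.2.1 x' hx') (hl.2.2 x hx x' hx')
    · rw [dist_comm]; exact hfg x' (hl.2.1 x' hx') x (hl.2.1 x hx) (hl.2.2 x' hx' x hx)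
    · exact hgg x (hl.2.1 x hx) x' (hl.2.1 x' hx') (hl.2.2 x hx x' hx')

lemma lmap_small [PseudoMetricSpace X] [PseudoMetricSpace Y] {f : X → Y} {K : Set X} {K' : Set Y}
    {δ ε : ℝ} {n : ℕ} (hf : ∀ x ∈ K, f x ∈ K')
    (hff : ∀ x ∈ K, ∀ y ∈ K, dist x y < δ → dist (f x) (f y) < ε)
    {c : LC X} (hc : c ∈ LS (sml K δ n)) : lmap f c ∈ LS (sml K' ε n) := by
  refine lmap_mem (A' := sml K' ε n) (fun l hl => ⟨by simp [hl.1], ?_, ?_⟩) hc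
  · intro y hy
    obtain ⟨x, hx, rfl⟩ := List.mem_map.1 hy
    exact hf x (hl.2.1 x hx)
  · intro y hy y' hy'
    obtain ⟨x, hx, rfl⟩ := List.mem_map.1 hy
    obtain ⟨x', hx', rfl⟩ := List.mem_map.1 hy'
    exact hff x (hl.2.1 x hx) x' (hl.2.1 x' hx') (hl.2.2 x hx x' hx')

lemma homotopy_steps [PseudoMetricSpace X] [PseudoMetricSpace Y] {K : Set X} {K' : Set Y}
    {δ ε : ℝ} {n : ℕ} (N : ℕ) (H : ℕ → X → Y) (hH : ∀ j ≤ N, ∀ x ∈ K, H j x ∈ K')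
    (h1 : ∀ j ≤ N, ∀ x ∈ K, ∀ y ∈ K, dist x y < δ → dist (H j x) (H j y) < ε)
    (h2 : ∀ j < N, ∀ x ∈ K, ∀ y ∈ K, dist x y < δ → dist (H j x) (H (j + 1) y) < ε)
    {c : LC X} (hc : c ∈ LS (sml K δ n)) (hz : lbd c = 0) :
    ∃ w ∈ LS (sml K' ε (n + 1)), lbd w = lmap (H 0) c + lmap (H N) c := by
  induction N with
  | zero => exact ⟨0, zero_mem _, by rw [z2_add_self, map_zero]⟩
  | succ N ih =>
    obtain ⟨w, hw, hw'⟩ := ih (fun j hj => hH j (by omega)) (fun j hj => h1 j (by omega))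
      (fun j hj => h2 j (by omega))
    refine ⟨w + prism (H N) (H (N + 1)) c, add_mem hw (prism_small (hH N (by omega))
      (hH (N + 1) le_rfl) (h1 N (by omega)) (h1 (N + 1) le_rfl) (h2 N (by omega)) hc), ?_⟩
    rw [map_add, hw', prism_formula, hz, map_zero, zero_add]
    have := z2_add_self (lmap (H N) c)
    calc _ = lmap (H 0) c + (lmap (H N) c + lmap (H N) c) + lmap (H (N + 1)) c := by abel
      _ = _ := by rw [this, add_zero]

end lists

end CM

/-! ### Part 2: small chains in metric spaces, simplicial chains -/
namespace CM

open Module Submodule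
set_option linter.unusedSectionVars false

section metric
variable {X Y : Type*}

lemma convex_acyclic {E : Type*} [NormedAddCommGroup E] [NormedSpace ℝ E] {K : Set E}
    (hK : Convex ℝ K) {p : E} (hp : p ∈ K) {ε : ℝ} (hε : 0 < ε) {n : ℕ} {z : LC E}
    (hz : z ∈ LS (sml K ε n)) (hz0 : lbd z = 0) :
    ∃ w ∈ LS (sml K ε (n + 1)), lbd w = z := by
  classical
  obtain ⟨η, hη0, hηε, D, hD, hzη⟩ : ∃ η, 0 < η ∧ η < ε ∧ ∃ D, 0 ≤ D ∧
      z ∈ LS (sml {x | x ∈ K ∧ ‖x - p‖ ≤ D} η n) := by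
    let Q : Finset E := z.support.biUnion (fun l => l.toFinset)
    have hQ : ∀ l ∈ z.support, ∀ x ∈ l, x ∈ Q := by
      intro l hl x hx
      exact Finset.mem_biUnion.2 ⟨l, hl, List.mem_toFinset.2 hx⟩
    obtain ⟨D, hD⟩ : ∃ D, ∀ x ∈ Q, ‖x - p‖ ≤ D := by
      obtain ⟨D, hD⟩ := (Q.finite_toSet.image (fun x => ‖x - p‖)).bddAbove
      exact ⟨D, fun x hx => hD ⟨x, hx, rfl⟩⟩
    let PP : Finset (E × E) := (Q ×ˢ Q).filter (fun q => dist q.1 q.2 < ε)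
    obtain ⟨η, h1, h2, h3⟩ : ∃ η, 0 < η ∧ η < ε ∧ ∀ q ∈ PP, dist q.1 q.2 < η := by
      have : ∀ T : Finset (E × E), (∀ q ∈ T, dist q.1 q.2 < ε) →
          ∃ η, 0 < η ∧ η < ε ∧ ∀ q ∈ T, dist q.1 q.2 < η := by
        intro T
        induction T using Finset.induction_on with
        | empty => exact fun _ => ⟨ε / 2, by linarith, by linarith, by simp⟩
        | insert a T ha ih =>
          intro h
          obtain ⟨η, h1, h2, h3⟩ := ih (fun q hq => h q (Finset.mem_insert_of_mem hq))
          have h4 := h a (Finset.mem_insert_self _ _)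
          refine ⟨max η ((dist a.1 a.2 + ε) / 2), lt_max_of_lt_left h1,
            max_lt h2 (by linarith), ?_⟩
          intro q hq
          rcases Finset.mem_insert.1 hq with rfl | hq
          · exact lt_max_of_lt_right (by linarith)
          · exact lt_max_of_lt_left (h3 q hq)
      exact this PP (fun q hq => (Finset.mem_filter.1 hq).2)
    refine ⟨η, h1, h2, max D 0, le_max_right _ _, ?_⟩
    rw [LS, Finsupp.mem_supported] at hz ⊢
    intro l hl
    have hl' := hz hl
    refine ⟨hl'.1, fun x hx => ⟨hl'.2.1 x hx, (hD x (hQ l hl x hx)).trans (le_max_left _ _)⟩, ?_⟩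
    intro x hx y hy
    exact h3 (x, y) (Finset.mem_filter.2 ⟨Finset.mem_product.2
      ⟨hQ l hl x hx, hQ l hl y hy⟩, hl'.2.2 x hx y hy⟩)
  obtain ⟨N, hN⟩ := exists_nat_gt (D / (ε - η))
  have hN0 : 0 < N := by
    have : (0 : ℝ) < N := lt_of_le_of_lt (by apply div_nonneg hD; linarith) hN
    exact_mod_cast this
  have hNr : (0 : ℝ) < N := by exact_mod_cast hN0
  have hDN : D / N < ε - η := by
    rw [div_lt_iff₀ (by linarith)] at hN
    rw [div_lt_iff₀ hNr]
    linarith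
  let H : ℕ → E → E := fun j x => x + ((j : ℝ) / N) • (p - x)
  have ht : ∀ j ≤ N, 0 ≤ (j : ℝ) / N ∧ (j : ℝ) / N ≤ 1 := by
    intro j hj
    refine ⟨by positivity, ?_⟩
    rw [div_le_one hNr]
    exact_mod_cast hj
  have hd : ∀ j ≤ N, ∀ x y : E, dist (H j x) (H j y) ≤ dist x y := by
    intro j hj x y
    obtain ⟨h0, h1⟩ := ht j hj
    have : H j x - H j y = (1 - (j : ℝ) / N) • (x - y) := by
      simp only [H]; module
    rw [dist_eq_norm, this, norm_smul, dist_eq_norm, Real.norm_of_nonneg (by linarith)]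
    have := norm_nonneg (x - y)
    nlinarith
  obtain ⟨w1, hw1, hw1'⟩ := homotopy_steps (K' := K) (ε := ε) N H (n := n) (δ := η)
    (K := {x | x ∈ K ∧ ‖x - p‖ ≤ D})
    (fun j hj x hx => by
      obtain ⟨h0, h1⟩ := ht j hj
      exact hK.add_smul_sub_mem hx.1 hp ⟨h0, h1⟩)
    (fun j hj x _ y _ hxy => lt_of_le_of_lt (hd j hj x y) (by linarith))
    (fun j hj x _ y hy hxy => by
      have h1 := hd j (by omega) x y
      have h2 : dist (H j y) (H (j + 1) y) ≤ D / N := by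
        have : H j y - H (j + 1) y = (1 / (N : ℝ)) • (y - p) := by
          simp only [H]; push_cast; rw [add_div]; module
        rw [dist_eq_norm, this, norm_smul, Real.norm_of_nonneg (by positivity)]
        rw [div_mul_eq_mul_div, one_mul]
        exact div_le_div_of_nonneg_right hy.2 hNr.le
      have h3 := dist_triangle (H j x) (H j y) (H (j + 1) y)
      linarith)
    hzη hz0
  have e0 : H 0 = id := by funext x; simp [H]
  have eN : H N = fun _ => p := by
    funext x; simp only [H]; rw [div_self hNr.ne']; module
  refine ⟨w1 + lcons p (lmap (fun _ => p) z), add_mem hw1 (lcons_mem (A' := sml K ε (n + 1)) ?_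
    (lmap_mem (A' := {l | l.length = n ∧ ∀ x ∈ l, x = p}) ?_ hz)), ?_⟩
  · rintro l ⟨h1, h2⟩
    have h3 : ∀ x ∈ p :: l, x = p := by
      intro x hx
      rcases List.mem_cons.1 hx with h | h
      · exact h
      · exact h2 x h
    refine ⟨by simp [h1], fun x hx => by rw [h3 x hx]; exact hp, fun x hx y hy => ?_⟩
    rw [h3 x hx, h3 y hy, dist_self]; exact hε
  · rintro l ⟨h1, -⟩
    refine ⟨by simp [h1], fun x hx => ?_⟩
    obtain ⟨y, -, rfl⟩ := List.mem_map.1 hx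
    rfl
  · rw [map_add, hw1', lbd_lcons, ← lmap_lbd, hz0, map_zero, map_zero, add_zero, e0, eN]
    have : lmap (id : E → E) z = z := by simp [lmap]
    rw [this, add_assoc, z2_add_self, add_zero]

lemma compact_homotopy [PseudoMetricSpace X] [PseudoMetricSpace Y] {K : Set X} {K' : Set Y}
    (hK : IsCompact K) (H : ℝ → X → Y)
    (hc : ContinuousOn (fun q : ℝ × X => H q.1 q.2) (Set.Icc 0 1 ×ˢ K))
    (hm : ∀ t ∈ Set.Icc (0 : ℝ) 1, ∀ x ∈ K, H t x ∈ K') {ε : ℝ} (hε : 0 < ε) :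
    ∃ δ > 0, ∀ n, ∀ c ∈ LS (sml K δ n), lbd c = 0 →
      ∃ w ∈ LS (sml K' ε (n + 1)), lbd w = lmap (H 0) c + lmap (H 1) c := by
  have hu := (isCompact_Icc.prod hK).uniformContinuousOn_of_continuous hc
  rw [Metric.uniformContinuousOn_iff] at hu
  obtain ⟨δ, hδ, h⟩ := hu ε hε
  refine ⟨δ, hδ, ?_⟩
  intro n c hcs hc0
  obtain ⟨N, hN⟩ := exists_nat_gt (1 / δ)
  have hNr : (0 : ℝ) < N := lt_trans (by positivity) hN
  have hN1 : 1 / (N : ℝ) < δ := by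
    rw [div_lt_iff₀ hδ] at hN
    rw [div_lt_iff₀ hNr]; linarith
  have ht : ∀ j ≤ N, (j : ℝ) / N ∈ Set.Icc (0 : ℝ) 1 := by
    intro j hj
    refine ⟨by positivity, ?_⟩
    rw [div_le_one hNr]
    exact_mod_cast hj
  have key := homotopy_steps (K := K) (K' := K') (δ := δ) (ε := ε) (n := n) N
    (fun j => H ((j : ℝ) / N)) (fun j hj x hx => hm _ (ht j hj) x hx)
    (fun j hj x hx y hy hxy => h (_, x) ⟨ht j hj, hx⟩ (_, y) ⟨ht j hj, hy⟩ (by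
      rw [Prod.dist_eq, dist_self]; exact max_lt hδ hxy))
    (fun j hj x hx y hy hxy => h (_, x) ⟨ht j hj.le, hx⟩ (_, y) ⟨ht (j + 1) hj, hy⟩ (by
      rw [Prod.dist_eq]; refine max_lt ?_ hxy
      rw [Real.dist_eq]
      have : (j : ℝ) / N - ((j + 1 : ℕ) : ℝ) / N = - (1 / N) := by push_cast; ring
      simp only [this, abs_neg]
      rw [abs_of_pos (by positivity)]; exact hN1)) hcs hc0
  simpa [div_self hNr.ne'] using key

lemma compact_small [PseudoMetricSpace X] [PseudoMetricSpace Y] {K : Set X}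
    (hK : IsCompact K) {f : X → Y} (hc : ContinuousOn f K) {ε : ℝ} (hε : 0 < ε) :
    ∃ δ > 0, ∀ x ∈ K, ∀ y ∈ K, dist x y < δ → dist (f x) (f y) < ε := by
  have hu := hK.uniformContinuousOn_of_continuous hc
  rw [Metric.uniformContinuousOn_iff] at hu
  exact hu ε hε

end metric

/-! #### simplicial chains -/

section simp
variable {ι : Type*} [Fintype ι] [DecidableEq ι]

/-- The boundary of a simplex. -/
noncomputable def sdel (S : Finset ι) : Finset ι →₀ ZMod 2 := ∑ i ∈ S, sg (S.erase i)

/-- The simplicial boundary (augmented). -/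
noncomputable def sbd : (Finset ι →₀ ZMod 2) →ₗ[ZMod 2] (Finset ι →₀ ZMod 2) :=
  Finsupp.linearCombination (ZMod 2) sdel

@[simp] lemma sbd_sg (S : Finset ι) : sbd (sg S) = sdel S := by simp [sbd]

/-- The cone operator. -/
noncomputable def scone (i : ι) : (Finset ι →₀ ZMod 2) →ₗ[ZMod 2] (Finset ι →₀ ZMod 2) :=
  Finsupp.linearCombination (ZMod 2) (fun S => if i ∈ S then 0 else sg (insert i S))

lemma scone_sg (i : ι) (S : Finset ι) :
    scone i (sg S) = if i ∈ S then 0 else sg (insert i S) := by simp [scone]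

lemma scone_formula (i : ι) (c : Finset ι →₀ ZMod 2) :
    sbd (scone i c) = scone i (sbd c) + c := by
  have : sbd ∘ₗ scone i = scone i ∘ₗ sbd + LinearMap.id := by
    apply lc_ext
    intro S
    simp only [LinearMap.comp_apply, LinearMap.add_apply, LinearMap.id_apply, sbd_sg, scone_sg]
    by_cases h : i ∈ S
    · simp only [h, if_true, map_zero, sdel, map_sum, scone_sg]
      rw [Finset.sum_eq_single_of_mem i h]
      · simp [h, Finset.insert_erase, z2_add_self]
      · intro j hj hji
        simp [Finset.mem_erase, h, hji.symm]
    · simp only [h, if_false, sbd_sg, sdel, map_sum, scone_sg]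
      rw [Finset.sum_insert h, Finset.erase_insert h, add_comm]
      congr 1
      apply Finset.sum_congr rfl
      intro j hj
      have hji : i ≠ j := fun e => h (e ▸ hj)
      simp [h, Finset.erase_insert_of_ne hji]
  exact LinearMap.congr_fun this c

lemma sbd_sdel (S : Finset ι) : sbd (sdel S) = 0 := by
  induction S using Finset.induction_on with
  | empty => simp [sdel]
  | insert i S hi ih =>
    have h1 : sdel (insert i S) = sbd (scone i (sg S)) := by
      rw [scone_sg, if_neg hi, sbd_sg]
    rw [h1, scone_formula, map_add, sbd_sg, scone_formula, ih, map_zero, zero_add, z2_add_self]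

lemma sbd_sbd (c : Finset ι →₀ ZMod 2) : sbd (sbd c) = 0 := by
  have : sbd ∘ₗ sbd = (0 : (Finset ι →₀ ZMod 2) →ₗ[ZMod 2] _) := by
    apply lc_ext; intro S; simp [sbd_sdel]
  exact LinearMap.congr_fun this c

/-- `n`-element simplices of a complex. -/
def sx (Δ : Set (Finset ι)) (n : ℕ) : Set (Finset ι) := {S | S ∈ Δ ∧ S.card = n}

lemma sdel_mem (S : Finset ι) : sdel S ∈ LS {T | T ⊆ S ∧ T.card + 1 = S.card} := by
  refine sum_mem fun i hi => sg_mem ⟨Finset.erase_subset _ _, ?_⟩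
  rw [Finset.card_erase_of_mem hi]
  have := Finset.card_pos.2 ⟨i, hi⟩
  omega

/-- cones are acyclic -/
lemma scone_acyclic {Δ : Set (Finset ι)} {i : ι} (hi : ∀ S ∈ Δ, insert i S ∈ Δ) {n : ℕ}
    {z : Finset ι →₀ ZMod 2} (hz : z ∈ LS (sx Δ n)) (h0 : sbd z = 0) :
    ∃ w ∈ LS (sx Δ (n + 1)), sbd w = z := by
  refine ⟨scone i z, LS_map _ _ (fun S hS => ?_) hz, by rw [scone_formula, h0]; simp⟩
  rw [scone_sg]
  split_ifs with h
  · exact zero_mem _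
  · exact sg_mem ⟨hi S hS.1, by rw [Finset.card_insert_of_notMem h, hS.2]⟩

/-- geometric simplex -/
def gs (S : Finset ι) : Set (ι → ℝ) := {x | x ∈ stdSimplex ℝ ι ∧ ∀ i ∉ S, x i = 0}

lemma gs_mono {S T : Finset ι} (h : S ⊆ T) : gs S ⊆ gs T :=
  fun _ hx => ⟨hx.1, fun i hi => hx.2 i (fun h' => hi (h h'))⟩

lemma gs_convex (S : Finset ι) : Convex ℝ (gs S) := by
  have : gs S = stdSimplex ℝ ι ∩ ⋂ i ∈ (Sᶜ : Finset ι), {x : ι → ℝ | x i = 0} := by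
    ext x; simp [gs]
  rw [this]
  refine (convex_stdSimplex ℝ ι).inter (convex_iInter fun i => convex_iInter fun _ => ?_)
  exact convex_hyperplane (f := fun x : ι → ℝ => x i) ⟨fun _ _ => rfl, fun _ _ => rfl⟩ 0

lemma gs_closed (S : Finset ι) : IsClosed (gs S) := by
  have : gs S = stdSimplex ℝ ι ∩ ⋂ i ∈ (Sᶜ : Finset ι), {x : ι → ℝ | x i = 0} := by
    ext x; simp [gs]
  rw [this]
  refine (isClosed_stdSimplex _ _).inter (isClosed_iInter fun i => isClosed_iInter fun _ => ?_)
  exact isClosed_eq (continuous_apply i) continuous_const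

lemma gs_single {S : Finset ι} {i : ι} (hi : i ∈ S) : Pi.single i (1 : ℝ) ∈ gs S := by
  refine ⟨single_mem_stdSimplex ℝ i, fun j hj => ?_⟩
  rw [Pi.single_apply, if_neg]
  rintro rfl; exact hj hi

/-- geometric realization -/
def gr (Δ : Set (Finset ι)) : Set (ι → ℝ) := ⋃ S ∈ Δ, gs S

lemma gr_compact (Δ : Set (Finset ι)) : IsCompact (gr Δ) := by
  refine (isCompact_stdSimplex ℝ ι).of_isClosed_subset ?_ ?_
  · exact Set.Finite.isClosed_biUnion (Set.toFinite _) (fun S _ => gs_closed S)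
  · intro x hx
    simp only [gr, Set.mem_iUnion] at hx
    obtain ⟨S, -, h⟩ := hx
    exact h.1

lemma gs_gr {Δ : Set (Finset ι)} {S : Finset ι} (h : S ∈ Δ) : gs S ⊆ gr Δ :=
  Set.subset_biUnion_of_mem (u := fun S => gs S) h

lemma gr_std {Δ : Set (Finset ι)} {x : ι → ℝ} (h : x ∈ gr Δ) : x ∈ stdSimplex ℝ ι := by
  simp only [gr, Set.mem_iUnion] at h
  obtain ⟨S, -, h⟩ := h
  exact h.1

/-- from simplicial chains to small chains -/
lemma exists_A {ε : ℝ} (hε : 0 < ε) :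
    ∃ A : (Finset ι →₀ ZMod 2) →ₗ[ZMod 2] LC (ι → ℝ), (∀ c, lbd (A c) = A (sbd c)) ∧
      (∀ S, A (sg S) ∈ LS (sml (gs S) ε S.card)) ∧ A (sg ∅) = sg [] := by
  obtain ⟨F, h1, h2, h3⟩ := carrier (Finsupp.basisSingleOne (R := ZMod 2) (ι := Finset ι)) sbd
    (lbd (X := ι → ℝ)) Finset.card 0 Set.univ (fun S n => LS (sml (gs S) ε n))
    (by
      intro S _
      simp only [Finsupp.coe_basisSingleOne, sbd_sg]
      have := sdel_mem S
      rw [LS, Finsupp.supported_eq_span_single] at this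
      refine span_mono (Set.image_mono ?_) this
      rintro T ⟨h1, h2⟩
      exact ⟨trivial, h2, fun n => Finsupp.supported_mono (sml_mono (gs_mono h1) le_rfl)⟩)
    (by intro S _; exact sbd_sbd _) 0 (by simp) (by intros; exact zero_mem _)
    (by
      intro S _ d hd z hz hz0
      obtain ⟨i, hi⟩ := Finset.card_pos.1 (by omega : 0 < S.card)
      exact convex_acyclic (gs_convex S) (gs_single hi) hε hz hz0)
    (fun _ => sg [])
    (by
      intro S _ hS
      refine ⟨sg_mem ⟨rfl, by simp, by simp⟩, by simp [ldel]⟩)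
  refine ⟨F, ?_, ?_, ?_⟩
  · intro c
    have : lbd ∘ₗ F = F ∘ₗ sbd := by
      apply lc_ext; intro S
      simpa using h1 S trivial
    exact LinearMap.congr_fun this c
  · intro S; simpa using h2 S trivial
  · simpa using h3 ∅ trivial

/-- threshold -/
noncomputable def thr (ι : Type*) [Fintype ι] : ℝ := 1 / (2 * (Fintype.card ι + 1))

lemma thr_pos : 0 < thr ι := by unfold thr; positivity

lemma thr_card : Fintype.card ι * thr ι ≤ 1 / 2 := by
  unfold thr
  rw [mul_one_div, div_le_div_iff₀ (by positivity) (by positivity)]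
  linarith

/-- the simplex spanned by the essential vertices of a list of points -/
noncomputable def Jl (l : List (ι → ℝ)) : Finset ι := by
  classical exact Finset.univ.filter (fun i => ∃ x ∈ l, thr ι < x i)

lemma mem_Jl {l : List (ι → ℝ)} {i : ι} : i ∈ Jl l ↔ ∃ x ∈ l, thr ι < x i := by
  simp [Jl]

lemma Jl_mono {l l' : List (ι → ℝ)} (h : l ⊆ l') : Jl l ⊆ Jl l' := by
  intro i hi
  rw [mem_Jl] at *
  obtain ⟨x, hx, h1⟩ := hi
  exact ⟨x, h hx, h1⟩

lemma Jl_nonempty {l : List (ι → ℝ)} (h : ∀ x ∈ l, x ∈ stdSimplex ℝ ι) (hl : l ≠ []) :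
    (Jl l).Nonempty := by
  obtain ⟨x, hx⟩ := List.exists_mem_of_ne_nil l hl
  by_contra hne
  rw [Finset.not_nonempty_iff_eq_empty] at hne
  have h1 : ∀ i, x i ≤ thr ι := by
    intro i
    by_contra hi
    have : i ∈ Jl l := mem_Jl.2 ⟨x, hx, not_le.1 hi⟩
    rw [hne] at this; simp at this
  have h2 : ∑ i, x i ≤ ∑ i : ι, thr ι := Finset.sum_le_sum fun i _ => h1 i
  rw [(h x hx).2] at h2
  simp only [Finset.sum_const, Finset.card_univ, nsmul_eq_mul] at h2
  have := thr_card (ι := ι)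
  linarith

lemma ldel_span (P : Set (List (ι → ℝ))) (Q : List (ι → ℝ) → Prop) (l : List (ι → ℝ))
    (h : ∀ l', l' ⊆ l → l'.length + 1 = l.length → Q l') :
    ldel l ∈ span (ZMod 2) ((fun l => (sg l : LC (ι → ℝ))) '' {l' | Q l'}) := by
  have := ldel_mem l
  rw [LS, Finsupp.supported_eq_span_single] at this
  refine span_mono (Set.image_mono ?_) this
  rintro T ⟨h1, h2⟩
  exact h T h2 h1

/-- from small chains to simplicial chains -/
lemma exists_B : ∃ β : LC (ι → ℝ) →ₗ[ZMod 2] (Finset ι →₀ ZMod 2),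
    (∀ c ∈ LS {l | ∀ x ∈ l, x ∈ stdSimplex ℝ ι}, sbd (β c) = β (lbd c)) ∧
    (∀ l, (∀ x ∈ l, x ∈ stdSimplex ℝ ι) → β (sg l) ∈ LS (sx {T | T ⊆ Jl l} l.length)) ∧
    β (sg []) = sg ∅ := by
  obtain ⟨F, h1, h2, h3⟩ := carrier (Finsupp.basisSingleOne (R := ZMod 2) (ι := List (ι → ℝ))) lbd
    (sbd (ι := ι)) List.length 0 {l | ∀ x ∈ l, x ∈ stdSimplex ℝ ι}
    (fun l n => LS (sx {T | T ⊆ Jl l} n))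
    (by
      intro l hl
      simp only [Finsupp.coe_basisSingleOne, lbd_sg]
      refine ldel_span Set.univ _ l ?_
      intro l' h1 h2
      refine ⟨fun x hx => hl x (h1 hx), h2, fun n => Finsupp.supported_mono ?_⟩
      rintro T ⟨hT, hT'⟩
      exact ⟨Finset.Subset.trans hT (Jl_mono h1), hT'⟩)
    (by intro S _; exact lbd_lbd _) 0 (by simp) (by intros; exact zero_mem _)
    (by
      intro l hl d hd z hz hz0
      obtain ⟨i, hi⟩ := Jl_nonempty hl (by rintro rfl; simp at hd)
      refine scone_acyclic (i := i) ?_ hz hz0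
      intro S hS
      exact Finset.insert_subset hi hS)
    (fun _ => sg ∅)
    (by
      intro S _ hS
      refine ⟨sg_mem ⟨Finset.empty_subset _, rfl⟩, by simp [sdel]⟩)
  refine ⟨F, ?_, ?_, ?_⟩
  · intro c hc
    have := LS_map (sbd ∘ₗ F - F ∘ₗ lbd) ⊥ (fun l hl => by
      have := h1 l hl
      simpa [sub_eq_zero] using this) hc
    simpa [sub_eq_zero] using this
  · intro l hl; simpa using h2 l hl
  · simpa using h3 [] (by simp)

end simp

end CM

/-! ### Part 3: homotopy invariance of simplicial homology -/
namespace CM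

open Module Submodule
set_option linter.unusedSectionVars false

section simp
variable {ι : Type*} [Fintype ι] [DecidableEq ι]

/-- downward closed, with the empty simplex -/
def DC (Δ : Set (Finset ι)) : Prop := ∅ ∈ Δ ∧ ∀ S ∈ Δ, ∀ T ⊆ S, T ∈ Δ

lemma sx_bd {Δ : Set (Finset ι)} (hΔ : DC Δ) {n : ℕ} {c : Finset ι →₀ ZMod 2}
    (hc : c ∈ LS (sx Δ (n + 1))) : sbd c ∈ LS (sx Δ n) := by
  refine LS_map _ _ (fun S hS => ?_) hc
  rw [sbd_sg]
  refine Finsupp.supported_mono ?_ (sdel_mem S)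
  rintro T ⟨h1, h2⟩
  exact ⟨hΔ.2 S hS.1 T h1, by have := hS.2; omega⟩

lemma A_mem {Δ : Set (Finset ι)} {ε : ℝ} {A : (Finset ι →₀ ZMod 2) →ₗ[ZMod 2] LC (ι → ℝ)}
    (hA : ∀ S, A (sg S) ∈ LS (sml (gs S) ε S.card)) {n : ℕ} {c : Finset ι →₀ ZMod 2}
    (hc : c ∈ LS (sx Δ n)) : A c ∈ LS (sml (gr Δ) ε n) := by
  refine LS_map _ _ (fun S hS => ?_) hc
  have := hA S
  rw [hS.2] at this
  exact Finsupp.supported_mono (sml_mono (gs_gr hS.1) le_rfl) this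

lemma Jl_small {Δ : Set (Finset ι)} (hΔ : DC Δ) {n : ℕ} {l : List (ι → ℝ)}
    (hl : l ∈ sml (gr Δ) (thr ι) n) : Jl l ∈ Δ := by
  rcases l with _ | ⟨x0, l⟩
  · have : Jl ([] : List (ι → ℝ)) = ∅ := by ext i; simp [mem_Jl]
    rw [this]; exact hΔ.1
  · have h0 := hl.2.1 x0 (by simp)
    simp only [gr, Set.mem_iUnion] at h0
    obtain ⟨S, hS, h0⟩ := h0
    refine hΔ.2 S hS _ ?_
    intro i hi
    obtain ⟨x, hx, h⟩ := mem_Jl.1 hi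
    by_contra hn
    have h1 := h0.2 i hn
    have h2 := hl.2.2 x hx x0 (by simp)
    have h3 := dist_le_pi_dist x x0 i
    rw [h1, Real.dist_eq, sub_zero] at h3
    have := le_abs_self (x i)
    linarith

lemma B_mem {Δ : Set (Finset ι)} (hΔ : DC Δ) {β : LC (ι → ℝ) →ₗ[ZMod 2] (Finset ι →₀ ZMod 2)}
    (hβ : ∀ l, (∀ x ∈ l, x ∈ stdSimplex ℝ ι) → β (sg l) ∈ LS (sx {T | T ⊆ Jl l} l.length))
    {n : ℕ} {c : LC (ι → ℝ)} (hc : c ∈ LS (sml (gr Δ) (thr ι) n)) : β c ∈ LS (sx Δ n) := by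
  refine LS_map _ _ (fun l hl => ?_) hc
  refine Finsupp.supported_mono ?_ (hβ l (fun x hx => gr_std (hl.2.1 x hx)))
  rintro T ⟨h1, h2⟩
  exact ⟨hΔ.2 _ (Jl_small hΔ hl) T h1, h2.trans hl.1⟩

lemma BA_homotopy {ε : ℝ} {A : (Finset ι →₀ ZMod 2) →ₗ[ZMod 2] LC (ι → ℝ)}
    (hA0 : ∀ c, lbd (A c) = A (sbd c))
    (hA : ∀ S, A (sg S) ∈ LS (sml (gs S) ε S.card)) (hA1 : A (sg ∅) = sg [])
    {β : LC (ι → ℝ) →ₗ[ZMod 2] (Finset ι →₀ ZMod 2)}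
    (hβ0 : ∀ c ∈ LS {l | ∀ x ∈ l, x ∈ stdSimplex ℝ ι}, sbd (β c) = β (lbd c))
    (hβ : ∀ l, (∀ x ∈ l, x ∈ stdSimplex ℝ ι) → β (sg l) ∈ LS (sx {T | T ⊆ Jl l} l.length))
    (hβ1 : β (sg []) = sg ∅) {Δ : Set (Finset ι)} (hΔ : DC Δ) {n : ℕ} {z : Finset ι →₀ ZMod 2}
    (hz : z ∈ LS (sx Δ n)) (hz0 : sbd z = 0) :
    ∃ w ∈ LS (sx Δ (n + 1)), sbd w = β (A z) + z := by
  have hAs : ∀ S, A (sg S) ∈ LS {l | ∀ x ∈ l, x ∈ stdSimplex ℝ ι} := fun S =>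
    Finsupp.supported_mono (fun l hl x hx => (hl.2.1 x hx).1) (hA S)
  obtain ⟨F, h1, h2, -⟩ := carrier (Finsupp.basisSingleOne (R := ZMod 2) (ι := Finset ι)) sbd
    sbd Finset.card 1 Set.univ (fun S n => LS (sx {T | T ⊆ S} n))
    (by
      intro S _
      simp only [Finsupp.coe_basisSingleOne, sbd_sg]
      have := sdel_mem S
      rw [LS, Finsupp.supported_eq_span_single] at this
      refine span_mono (Set.image_mono ?_) this
      rintro T ⟨h1, h2⟩
      exact ⟨trivial, h2, fun n => Finsupp.supported_mono
        (fun U hU => ⟨Finset.Subset.trans hU.1 h1, hU.2⟩)⟩)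
    (by intro S _; exact sbd_sbd _) (β ∘ₗ A + LinearMap.id)
    (by
      intro S _
      simp only [Finsupp.coe_basisSingleOne, LinearMap.add_apply, LinearMap.comp_apply,
        LinearMap.id_apply, map_add]
      rw [hβ0 _ (hAs S), hA0])
    (by
      intro S _ d hd
      simp only [Finsupp.coe_basisSingleOne, LinearMap.add_apply, LinearMap.comp_apply,
        LinearMap.id_apply]
      refine add_mem ?_ (sg_mem ⟨Finset.Subset.refl S, hd⟩)
      refine LS_map β _ (fun l hl => ?_) (hA S)
      refine Finsupp.supported_mono ?_ (hβ l (fun x hx => (hl.2.1 x hx).1))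
      rintro T ⟨h1, h2⟩
      refine ⟨fun i hi => ?_, by rw [h2, hl.1, hd]⟩
      obtain ⟨x, hx, h⟩ := mem_Jl.1 (h1 hi)
      by_contra hn
      have h3 := (hl.2.1 x hx).2 i hn
      have := thr_pos (ι := ι)
      linarith)
    (by
      intro S _ d hd z hz hz0
      obtain ⟨i, hi⟩ := Finset.card_pos.1 (by omega : 0 < S.card)
      refine scone_acyclic (i := i) ?_ hz hz0
      intro T hT
      exact Finset.insert_subset hi hT)
    (fun _ => 0)
    (by
      intro S _ hS
      refine ⟨zero_mem _, ?_⟩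
      rw [Finset.card_eq_zero.1 hS]
      simp only [Finsupp.coe_basisSingleOne, LinearMap.add_apply, LinearMap.comp_apply,
        LinearMap.id_apply, hA1, hβ1, z2_add_self, map_zero])
  refine ⟨F z, ?_, ?_⟩
  · refine LS_map F _ (fun S hS => ?_) hz
    have := h2 S trivial
    simp only [Finsupp.coe_basisSingleOne, hS.2] at this
    refine Finsupp.supported_mono ?_ this
    intro T hT
    exact ⟨hΔ.2 S hS.1 T hT.1, hT.2⟩
  · have : sbd ∘ₗ F = (β ∘ₗ A + LinearMap.id) + F ∘ₗ sbd := by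
      apply lc_ext; intro S
      simpa using h1 S trivial
    have := LinearMap.congr_fun this z
    simpa [hz0] using this

/-- the retraction killing small coordinates -/
noncomputable def hret (x : ι → ℝ) : ι → ℝ := fun i =>
  max (x i - thr ι) 0 / ∑ j, max (x j - thr ι) 0

lemma hret_den {x : ι → ℝ} (hx : x ∈ stdSimplex ℝ ι) : 0 < ∑ j, max (x j - thr ι) 0 := by
  have h1 : ∑ j, (x j - thr ι) ≤ ∑ j, max (x j - thr ι) 0 :=
    Finset.sum_le_sum fun i _ => le_max_left _ _
  rw [Finset.sum_sub_distrib, hx.2] at h1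
  simp only [Finset.sum_const, Finset.card_univ, nsmul_eq_mul] at h1
  have := thr_card (ι := ι)
  linarith

lemma hret_mem {x : ι → ℝ} {S : Finset ι} (hx : x ∈ stdSimplex ℝ ι)
    (h : ∀ i, thr ι < x i → i ∈ S) : hret x ∈ gs S := by
  have h0 := hret_den hx
  refine ⟨⟨fun i => div_nonneg (le_max_right _ _) h0.le, ?_⟩, ?_⟩
  · simp only [hret]
    rw [← Finset.sum_div, div_self h0.ne']
  · intro i hi
    have : x i ≤ thr ι := by
      by_contra hn; exact hi (h i (not_le.1 hn))
    simp only [hret]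
    rw [max_eq_right (by linarith), zero_div]

lemma hret_cont : ContinuousOn (hret (ι := ι)) (stdSimplex ℝ ι) := by
  rw [continuousOn_pi]
  intro i
  refine ContinuousOn.div ?_ ?_ (fun x hx => (hret_den hx).ne')
  · fun_prop
  · fun_prop

lemma AB_homotopy {ε : ℝ} (hε : 0 < ε) {A : (Finset ι →₀ ZMod 2) →ₗ[ZMod 2] LC (ι → ℝ)}
    (hA0 : ∀ c, lbd (A c) = A (sbd c))
    (hA : ∀ S, A (sg S) ∈ LS (sml (gs S) ε S.card)) (hA1 : A (sg ∅) = sg [])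
    {β : LC (ι → ℝ) →ₗ[ZMod 2] (Finset ι →₀ ZMod 2)}
    (hβ0 : ∀ c ∈ LS {l | ∀ x ∈ l, x ∈ stdSimplex ℝ ι}, sbd (β c) = β (lbd c))
    (hβ : ∀ l, (∀ x ∈ l, x ∈ stdSimplex ℝ ι) → β (sg l) ∈ LS (sx {T | T ⊆ Jl l} l.length))
    (hβ1 : β (sg []) = sg ∅) {Δ : Set (Finset ι)} (hΔ : DC Δ) :
    ∃ δ > 0, δ ≤ thr ι ∧ ∀ n, ∀ y ∈ LS (sml (gr Δ) δ n), lbd y = 0 →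
      ∃ w ∈ LS (sml (gr Δ) ε (n + 1)), lbd w = A (β y) + y := by
  have hstd : gr Δ ⊆ stdSimplex ℝ ι := fun x hx => gr_std hx
  obtain ⟨δ1, hδ1, hh1⟩ := compact_small (isCompact_stdSimplex ℝ ι) hret_cont hε
  obtain ⟨δtwo, hδtwo, hh2⟩ := compact_homotopy (K' := gr Δ) (gr_compact Δ)
    (fun t x => (1 - t) • x + t • hret x)
    (by
      have : ContinuousOn (fun q : ℝ × (ι → ℝ) => hret q.2) (Set.Icc 0 1 ×ˢ gr Δ) :=
        hret_cont.comp continuousOn_snd (fun q hq => hstd hq.2)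
      fun_prop)
    (by
      intro t ht x hx
      simp only [gr, Set.mem_iUnion] at hx ⊢
      obtain ⟨S, hS, hx⟩ := hx
      refine ⟨S, hS, gs_convex S hx ?_ (by linarith [ht.2]) ht.1 (by ring)⟩
      refine hret_mem hx.1 (fun i hi => ?_)
      by_contra hn
      have := hx.2 i hn
      have := thr_pos (ι := ι)
      linarith) hε
  let δ := min (thr ι) (min δ1 δtwo)
  have hδ : 0 < δ := lt_min thr_pos (lt_min hδ1 hδtwo)
  refine ⟨δ, hδ, min_le_left _ _, ?_⟩
  obtain ⟨F, h1, h2, -⟩ := carrier (Finsupp.basisSingleOne (R := ZMod 2) (ι := List (ι → ℝ))) lbd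
    (lbd (X := ι → ℝ)) List.length 1 {l | l ∈ sml (gr Δ) δ l.length}
    (fun l n => LS (sml (gs (Jl l)) ε n))
    (by
      intro l hl
      simp only [Finsupp.coe_basisSingleOne, lbd_sg]
      refine ldel_span Set.univ _ l ?_
      intro l' h1 h2
      refine ⟨⟨rfl, fun x hx => hl.2.1 x (h1 hx), fun x hx y hy => hl.2.2 x (h1 hx) y (h1 hy)⟩,
        h2, fun n => Finsupp.supported_mono (sml_mono (gs_mono (Jl_mono h1)) le_rfl)⟩)
    (by intro S _; exact lbd_lbd _) (A ∘ₗ β + lmap hret)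
    (by
      intro l hl
      simp only [Finsupp.coe_basisSingleOne, LinearMap.add_apply, LinearMap.comp_apply, map_add]
      rw [hA0, hβ0 _ (sg_mem (fun x hx => hstd (hl.2.1 x hx))), lmap_lbd])
    (by
      intro l hl d hd
      have hl1 : ∀ x ∈ l, x ∈ stdSimplex ℝ ι := fun x hx => hstd (hl.2.1 x hx)
      simp only [Finsupp.coe_basisSingleOne, LinearMap.add_apply, LinearMap.comp_apply]
      refine add_mem ?_ ?_
      · refine LS_map A _ (fun S hS => ?_) (hβ l hl1)
        have := hA S
        rw [hS.2, hd] at this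
        exact Finsupp.supported_mono (sml_mono (gs_mono hS.1) le_rfl) this
      · rw [lmap_sg]
        refine sg_mem ⟨by simp [hd], ?_, ?_⟩
        · intro y hy
          obtain ⟨x, hx, rfl⟩ := List.mem_map.1 hy
          exact hret_mem (hl1 x hx) (fun i hi => mem_Jl.2 ⟨x, hx, hi⟩)
        · intro y hy y' hy'
          obtain ⟨x, hx, rfl⟩ := List.mem_map.1 hy
          obtain ⟨x', hx', rfl⟩ := List.mem_map.1 hy'
          exact hh1 x (hl1 x hx) x' (hl1 x' hx') (lt_of_lt_of_le (hl.2.2 x hx x' hx')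
            ((min_le_right _ _).trans (min_le_left _ _))))
    (by
      intro l hl d hd z hz hz0
      have hl1 : ∀ x ∈ l, x ∈ stdSimplex ℝ ι := fun x hx => hstd (hl.2.1 x hx)
      obtain ⟨i, hi⟩ := Jl_nonempty hl1 (by rintro rfl; simp at hd)
      exact convex_acyclic (gs_convex _) (gs_single hi) hε hz hz0)
    (fun _ => 0)
    (by
      intro l _ hl
      refine ⟨zero_mem _, ?_⟩
      rw [List.length_eq_zero_iff.1 hl]
      simp only [Finsupp.coe_basisSingleOne, LinearMap.add_apply, LinearMap.comp_apply, hβ1, hA1,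
        lmap_sg, List.map_nil, z2_add_self, map_zero])
  intro n y hy hy0
  obtain ⟨w, hw, hw'⟩ := hh2 n y (Finsupp.supported_mono (sml_mono le_rfl
    ((min_le_right _ _).trans (min_le_right _ _))) hy) hy0
  refine ⟨w + F y, add_mem hw ?_, ?_⟩
  · refine LS_map F _ (fun l hl => ?_) hy
    have := h2 l ⟨rfl, hl.2⟩
    simp only [Finsupp.coe_basisSingleOne, hl.1] at this
    exact Finsupp.supported_mono (sml_mono (gs_gr (Jl_small hΔ
      (sml_mono le_rfl (min_le_left _ _) hl))) le_rfl) this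
  · have := LS_map (lbd ∘ₗ F - ((A ∘ₗ β + lmap hret) + F ∘ₗ lbd)) ⊥ (fun l (hl : l ∈ _) => by
      have := h1 l ⟨rfl, hl.2⟩
      simp only [Finsupp.coe_basisSingleOne] at this
      rw [Submodule.mem_bot, LinearMap.sub_apply, sub_eq_zero]
      simpa using this) hy
    rw [Submodule.mem_bot, LinearMap.sub_apply, sub_eq_zero] at this
    simp only [LinearMap.add_apply, LinearMap.comp_apply, hy0, map_zero, add_zero] at this
    rw [map_add, hw', this]
    have e0 : (fun x : ι → ℝ => (1 - (0:ℝ)) • x + (0:ℝ) • hret x) = id := by funext x; simp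
    have e1 : (fun x : ι → ℝ => (1 - (1:ℝ)) • x + (1:ℝ) • hret x) = hret := by funext x; simp
    rw [e0, e1]
    have : lmap (id : (ι → ℝ) → _) y = y := by simp [lmap]
    rw [this, add_comm (A (β y)), add_assoc, ← add_assoc (lmap hret y), z2_add_self, zero_add,
      add_comm]

/-- vanishing of homology -/
def Van (Δ : Set (Finset ι)) (n : ℕ) : Prop :=
  ∀ z ∈ LS (sx Δ n), sbd z = 0 → ∃ w ∈ LS (sx Δ (n + 1)), sbd w = z

/-- homology of rank at most one -/
def One (Δ : Set (Finset ι)) (n : ℕ) : Prop :=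
  ∀ z ∈ LS (sx Δ n), sbd z = 0 → ∀ z' ∈ LS (sx Δ n), sbd z' = 0 →
    (∃ w ∈ LS (sx Δ (n + 1)), sbd w = z) ∨ (∃ w ∈ LS (sx Δ (n + 1)), sbd w = z') ∨
    (∃ w ∈ LS (sx Δ (n + 1)), sbd w = z + z')

end simp

section dom
variable {ι κ : Type*} [Fintype ι] [DecidableEq ι] [Fintype κ] [DecidableEq κ]

/-- algebraic form of domination -/
def Dom (Δ : Set (Finset ι)) (Δ' : Set (Finset κ)) : Prop :=
    ∃ (φ : (Finset ι →₀ ZMod 2) →ₗ[ZMod 2] (Finset κ →₀ ZMod 2))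
      (ψ : (Finset κ →₀ ZMod 2) →ₗ[ZMod 2] (Finset ι →₀ ZMod 2)),
      (∀ n, ∀ c ∈ LS (sx Δ n), φ c ∈ LS (sx Δ' n) ∧ sbd (φ c) = φ (sbd c)) ∧
      (∀ n, ∀ c ∈ LS (sx Δ' n), ψ c ∈ LS (sx Δ n) ∧ sbd (ψ c) = ψ (sbd c)) ∧
      ∀ n, ∀ z ∈ LS (sx Δ n), sbd z = 0 → ∃ w ∈ LS (sx Δ (n + 1)), sbd w = ψ (φ z) + z

/-- `Δ` is dominated by `Δ'`. -/
theorem domination {Δ : Set (Finset ι)} {Δ' : Set (Finset κ)} (hΔ : DC Δ) (hΔ' : DC Δ')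
    (f : (ι → ℝ) → (κ → ℝ)) (g : (κ → ℝ) → (ι → ℝ)) (hf : ContinuousOn f (gr Δ))
    (hfm : ∀ x ∈ gr Δ, f x ∈ gr Δ') (hg : ContinuousOn g (gr Δ'))
    (hgm : ∀ x ∈ gr Δ', g x ∈ gr Δ) (H : ℝ → (ι → ℝ) → (ι → ℝ))
    (hH : ContinuousOn (fun q : ℝ × (ι → ℝ) => H q.1 q.2) (Set.Icc 0 1 ×ˢ gr Δ))
    (hHm : ∀ t ∈ Set.Icc (0 : ℝ) 1, ∀ x ∈ gr Δ, H t x ∈ gr Δ)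
    (hH0 : ∀ x ∈ gr Δ, H 0 x = g (f x)) (hH1 : ∀ x ∈ gr Δ, H 1 x = x) :
    Dom Δ Δ' := by
  obtain ⟨β, hβ0, hβ, hβ1⟩ := exists_B (ι := ι)
  obtain ⟨β', hβ0', hβ', hβ1'⟩ := exists_B (ι := κ)
  obtain ⟨δ', hδ', hg'⟩ := compact_small (gr_compact Δ') hg (thr_pos (ι := ι))
  obtain ⟨A', hA0', hA', hA1'⟩ := exists_A (ι := κ) hδ'
  obtain ⟨δtwo, hδtwo, hδtwot, hAB⟩ := AB_homotopy hδ' hA0' hA' hA1' hβ0' hβ' hβ1' hΔ'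
  obtain ⟨δ3, hδ3, hf'⟩ := compact_small (gr_compact Δ) hf hδtwo
  obtain ⟨δ4, hδ4, hH'⟩ := compact_homotopy (gr_compact Δ) H hH hHm (thr_pos (ι := ι))
  obtain ⟨A, hA0, hA, hA1⟩ := exists_A (ι := ι) (lt_min (lt_min hδ3 hδ4) (thr_pos (ι := ι)))
  have sA : ∀ n, ∀ c ∈ LS (sx Δ n), lmap f (A c) ∈ LS (sml (gr Δ') δtwo n) := by
    intro n c hc
    refine lmap_small hfm hf' ?_
    exact Finsupp.supported_mono (sml_mono le_rfl ((min_le_left _ _).trans (min_le_left _ _)))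
      (A_mem hA hc)
  have mstd : ∀ {α : Type _} [Fintype α] {Γ : Set (Finset α)} {e : ℝ} {n : ℕ} {c : LC (α → ℝ)},
      c ∈ LS (sml (gr Γ) e n) → c ∈ LS {l | ∀ x ∈ l, x ∈ stdSimplex ℝ α} := by
    intro α _ Γ e n c hc
    refine Finsupp.supported_mono ?_ hc
    intro l hl x hx
    have := hl.2.1 x hx
    simp only [gr, Set.mem_iUnion] at this
    obtain ⟨S, -, h⟩ := this
    exact h.1
  have mstd' : ∀ {Γ : Set (Finset κ)} {e : ℝ} {n : ℕ} {c : LC (κ → ℝ)},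
      c ∈ LS (sml (gr Γ) e n) → c ∈ LS {l | ∀ x ∈ l, x ∈ stdSimplex ℝ κ} := by
    intro Γ e n c hc
    refine Finsupp.supported_mono ?_ hc
    intro l hl x hx
    exact gr_std (hl.2.1 x hx)
  have sA' : ∀ n, ∀ c ∈ LS (sml (gr Δ') δ' n), lmap g c ∈ LS (sml (gr Δ) (thr ι) n) := by
    intro n c hc
    exact lmap_small hgm hg' hc
  refine ⟨β' ∘ₗ lmap f ∘ₗ A, β ∘ₗ lmap g ∘ₗ A', ?_, ?_, ?_⟩
  · intro n c hc
    refine ⟨B_mem hΔ' hβ' (Finsupp.supported_mono (sml_mono le_rfl hδtwot) (sA n c hc)), ?_⟩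
    simp only [LinearMap.comp_apply]
    rw [hβ0' _ (mstd' (sA n c hc)), ← lmap_lbd, hA0]
  · intro n c hc
    have := sA' n _ (A_mem hA' hc)
    refine ⟨B_mem hΔ hβ this, ?_⟩
    simp only [LinearMap.comp_apply]
    rw [hβ0 _ (mstd this), ← lmap_lbd, hA0']
  · intro n z hz hz0
    simp only [LinearMap.comp_apply]
    have hAz0 : lbd (A z) = 0 := by rw [hA0, hz0, map_zero]
    obtain ⟨w1, hw1, e1⟩ := hAB n _ (sA n z hz) (by rw [← lmap_lbd, hAz0, map_zero])
    obtain ⟨w2, hw2, e2⟩ := hH' n (A z) (Finsupp.supported_mono (sml_mono le_rfl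
      ((min_le_left _ _).trans (min_le_right _ _))) (A_mem hA hz)) hAz0
    obtain ⟨w3, hw3, e3⟩ := BA_homotopy hA0 hA hA1 hβ0 hβ hβ1 hΔ hz hz0
    have hw1' := sA' _ _ hw1
    refine ⟨β (lmap g w1) + β w2 + w3, add_mem (add_mem (B_mem hΔ hβ hw1') (B_mem hΔ hβ hw2)) hw3,
      ?_⟩
    have hl : ∀ h h' : (ι → ℝ) → (ι → ℝ), (∀ x ∈ gr Δ, h x = h' x) →
        lmap h (A z) = lmap h' (A z) := by
      intro h h' hh
      have := LS_map (lmap h - lmap h') ⊥ (fun l (hl : l ∈ _) => by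
        rw [Submodule.mem_bot, LinearMap.sub_apply, sub_eq_zero, lmap_sg, lmap_sg]
        congr 1
        exact List.map_congr_left (fun x hx => hh x (hl.2.1 x hx))) (A_mem hA hz)
      rw [Submodule.mem_bot, LinearMap.sub_apply, sub_eq_zero] at this
      exact this
    have e4 : lmap (H 0) (A z) = lmap g (lmap f (A z)) := by
      rw [lmap_lmap]; exact hl _ _ hH0
    have e5 : lmap (H 1) (A z) = A z := by
      rw [hl (H 1) id hH1]; simp [lmap]
    rw [map_add, map_add, e3, hβ0 _ (mstd hw1'), hβ0 _ (mstd hw2), ← lmap_lbd, e1, e2, e4, e5]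
    simp only [map_add]
    generalize β (lmap g (A' (β' (lmap f (A z))))) = a
    generalize β (lmap g (lmap f (A z))) = b
    generalize β (A z) = c
    calc a + b + (b + c) + (c + z) = a + (b + b) + (c + c) + z := by abel
      _ = a + z := by rw [z2_add_self, z2_add_self, add_zero, add_zero]

end dom

section trans
variable {ι κ : Type*} [Fintype ι] [DecidableEq ι] [Fintype κ] [DecidableEq κ]

lemma Dom.pull {Δ : Set (Finset ι)} {Δ' : Set (Finset κ)} (h : Dom Δ Δ') {n : ℕ} :
    ∃ (φ : (Finset ι →₀ ZMod 2) →ₗ[ZMod 2] (Finset κ →₀ ZMod 2)),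
      (∀ c ∈ LS (sx Δ n), sbd c = 0 → φ c ∈ LS (sx Δ' n) ∧ sbd (φ c) = 0) ∧
      ∀ z ∈ LS (sx Δ n), sbd z = 0 → (∃ w ∈ LS (sx Δ' (n + 1)), sbd w = φ z) →
        ∃ w ∈ LS (sx Δ (n + 1)), sbd w = z := by
  obtain ⟨φ, ψ, h1, h2, h3⟩ := h
  refine ⟨φ, fun c hc hc0 => ⟨(h1 n c hc).1, by rw [(h1 n c hc).2, hc0, map_zero]⟩, ?_⟩
  rintro z hz hz0 ⟨w, hw, hw0⟩
  obtain ⟨v, hv, hv0⟩ := h3 n z hz hz0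
  refine ⟨v + ψ w, add_mem hv (h2 _ w hw).1, ?_⟩
  rw [map_add, hv0, (h2 _ w hw).2, hw0, add_comm (ψ (φ z)), add_assoc, z2_add_self, add_zero]

lemma Dom.van {Δ : Set (Finset ι)} {Δ' : Set (Finset κ)} (h : Dom Δ Δ') {n : ℕ}
    (hv : Van Δ' n) : Van Δ n := by
  obtain ⟨φ, h1, h2⟩ := h.pull (n := n)
  intro z hz hz0
  exact h2 z hz hz0 (hv _ (h1 z hz hz0).1 (h1 z hz hz0).2)

lemma Dom.one {Δ : Set (Finset ι)} {Δ' : Set (Finset κ)} (h : Dom Δ Δ') {n : ℕ}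
    (hv : One Δ' n) : One Δ n := by
  obtain ⟨φ, h1, h2⟩ := h.pull (n := n)
  intro z hz hz0 z' hz' hz0'
  rcases hv _ (h1 z hz hz0).1 (h1 z hz hz0).2 _ (h1 z' hz' hz0').1 (h1 z' hz' hz0').2 with h | h | h
  · exact Or.inl (h2 z hz hz0 h)
  · exact Or.inr (Or.inl (h2 z' hz' hz0' h))
  · refine Or.inr (Or.inr (h2 _ (add_mem hz hz') (by rw [map_add, hz0, hz0', add_zero]) ?_))
    rw [map_add]; exact h

end trans

end CM

/-! ### Part 4: germs and cones -/
namespace CM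

open Module Submodule
set_option linter.unusedSectionVars false

section germ

/-- local homeomorphism of pointed sets -/
def LH {E E' : Type*} [TopologicalSpace E] [TopologicalSpace E'] (X : Set E) (x : E) (Y : Set E')
    (y : E') : Prop :=
  ∃ (p : E → E') (q : E' → E) (U : Set E) (V : Set E'), IsOpen U ∧ IsOpen V ∧ x ∈ U ∧ y ∈ V ∧
    x ∈ X ∧ y ∈ Y ∧ ContinuousOn p (X ∩ U) ∧ ContinuousOn q (Y ∩ V) ∧
    (∀ u ∈ X ∩ U, p u ∈ Y) ∧ (∀ v ∈ Y ∩ V, q v ∈ X) ∧ p x = y ∧ q y = x ∧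
    (∀ u ∈ X ∩ U, p u ∈ V → q (p u) = u) ∧ (∀ v ∈ Y ∩ V, q v ∈ U → p (q v) = v)

variable {E E' E'' : Type*} [TopologicalSpace E] [TopologicalSpace E'] [TopologicalSpace E'']
  {X : Set E} {x : E} {Y : Set E'} {y : E'} {Z : Set E''} {z : E''}

lemma LH.symm (h : LH X x Y y) : LH Y y X x := by
  obtain ⟨p, q, U, V, h1, h2, h3, h4, h5, h6, h7, h8, h9, h10, h11, h12, h13, h14⟩ := h
  exact ⟨q, p, V, U, h2, h1, h4, h3, h6, h5, h8, h7, h10, h9, h12, h11, h14, h13⟩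

lemma LH.trans (h : LH X x Y y) (h' : LH Y y Z z) : LH X x Z z := by
  obtain ⟨p, q, U, V, hU, hV, h3, h4, h5, h6, h7, h8, h9, h10, h11, h12, h13, h14⟩ := h
  obtain ⟨p', q', U', V', hU', hV', h3', h4', h5', h6', h7', h8', h9', h10', h11', h12', h13',
    h14'⟩ := h'
  obtain ⟨u, hu, hu'⟩ := continuousOn_iff'.1 h7 (U' ∩ V) (hU'.inter hV)
  obtain ⟨v, hv, hv'⟩ := continuousOn_iff'.1 h8' (U' ∩ V) (hU'.inter hV)
  have ku : ∀ w ∈ X ∩ (u ∩ U), w ∈ X ∩ U ∧ p w ∈ Y ∧ p w ∈ U' ∧ p w ∈ V := by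
    rintro w ⟨w1, w2, w3⟩
    have : w ∈ p ⁻¹' (U' ∩ V) ∩ (X ∩ U) := by rw [hu']; exact ⟨w2, w1, w3⟩
    exact ⟨⟨w1, w3⟩, h9 w ⟨w1, w3⟩, this.1.1, this.1.2⟩
  have kv : ∀ w ∈ Z ∩ (v ∩ V'), w ∈ Z ∩ V' ∧ q' w ∈ Y ∧ q' w ∈ U' ∧ q' w ∈ V := by
    rintro w ⟨w1, w2, w3⟩
    have : w ∈ q' ⁻¹' (U' ∩ V) ∩ (Z ∩ V') := by rw [hv']; exact ⟨w2, w1, w3⟩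
    exact ⟨⟨w1, w3⟩, h10' w ⟨w1, w3⟩, this.1.1, this.1.2⟩
  refine ⟨p' ∘ p, q ∘ q', u ∩ U, v ∩ V', hu.inter hU, hv.inter hV', ?_, ?_, h5, h6', ?_, ?_, ?_, ?_,
    ?_, ?_, ?_, ?_⟩
  · have : x ∈ p ⁻¹' (U' ∩ V) ∩ (X ∩ U) := ⟨by
      rw [Set.mem_preimage, h11]; exact ⟨h3', h4⟩, h5, h3⟩
    rw [hu'] at this
    exact ⟨this.1, h3⟩
  · have : z ∈ q' ⁻¹' (U' ∩ V) ∩ (Z ∩ V') := ⟨by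
      rw [Set.mem_preimage, h12']; exact ⟨h3', h4⟩, h6', h4'⟩
    rw [hv'] at this
    exact ⟨this.1, h4'⟩
  · exact h7'.comp (h7.mono fun w hw => (ku w hw).1) fun w hw => ⟨(ku w hw).2.1, (ku w hw).2.2.1⟩
  · exact h8.comp (h8'.mono fun w hw => (kv w hw).1) fun w hw => ⟨(kv w hw).2.1, (kv w hw).2.2.2⟩
  · exact fun w hw => h9' _ ⟨(ku w hw).2.1, (ku w hw).2.2.1⟩
  · exact fun w hw => h10 _ ⟨(kv w hw).2.1, (kv w hw).2.2.2⟩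
  · simp [h11, h11']
  · simp [h12, h12']
  · intro w hw hw'
    have k := ku w hw
    simp only [Function.comp_apply] at hw' ⊢
    rw [h13' _ ⟨k.2.1, k.2.2.1⟩ hw'.2, h13 _ k.1 k.2.2.2]
  · intro w hw hw'
    have k := kv w hw
    simp only [Function.comp_apply] at hw' ⊢
    rw [h14 _ ⟨k.2.1, k.2.2.2⟩ hw'.2, h14' _ k.1 k.2.2.1]

end germ

section cone
variable {ι κ : Type*} [Fintype ι] [DecidableEq ι] [Fintype κ] [DecidableEq κ]

/-- the cone on a simplicial complex -/
def cone (Δ : Set (Finset ι)) : Set (ι → ℝ) :=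
  {y | (∀ i, 0 ≤ y i) ∧ ∃ S ∈ Δ, ∀ i ∉ S, y i = 0}

/-- normalisation -/
noncomputable def nrm (y : ι → ℝ) : ι → ℝ := (∑ i, y i)⁻¹ • y

lemma cone_smul {Δ : Set (Finset ι)} {y : ι → ℝ} (hy : y ∈ cone Δ) {t : ℝ} (ht : 0 ≤ t) :
    t • y ∈ cone Δ := by
  obtain ⟨h1, S, hS, h2⟩ := hy
  exact ⟨fun i => mul_nonneg ht (h1 i), S, hS, fun i hi => by simp [h2 i hi]⟩

lemma cone_sum {Δ : Set (Finset ι)} {y : ι → ℝ} (hy : y ∈ cone Δ) : 0 ≤ ∑ i, y i :=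
  Finset.sum_nonneg fun i _ => hy.1 i

lemma cone_sum_pos {Δ : Set (Finset ι)} {y : ι → ℝ} (hy : y ∈ cone Δ) (h0 : y ≠ 0) :
    0 < ∑ i, y i := by
  refine lt_of_le_of_ne (cone_sum hy) (fun h => h0 ?_)
  have := (Finset.sum_eq_zero_iff_of_nonneg (fun i _ => hy.1 i)).1 h.symm
  funext i; exact this i (Finset.mem_univ i)

lemma nrm_mem {Δ : Set (Finset ι)} {y : ι → ℝ} (hy : y ∈ cone Δ) (h0 : y ≠ 0) :
    nrm y ∈ gr Δ := by
  have h := cone_sum_pos hy h0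
  obtain ⟨h1, S, hS, h2⟩ := hy
  refine gs_gr hS ⟨⟨fun i => mul_nonneg (inv_nonneg.2 h.le) (h1 i), ?_⟩, fun i hi => by
    simp [nrm, h2 i hi]⟩
  simp only [nrm, Pi.smul_apply, smul_eq_mul]
  rw [← Finset.mul_sum, inv_mul_cancel₀ h.ne']

lemma gr_cone {Δ : Set (Finset ι)} {y : ι → ℝ} (hy : y ∈ gr Δ) : y ∈ cone Δ := by
  simp only [gr, Set.mem_iUnion] at hy
  obtain ⟨S, hS, h⟩ := hy
  exact ⟨h.1.1, S, hS, h.2⟩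

lemma norm_le_sum {Δ : Set (Finset ι)} {y : ι → ℝ} (hy : y ∈ cone Δ) : ‖y‖ ≤ ∑ i, y i := by
  rw [pi_norm_le_iff_of_nonneg (cone_sum hy)]
  intro i
  rw [Real.norm_of_nonneg (hy.1 i)]
  exact Finset.single_le_sum (fun i _ => hy.1 i) (Finset.mem_univ i)

lemma sum_nrm {y : ι → ℝ} (h : ∑ i, y i ≠ 0) : ∑ i, nrm y i = 1 := by
  simp only [nrm, Pi.smul_apply, smul_eq_mul]
  rw [← Finset.mul_sum, inv_mul_cancel₀ h]

lemma nrm_cont {Z : Type*} [TopologicalSpace Z] {s : Set Z} {f : Z → ι → ℝ} (hf : ContinuousOn f s)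
    (h : ∀ z ∈ s, ∑ i, f z i ≠ 0) : ContinuousOn (fun z => nrm (f z)) s := by
  unfold nrm
  refine ContinuousOn.smul (ContinuousOn.inv₀ ?_ h) hf
  exact continuousOn_finsetSum _ fun i _ => (continuous_apply i).comp_continuousOn hf

theorem LH.dom {Δ : Set (Finset ι)} {Δ' : Set (Finset κ)} (hΔ : DC Δ) (hΔ' : DC Δ')
    (h : LH (cone Δ) 0 (cone Δ') 0) : Dom Δ Δ' := by
  obtain ⟨p, q, U, V, hU, hV, h3, h4, h5, h6, h7, h8, h9, h10, h11, h12, h13, h14⟩ := h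
  have cq : ∀ᶠ v in nhdsWithin (0 : κ → ℝ) (cone Δ' ∩ V), q v ∈ U := by
    have := (h8 0 ⟨h6, h4⟩).preimage_mem_nhdsWithin (t := U) (by
      rw [h12]; exact hU.mem_nhds h3)
    exact this
  rw [eventually_nhdsWithin_iff] at cq
  obtain ⟨ρ', hρ', kq⟩ := Metric.eventually_nhds_iff.1 (cq.and (hV.mem_nhds h4))
  have cp : ∀ᶠ v in nhdsWithin (0 : ι → ℝ) (cone Δ ∩ U), p v ∈ V ∧ ∑ i, p v i ≤ ρ' / 2 := by
    have hW : V ∩ {w | ∑ i, w i < ρ' / 2} ∈ nhds (0 : κ → ℝ) := by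
      refine Filter.inter_mem (hV.mem_nhds h4) (IsOpen.mem_nhds ?_ (by simp; linarith))
      exact isOpen_lt (by fun_prop) continuous_const
    have := (h7 0 ⟨h5, h3⟩).preimage_mem_nhdsWithin (t := V ∩ {w | ∑ i, w i < ρ' / 2}) (by
      rw [h11]; exact hW)
    filter_upwards [this] with v hv
    exact ⟨hv.1, hv.2.le⟩
  rw [eventually_nhdsWithin_iff] at cp
  obtain ⟨ρ, hρ, kp⟩ := Metric.eventually_nhds_iff.1 (cp.and (hU.mem_nhds h3))
  set r := ρ / 2 with hr
  set r' := ρ' / 2 with hr'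
  have hr0 : 0 < r := by positivity
  have hr0' : 0 < r' := by positivity
  have Q : ∀ v ∈ cone Δ', ∑ i, v i ≤ r' → v ∈ cone Δ' ∩ V ∧ q v ∈ cone Δ ∧ q v ∈ U := by
    intro v hv hs
    have h1 := norm_le_sum hv
    have := kq (y := v) (by rw [dist_zero_right]; linarith)
    have hvV : v ∈ V := this.2
    exact ⟨⟨hv, hvV⟩, h10 v ⟨hv, hvV⟩, this.1 ⟨hv, hvV⟩⟩
  have P : ∀ v ∈ cone Δ, ∑ i, v i ≤ r → v ∈ cone Δ ∩ U ∧ p v ∈ cone Δ' ∧ p v ∈ V ∧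
      ∑ i, p v i ≤ r' := by
    intro v hv hs
    have h1 := norm_le_sum hv
    have := kp (y := v) (by rw [dist_zero_right]; linarith)
    have hvU : v ∈ U := this.2
    exact ⟨⟨hv, hvU⟩, h9 v ⟨hv, hvU⟩, this.1 ⟨hv, hvU⟩⟩
  have Q0 : ∀ v ∈ cone Δ', ∑ i, v i ≤ r' → v ≠ 0 → q v ≠ 0 := by
    intro v hv hs h0 e
    have k := Q v hv hs
    apply h0
    rw [← h14 v k.1 k.2.2, e, h11]
  have P0 : ∀ v ∈ cone Δ, ∑ i, v i ≤ r → v ≠ 0 → p v ≠ 0 := by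
    intro v hv hs h0 e
    have k := P v hv hs
    apply h0
    rw [← h13 v k.1 k.2.2.1, e, h12]
  have gne : ∀ {α : Type _} [Fintype α] (s : ℝ) (x : α → ℝ), 0 < s → ∑ i, x i = 1 →
      ∑ i, (s • x) i = s := by
    intro α _ s x hs hx
    simp only [Pi.smul_apply, smul_eq_mul]
    rw [← Finset.mul_sum, hx, mul_one]
  have gne' : ∀ (s : ℝ) (x : κ → ℝ), 0 < s → ∑ i, x i = 1 →
      ∑ i, (s • x) i = s := by
    intro s x hs hx
    simp only [Pi.smul_apply, smul_eq_mul]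
    rw [← Finset.mul_sum, hx, mul_one]
  have S1 : ∀ x ∈ gr Δ, r • x ∈ cone Δ ∧ ∑ i, (r • x) i ≤ r ∧ r • x ≠ 0 := by
    intro x hx
    have hs := gne r x hr0 (gr_std hx).2
    refine ⟨cone_smul (gr_cone hx) hr0.le, hs.le, fun e => ?_⟩
    rw [e] at hs; simp at hs; linarith
  have S2 : ∀ x ∈ gr Δ', r' • x ∈ cone Δ' ∧ ∑ i, (r' • x) i ≤ r' ∧ r' • x ≠ 0 := by
    intro x hx
    have hs := gne' r' x hr0' (gr_std hx).2
    refine ⟨cone_smul (gr_cone hx) hr0'.le, hs.le, fun e => ?_⟩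
    rw [e] at hs; simp at hs; linarith
  have cf : ContinuousOn (fun x => p (r • x)) (gr Δ) := by
    refine h7.comp (by fun_prop) ?_
    intro x hx
    exact (P _ (S1 x hx).1 (S1 x hx).2.1).1
  let arg : ℝ → (ι → ℝ) → (κ → ℝ) := fun t x =>
    (t + (1 - t) * r' * (∑ i, p (r • x) i)⁻¹) • p (r • x)
  have harg : ∀ t ∈ Set.Icc (0 : ℝ) 1, ∀ x ∈ gr Δ,
      arg t x ∈ cone Δ' ∧ ∑ i, arg t x i ≤ r' ∧ arg t x ≠ 0 := by
    intro t ht x hx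
    have k := P _ (S1 x hx).1 (S1 x hx).2.1
    have k0 := P0 _ (S1 x hx).1 (S1 x hx).2.1 (S1 x hx).2.2
    have ks := cone_sum_pos k.2.1 k0
    have t0 := ht.1
    have t1 : 0 ≤ 1 - t := by linarith [ht.2]
    have hpos : 0 < t + (1 - t) * r' * (∑ i, p (r • x) i)⁻¹ := by
      rcases t0.lt_or_eq with h | h
      · positivity
      · rw [← h]; simp only [sub_zero, one_mul, zero_add]; positivity
    refine ⟨cone_smul k.2.1 hpos.le, ?_, ?_⟩
    · simp only [arg, Pi.smul_apply, smul_eq_mul]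
      rw [← Finset.mul_sum, add_mul, mul_assoc, inv_mul_cancel₀ ks.ne']
      have := k.2.2.2
      nlinarith
    · exact smul_ne_zero hpos.ne' k0
  refine domination hΔ hΔ' (fun x => nrm (p (r • x))) (fun x => nrm (q (r' • x))) ?_ ?_ ?_ ?_
    (fun t x => nrm (q (arg t x))) ?_ ?_ ?_ ?_
  · refine nrm_cont cf ?_
    intro x hx
    exact (cone_sum_pos (P _ (S1 x hx).1 (S1 x hx).2.1).2.1
      (P0 _ (S1 x hx).1 (S1 x hx).2.1 (S1 x hx).2.2)).ne'
  · intro x hx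
    exact nrm_mem (P _ (S1 x hx).1 (S1 x hx).2.1).2.1
      (P0 _ (S1 x hx).1 (S1 x hx).2.1 (S1 x hx).2.2)
  · refine nrm_cont (h8.comp (by fun_prop) ?_) ?_
    · intro x hx
      exact (Q _ (S2 x hx).1 (S2 x hx).2.1).1
    · intro x hx
      exact (cone_sum_pos (Q _ (S2 x hx).1 (S2 x hx).2.1).2.1
        (Q0 _ (S2 x hx).1 (S2 x hx).2.1 (S2 x hx).2.2)).ne'
  · intro x hx
    exact nrm_mem (Q _ (S2 x hx).1 (S2 x hx).2.1).2.1
      (Q0 _ (S2 x hx).1 (S2 x hx).2.1 (S2 x hx).2.2)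
  · refine nrm_cont (h8.comp ?_ ?_) ?_
    · have c1 : ContinuousOn (fun z : ℝ × (ι → ℝ) => p (r • z.2)) (Set.Icc 0 1 ×ˢ gr Δ) :=
        cf.comp continuousOn_snd (fun z hz => hz.2)
      have c2 : ContinuousOn (fun z : ℝ × (ι → ℝ) => (∑ i, p (r • z.2) i)⁻¹)
          (Set.Icc 0 1 ×ˢ gr Δ) := by
        refine ContinuousOn.inv₀ (continuousOn_finsetSum _ fun i _ =>
          (continuous_apply i).comp_continuousOn c1) ?_
        intro z hz
        exact (cone_sum_pos (P _ (S1 _ hz.2).1 (S1 _ hz.2).2.1).2.1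
          (P0 _ (S1 _ hz.2).1 (S1 _ hz.2).2.1 (S1 _ hz.2).2.2)).ne'
      exact ContinuousOn.smul (continuousOn_fst.add (((continuousOn_const.sub
        continuousOn_fst).mul continuousOn_const).mul c2)) c1
    · intro z hz
      have k := harg z.1 hz.1 z.2 hz.2
      exact (Q _ k.1 k.2.1).1
    · intro z hz
      have k := harg z.1 hz.1 z.2 hz.2
      exact (cone_sum_pos (Q _ k.1 k.2.1).2.1 (Q0 _ k.1 k.2.1 k.2.2)).ne'
  · intro t ht x hx
    have k := harg t ht x hx
    exact nrm_mem (Q _ k.1 k.2.1).2.1 (Q0 _ k.1 k.2.1 k.2.2)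
  · intro x hx
    have e : arg 0 x = r' • nrm (p (r • x)) := by simp [arg, nrm, smul_smul]
    simp only [e]
  · intro x hx
    have e : arg 1 x = p (r • x) := by simp [arg]
    have k := P _ (S1 x hx).1 (S1 x hx).2.1
    simp only [e, h13 _ k.1 k.2.2.1, nrm]
    rw [gne r x hr0 (gr_std hx).2, smul_smul, inv_mul_cancel₀ hr0.ne', one_smul]

end cone

end CM

/-! ### Part 5: links of faces and charts -/
namespace CM

open Module Submodule CubeFace
set_option linter.unusedSectionVars false

section link
variable {a : ℕ}

/-- the centre of a face -/
noncomputable def ctr (F : CubeFace a) : Fin a → ℝ := fun i =>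
  match F i with
  | none => 1 / 2
  | some true => 1
  | some false => 0

/-- the face spanned by a set of directions -/
noncomputable def GS (F : CubeFace a) (S : Finset (Fin a × Bool)) : CubeFace a := by
  classical exact fun i => if ∃ s, (i, s) ∈ S then none else F i

lemma GS_of_mem {F : CubeFace a} {S : Finset (Fin a × Bool)} {i : Fin a} {s : Bool}
    (h : (i, s) ∈ S) : GS F S i = none := by
  unfold GS; rw [if_pos ⟨s, h⟩]

lemma GS_of_notMem {F : CubeFace a} {S : Finset (Fin a × Bool)} {i : Fin a}
    (h : ∀ s, (i, s) ∉ S) : GS F S i = F i := by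
  unfold GS; rw [if_neg]; push Not; exact h

lemma GS_mono {F : CubeFace a} {S T : Finset (Fin a × Bool)} (h : S ⊆ T) : GS F S ≤ GS F T := by
  intro i
  by_cases hT : ∃ s, (i, s) ∈ T
  · obtain ⟨s, hs⟩ := hT
    exact Or.inl (GS_of_mem hs)
  · push Not at hT
    right
    rw [GS_of_notMem hT, GS_of_notMem fun s hs => hT s (h hs)]

/-- the local complex at the centre of a face -/
def lk (M : Set (CubeFace a)) (F : CubeFace a) : Set (Finset (Fin a × Bool)) :=
  {S | (∀ i, ¬((i, true) ∈ S ∧ (i, false) ∈ S)) ∧ (∀ i b, F i = some b → (i, b) ∉ S) ∧ GS F S ∈ M}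

lemma lk_DC {M : Set (CubeFace a)} (hM : IsSubcomplex M) {F : CubeFace a} (hF : F ∈ M) :
    DC (lk M F) := by
  refine ⟨⟨by simp, by simp, ?_⟩, ?_⟩
  · have : GS F ∅ = F := by funext i; exact GS_of_notMem (by simp)
    rwa [this]
  · rintro S ⟨h1, h2, h3⟩ T hT
    exact ⟨fun i h => h1 i ⟨hT h.1, hT h.2⟩, fun i b hb h => h2 i b hb (hT h),
      hM.2 _ h3 _ (GS_mono hT)⟩

lemma ctr_bounds (F : CubeFace a) (i : Fin a) : 0 ≤ ctr F i ∧ ctr F i ≤ 1 := by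
  unfold ctr; split <;> norm_num

lemma ctr_mem {M : Set (CubeFace a)} {F : CubeFace a} (hF : F ∈ M) : ctr F ∈ real M := by
  simp only [CubeFace.real, Set.mem_iUnion]
  refine ⟨F, hF, ctr_bounds F, fun i => ⟨fun h => ?_, fun h => ?_⟩⟩ <;> simp [ctr, h]

lemma LH_link {M : Set (CubeFace a)} (hM : IsSubcomplex M) {F : CubeFace a} (hF : F ∈ M) :
    LH (cone (lk M F)) 0 (real M) (ctr F) := by
  classical
  have c0 : ∀ i, F i = none → ctr F i = 1 / 2 := fun i h => by simp [ctr, h]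
  have c1 : ∀ i, F i = some true → ctr F i = 1 := fun i h => by simp [ctr, h]
  have c2 : ∀ i, F i = some false → ctr F i = 0 := fun i h => by simp [ctr, h]
  refine ⟨fun y i => ctr F i + (y (i, true) - y (i, false)),
    fun x j => if j.2 then max (x j.1 - ctr F j.1) 0 else max (ctr F j.1 - x j.1) 0,
    {y | ∀ j, y j < 1 / 4}, {x | ∀ i, |x i - ctr F i| < 1 / 4}, ?_, ?_, ?_, ?_, ?_, ctr_mem hF,
    ?_, ?_, ?_, ?_, ?_, ?_, ?_, ?_⟩
  · simp only [Set.ofPred_forall]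
    exact isOpen_iInter_of_finite fun j => isOpen_lt (by fun_prop) continuous_const
  · simp only [Set.ofPred_forall]
    exact isOpen_iInter_of_finite fun j => isOpen_lt (by fun_prop) continuous_const
  · intro j; norm_num
  · intro j; simp
  · exact ⟨fun i => le_rfl, ∅, (lk_DC hM hF).1, fun i _ => rfl⟩
  · fun_prop
  · refine Continuous.continuousOn ?_
    refine continuous_pi fun j => ?_
    split_ifs <;> fun_prop
  · -- into `real M`
    rintro y ⟨⟨h0, S, ⟨s1, s2, s3⟩, hS⟩, hy⟩
    simp only [CubeFace.real, Set.mem_iUnion]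
    have hb : ∀ i, (0 ≤ ctr F i + (y (i, true) - y (i, false)) ∧
        ctr F i + (y (i, true) - y (i, false)) ≤ 1) := by
      intro i
      have t0 := h0 (i, true)
      have t1 := h0 (i, false)
      have t2 := hy (i, true)
      have t3 := hy (i, false)
      rcases hFi : F i with _ | _ | _
      · rw [c0 i hFi]; constructor <;> linarith
      · rw [c2 i hFi, hS _ (s2 i false hFi)]; constructor <;> linarith
      · rw [c1 i hFi, hS _ (s2 i true hFi)]; constructor <;> linarith
    refine ⟨GS F S, s3, hb, fun i => ?_⟩
    by_cases hi : ∃ s, (i, s) ∈ S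
    · obtain ⟨s, hs⟩ := hi
      rw [GS_of_mem hs]; simp
    · push Not at hi
      rw [GS_of_notMem hi]
      dsimp only
      rw [hS _ (hi true), hS _ (hi false)]
      exact ⟨fun h => by rw [c2 i h]; ring, fun h => by rw [c1 i h]; ring⟩
  · -- into the cone
    rintro x ⟨hx, hV⟩
    simp only [CubeFace.real, Set.mem_iUnion] at hx
    obtain ⟨G, hG, hb, hxG⟩ := hx
    refine ⟨fun j => ?_, Finset.univ.filter (fun j : Fin a × Bool =>
      if j.2 then 0 < x j.1 - ctr F j.1 else 0 < ctr F j.1 - x j.1), ⟨?_, ?_, ?_⟩, ?_⟩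
    · dsimp only; split_ifs <;> exact le_max_right _ _
    · intro i
      simp only [Finset.mem_filter, Finset.mem_univ, true_and, if_true, Bool.false_eq_true, if_false]
      rintro ⟨h1, h2⟩; linarith
    · intro i b hFi
      have hbi := hb i
      rcases b with _ | _
      · simp only [Finset.mem_filter, Finset.mem_univ, true_and, Bool.false_eq_true, if_false]
        rw [c2 i hFi]; linarith
      · simp only [Finset.mem_filter, Finset.mem_univ, true_and, if_true]
        rw [c1 i hFi]; linarith
    · refine hM.2 G hG _ fun i => ?_
      have hVi := abs_lt.1 (hV i)
      have hGi := hxG i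
      rcases hGe : G i with _ | g
      · exact Or.inl rfl
      right
      have hxe : x i = if g then 1 else 0 := by
        rcases g with _ | _
        · simpa using hGi.1 hGe
        · simpa using hGi.2 hGe
      have hFi : F i = some g := by
        rcases hFe : F i with _ | _ | _ <;> rcases g with _ | _ <;>
          simp only [c0 i, c1 i, c2 i, hFe, hxe, if_true, Bool.false_eq_true, if_false] at hVi ⊢ <;>
          norm_num at hVi
      rw [GS_of_notMem, hFi]
      intro s hs
      have hce : ctr F i = if g then 1 else 0 := by
        rcases g with _ | _
        · simpa using c2 i hFi
        · simpa using c1 i hFi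
      simp only [Finset.mem_filter, Finset.mem_univ, true_and, hxe, hce, sub_self, lt_irrefl,
        ite_self] at hs
    · rintro ⟨i, s⟩ hj
      simp only [Finset.mem_filter, Finset.mem_univ, true_and] at hj
      rcases s with _ | _ <;>
        simp only [Bool.false_eq_true, if_false, if_true, not_lt] at hj ⊢ <;>
        exact max_eq_right hj
  · funext i; simp
  · funext j; simp
  · rintro y ⟨⟨h0, S, ⟨s1, s2, s3⟩, hS⟩, hy⟩ -
    funext ⟨i, s⟩
    have t0 := h0 (i, true)
    have t1 := h0 (i, false)
    have : y (i, true) = 0 ∨ y (i, false) = 0 := by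
      by_contra hn
      push Not at hn
      apply s1 i
      constructor
      · by_contra h; exact hn.1 (hS _ h)
      · by_contra h; exact hn.2 (hS _ h)
    rcases s with _ | _ <;> simp only [Bool.false_eq_true, if_false, if_true] <;>
      rcases this with h | h <;> rw [h]
    · rw [max_eq_left] <;> linarith
    · rw [max_eq_right] <;> linarith
    · rw [max_eq_right] <;> linarith
    · rw [max_eq_left] <;> linarith
  · rintro x - -
    funext i
    simp only [Bool.false_eq_true, if_false, if_true]
    rcases le_total (x i) (ctr F i) with h | h
    · rw [max_eq_right (by linarith), max_eq_left (by linarith)]; ring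
    · rw [max_eq_left (by linarith), max_eq_right (by linarith)]; ring

lemma LH_chart {X : Set (Fin a → ℝ)} {m : ℕ} (h : IsCompactManifold (↥X) m) {x : Fin a → ℝ}
    (hx : x ∈ X) : ∃ c : EuclideanSpace ℝ (Fin m), LH X x Set.univ c := by
  classical
  obtain ⟨-, ⟨hc⟩⟩ := h
  let e := chartAt (EuclideanSpace ℝ (Fin m)) (⟨x, hx⟩ : X)
  obtain ⟨U, hU, hUe⟩ := isOpen_induced_iff.1 e.open_source
  have mU : ∀ u (hu : u ∈ X), u ∈ U ↔ (⟨u, hu⟩ : X) ∈ e.source := by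
    intro u hu; rw [← hUe]; rfl
  refine ⟨e ⟨x, hx⟩, fun u => if hu : u ∈ X then e ⟨u, hu⟩ else 0, fun v => (e.symm v : Fin a → ℝ),
    U, e.target, hU, e.open_target, ?_, ?_, hx, trivial, ?_, ?_, fun _ _ => trivial,
    fun v _ => (e.symm v).2, by simp [hx], ?_, ?_, ?_⟩
  · rw [mU x hx]; exact mem_chart_source _ _
  · exact mem_chart_target _ _
  · rw [continuousOn_iff_continuous_domRestrict]
    have h1 := continuousOn_iff_continuous_domRestrict.1 e.continuousOn
    let g : ↥(X ∩ U) → ↥e.source := fun u => ⟨⟨u.1, u.2.1⟩, (mU _ u.2.1).1 u.2.2⟩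
    have hg : Continuous g := by
      refine Continuous.subtype_mk (Continuous.subtype_mk continuous_subtype_val _) _
    have := h1.comp hg
    refine this.congr fun u => ?_
    simp [g, u.2.1]
  · exact continuous_subtype_val.comp_continuousOn (e.continuousOn_symm.mono (by simp))
  · dsimp only
    rw [e.left_inv (mem_chart_source _ _)]
  · rintro u ⟨hu, huU⟩ -
    simp only [hu, dif_pos]
    rw [e.left_inv ((mU u hu).1 huU)]
  · rintro v ⟨-, hv⟩ -
    simp only [(e.symm v).2, dif_pos, Subtype.coe_eta]
    exact e.right_inv hv

/-- boundary of a simplex -/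
def bdS (m : ℕ) : Set (Finset (Fin (m + 1))) := {S | S ≠ Finset.univ}

lemma LH_model {m : ℕ} (c : EuclideanSpace ℝ (Fin m)) :
    LH Set.univ c (cone (bdS m)) 0 := by
  classical
  let ext : EuclideanSpace ℝ (Fin m) → Fin (m + 1) → ℝ := fun t =>
    Fin.cons 0 (fun i => t i - c i)
  let mn : (Fin (m + 1) → ℝ) → ℝ := fun s => Finset.univ.inf' Finset.univ_nonempty s
  have hmn : ∀ s i, mn s ≤ s i := fun s i => Finset.inf'_le _ (Finset.mem_univ i)
  have hmn' : ∀ s, ∃ i, mn s = s i := fun s => by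
    obtain ⟨i, -, h⟩ := Finset.exists_mem_eq_inf' (s := Finset.univ) Finset.univ_nonempty s
    exact ⟨i, h⟩
  have hext : Continuous ext := by
    refine continuous_pi fun j => ?_
    refine Fin.cases ?_ (fun i => ?_) j
    · simp only [ext, Fin.cons_zero]; fun_prop
    · simp only [ext, Fin.cons_succ]; fun_prop
  have hmnc : Continuous mn := by
    refine Continuous.finset_inf'_apply _ fun i _ => continuous_apply i
  have e0 : ∀ s : Fin (m + 1) → ℝ, (∃ i, s i = 0) → (∀ i, 0 ≤ s i) → ∀ r : ℝ,
      mn (fun i => s i - r) = - r := by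
    intro s ⟨i, hi⟩ h0 r
    apply le_antisymm
    · have := hmn (fun i => s i - r) i
      simpa [hi] using this
    · obtain ⟨j, hj⟩ := hmn' (fun i => s i - r)
      rw [hj]; have := h0 j; linarith
  have cone0 : (0 : Fin (m + 1) → ℝ) ∈ cone (bdS m) := by
    refine ⟨fun _ => le_rfl, ∅, ?_, fun _ _ => rfl⟩
    intro h
    have : (0 : Fin (m + 1)) ∈ (∅ : Finset (Fin (m + 1))) := by rw [h]; simp
    simp at this
  refine ⟨fun t j => ext t j - mn (ext t), fun y => WithLp.toLp 2 (fun i => y i.succ - y 0 + c i),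
    Set.univ, Set.univ, isOpen_univ, isOpen_univ, trivial, trivial, trivial, cone0, ?_, ?_, ?_,
    fun _ _ => trivial, ?_, ?_, ?_, ?_⟩
  · refine Continuous.continuousOn ?_
    refine continuous_pi fun j => ?_
    exact ((continuous_apply j).comp hext).sub (hmnc.comp hext)
  · refine Continuous.continuousOn ?_
    refine (PiLp.continuous_toLp 2 _).comp ?_
    fun_prop
  · rintro t -
    obtain ⟨j, hj⟩ := hmn' (ext t)
    refine ⟨fun i => by have := hmn (ext t) i; dsimp only; linarith, Finset.univ.erase j, ?_, ?_⟩
    · intro h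
      have : j ∈ Finset.univ.erase j := by rw [h]; simp
      simp at this
    · intro i hi
      have : i = j := by simpa using hi
      subst this
      dsimp only; linarith
  · have : ext c = fun i => (0 : Fin (m + 1) → ℝ) i - 0 := by
      funext j
      refine Fin.cases ?_ (fun i => ?_) j <;> simp [ext]
    funext j
    dsimp only
    rw [this, e0 0 ⟨0, rfl⟩ (fun _ => le_rfl)]
    simp
  · ext i; simp
  · rintro t - -
    ext i
    simp [ext]
  · rintro y ⟨⟨h0, S, hS, hy⟩, -⟩ -
    have : ext (WithLp.toLp 2 (fun i => y i.succ - y 0 + c i)) = fun i => y i - y 0 := by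
      funext j
      refine Fin.cases ?_ (fun i => ?_) j <;> simp [ext]
    have hz : ∃ i, y i = 0 := by
      by_contra hn
      push Not at hn
      apply hS
      ext i
      simp only [Finset.mem_univ, iff_true]
      by_contra hi; exact hn i (hy i hi)
    funext j
    dsimp only
    rw [this, e0 y hz h0]
    simp

lemma bdS_DC (m : ℕ) : DC (bdS m) := by
  refine ⟨?_, ?_⟩
  · intro h
    have : (0 : Fin (m + 1)) ∈ (∅ : Finset (Fin (m + 1))) := by rw [h]; simp
    simp at this
  · intro S hS T hT h
    apply hS
    rw [h] at hT
    exact Finset.univ_subset_iff.1 hT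

lemma bdS_van {m n : ℕ} (h : n < m) : Van (bdS m) n := by
  intro z hz hz0
  refine ⟨scone 0 z, LS_map _ _ (fun S hS => ?_) hz, by rw [scone_formula, hz0]; simp⟩
  rw [scone_sg]
  split_ifs with hi
  · exact zero_mem _
  · have hc : (insert 0 S).card = n + 1 := by rw [Finset.card_insert_of_notMem hi, hS.2]
    refine sg_mem ⟨fun e => ?_, hc⟩
    rw [e] at hc
    simp at hc; omega

lemma bdS_cyc {m : ℕ} {z} (hz : z ∈ LS (sx (bdS m) m)) (hz0 : sbd z = 0) :
    z = 0 ∨ z = sdel Finset.univ := by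
  have h1 : scone 0 z ∈ LS {(Finset.univ : Finset (Fin (m + 1)))} := by
    refine LS_map _ _ (fun S hS => ?_) hz
    rw [scone_sg]
    split_ifs with hi
    · exact zero_mem _
    · refine sg_mem ?_
      rw [Set.mem_singleton_iff, ← Finset.card_eq_iff_eq_univ, Finset.card_insert_of_notMem hi,
        hS.2]
      simp
  have h2 : sbd (scone 0 z) = z := by rw [scone_formula, hz0]; simp
  have h3 : scone 0 z = Finsupp.single Finset.univ (scone 0 z Finset.univ) := by
    ext S
    by_cases hS : S = Finset.univ
    · subst hS; simp
    · rw [Finsupp.single_eq_of_ne hS]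
      by_contra hn
      exact hS (by simpa using (Finsupp.mem_supported _ _).1 h1 (Finsupp.mem_support_iff.2 hn))
  rcases z2_cases (scone 0 z Finset.univ) with h | h
  · left; rw [← h2, h3, h]; simp
  · right; rw [← h2, h3, h, sbd_sg]

lemma bdS_top {m : ℕ} {w : Finset (Fin (m + 1)) →₀ ZMod 2} (hw : w ∈ LS (sx (bdS m) (m + 1))) :
    w = 0 := by
  have : sx (bdS m) (m + 1) = ∅ := by
    ext S
    simp only [sx, bdS, Set.mem_ofPred_eq, Set.mem_empty_iff_false, iff_false, not_and]
    intro h h'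
    apply h
    rw [← Finset.card_eq_iff_eq_univ, h']; simp
  rw [this] at hw
  simpa using hw

lemma bdS_one (m : ℕ) : One (bdS m) m := by
  intro z hz hz0 z' hz' hz0'
  rcases bdS_cyc hz hz0 with h | h
  · exact Or.inl ⟨0, zero_mem _, by rw [h, map_zero]⟩
  rcases bdS_cyc hz' hz0' with h' | h'
  · exact Or.inr (Or.inl ⟨0, zero_mem _, by rw [h', map_zero]⟩)
  · exact Or.inr (Or.inr ⟨0, zero_mem _, by rw [h, h', z2_add_self, map_zero]⟩)

lemma bdS_notVan (m : ℕ) : ¬ Van (bdS m) m := by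
  intro h
  obtain ⟨w, hw, hw0⟩ := h (sdel Finset.univ) (by
    refine Finsupp.supported_mono ?_ (sdel_mem Finset.univ)
    rintro T ⟨-, h2⟩
    simp only [Finset.card_univ, Fintype.card_fin] at h2
    refine ⟨?_, by omega⟩
    rintro rfl
    simp at h2) (sbd_sdel _)
  rw [bdS_top hw, map_zero] at hw0
  have h1 : (sdel (Finset.univ : Finset (Fin (m + 1)))) (Finset.univ.erase 0) = 1 := by
    rw [sdel, Finsupp.finsetSum_apply, Finset.sum_eq_single_of_mem 0 (Finset.mem_univ _)]
    · simp
    · intro i _ hi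
      rw [Finsupp.single_eq_of_ne]
      intro e
      have : i ∈ (Finset.univ.erase 0 : Finset (Fin (m + 1))) := by simp [hi]
      rw [e] at this
      simp at this
  rw [← hw0] at h1
  simp at h1

/-- local homology of a manifold at a face -/
theorem lk_local {M : Set (CubeFace a)} (hM : IsSubcomplex M) {m : ℕ}
    (hm : IsCompactManifold (↥(real M)) m) {F : CubeFace a} (hF : F ∈ M) :
    (∀ n < m, Van (lk M F) n) ∧ One (lk M F) m ∧ ¬ Van (lk M F) m := by
  obtain ⟨c, hc⟩ := LH_chart hm (ctr_mem hF)
  have h := ((LH_link hM hF).trans hc).trans (LH_model c)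
  have d1 := h.dom (lk_DC hM hF) (bdS_DC m)
  have d2 := h.symm.dom (bdS_DC m) (lk_DC hM hF)
  exact ⟨fun n hn => d1.van (bdS_van hn), d1.one (bdS_one m), fun hv => bdS_notVan m (d2.van hv)⟩

end link

end CM

/-! ### Part 6: cubical chains and stars -/
namespace CM

open Module Submodule CubeFace
set_option linter.unusedSectionVars false

section cub
variable {a : ℕ}

instance : Finite (CubeFace a) := inferInstanceAs (Finite (Fin a → Option Bool))

/-- free a coordinate -/
def fr (F : CubeFace a) (i : Fin a) : CubeFace a := Function.update (β := fun _ => Option Bool) F i none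

lemma fr_same (F : CubeFace a) (i : Fin a) : fr F i i = none :=
  Function.update_self (β := fun _ => Option Bool) i none F

lemma fr_ne (F : CubeFace a) {i j : Fin a} (h : j ≠ i) : fr F i j = F j :=
  Function.update_of_ne (β := fun _ => Option Bool) h none F

lemma le_fr (F : CubeFace a) (i : Fin a) : F ≤ fr F i := by
  intro j
  by_cases h : j = i
  · subst h; exact Or.inl (fr_same F j)
  · exact Or.inr (fr_ne F h).symm

lemma none_of_le {F G : CubeFace a} (h : F ≤ G) {i : Fin a} (hi : F i = none) : G i = none := by
  rcases h i with h | h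
  · exact h
  · rw [← h, hi]

lemma eq_of_le {F G : CubeFace a} (h : F ≤ G) {i : Fin a} {b : Bool} (hi : G i = some b) :
    F i = some b := by
  rcases h i with h | h
  · rw [hi] at h; simp at h
  · rw [h, hi]

open Classical in
lemma dim_eq (F : CubeFace a) : dim F = (Finset.univ.filter (fun i => F i = none)).card := by
  unfold dim; congr

lemma dim_fr {F : CubeFace a} {i : Fin a} (h : F i ≠ none) : dim (fr F i) = dim F + 1 := by
  classical
  rw [dim_eq, dim_eq, ← Finset.card_insert_of_notMem (a := i) (by simp [h])]
  congr 1
  ext j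
  by_cases hj : j = i
  · subst hj; simp [fr_same]
  · simp [hj, fr_ne F hj]

lemma dim_mono {F G : CubeFace a} (h : F ≤ G) : dim F ≤ dim G := by
  classical
  rw [dim_eq, dim_eq]
  refine Finset.card_le_card fun i hi => ?_
  simp only [Finset.mem_filter, Finset.mem_univ, true_and] at hi ⊢
  exact none_of_le h hi

lemma eq_of_le_dim {F G : CubeFace a} (h : F ≤ G) (hd : dim G ≤ dim F) : F = G := by
  classical
  rw [dim_eq, dim_eq] at hd
  have := Finset.eq_of_subset_of_card_le (s := Finset.univ.filter (fun i => F i = none))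
    (t := Finset.univ.filter (fun i => G i = none)) (fun i hi => by
      simp only [Finset.mem_filter, Finset.mem_univ, true_and] at hi ⊢
      exact none_of_le h hi) hd
  funext i
  rcases h i with h' | h'
  · rw [h']
    have hi : i ∈ Finset.univ.filter (fun i => G i = none) := by simp [h']
    rw [← this] at hi
    simpa using hi
  · exact h'

open Classical in
/-- coefficients of the boundary -/
noncomputable def bd (c : CubeFace a → ZMod 2) (F : CubeFace a) : ZMod 2 :=
  ∑ i, if F i = none then 0 else c (fr F i)

lemma bd_add (c c' : CubeFace a → ZMod 2) (F : CubeFace a) : bd (c + c') F = bd c F + bd c' F := by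
  unfold bd
  rw [← Finset.sum_add_distrib]
  refine Finset.sum_congr rfl fun i _ => ?_
  split_ifs <;> simp

lemma bd_congr {c c' : CubeFace a → ZMod 2} {F : CubeFace a}
    (h : ∀ G, F ≤ G → dim G = dim F + 1 → c G = c' G) : bd c F = bd c' F := by
  unfold bd
  refine Finset.sum_congr rfl fun i _ => ?_
  split_ifs with hi
  · rfl
  · exact h _ (le_fr F i) (dim_fr hi)

lemma bd_zero_of {c : CubeFace a → ZMod 2} {F : CubeFace a}
    (h : ∀ G, F ≤ G → dim G = dim F + 1 → c G = 0) : bd c F = 0 := by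
  rw [bd_congr (c' := 0) h]
  unfold bd; simp

lemma bd_bd (c : CubeFace a → ZMod 2) (F : CubeFace a) : bd (bd c) F = 0 := by
  classical
  unfold bd
  have e : ∀ i, (if F i = none then 0 else ∑ j, if fr F i j = none then 0 else c (fr (fr F i) j)) =
      ∑ j, if F i = none ∨ F j = none ∨ i = j then 0 else c (fr (fr F i) j) := by
    intro i
    by_cases hi : F i = none
    · simp [hi]
    · rw [if_neg hi]
      refine Finset.sum_congr rfl fun j _ => ?_
      by_cases hj : j = i
      · subst hj; simp [fr_same]
      · have hj' : i ≠ j := fun h => hj h.symm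
        simp [fr_ne F hj, hi, hj']
  rw [Finset.sum_congr rfl fun i _ => e i]
  refine (Fintype.sum_prod_type (f := fun p : Fin a × Fin a =>
      if F p.1 = none ∨ F p.2 = none ∨ p.1 = p.2 then 0 else c (fr (fr F p.1) p.2))).symm.trans ?_
  refine Finset.sum_involution (fun p _ => (p.2, p.1)) ?_ ?_ ?_ ?_
  · rintro ⟨i, j⟩ -
    have : fr (fr F i) j = fr (fr F j) i := by
      funext k
      by_cases h1 : k = i
      · subst h1
        rw [fr_same]
        by_cases h2 : k = j
        · subst h2; rw [fr_same]
        · rw [fr_ne _ h2, fr_same]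
      · rw [fr_ne (fr F j) h1]
        by_cases h2 : k = j
        · subst h2; rw [fr_same, fr_same]
        · rw [fr_ne _ h2, fr_ne _ h2, fr_ne _ h1]
    by_cases h : F i = none ∨ F j = none ∨ i = j
    · have h' : F j = none ∨ F i = none ∨ j = i := by tauto
      simp only [h, h', if_true, add_zero]
    · have h' : ¬ (F j = none ∨ F i = none ∨ j = i) := by tauto
      simp only [h, h', if_false, this]
      exact z2_add_self _
  · rintro ⟨i, j⟩ - h e
    simp only [Prod.mk.injEq] at e
    apply h
    simp [e.1]
  · simp
  · simp

/-- chains supported in a set of faces -/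
def Ch (U : Set (CubeFace a)) (d : ℕ) (c : CubeFace a → ZMod 2) : Prop :=
  ∀ F, c F ≠ 0 → F ∈ U ∧ dim F = d

/-- vanishing of (locally finite) homology of an open set -/
def HV (U : Set (CubeFace a)) (d : ℕ) : Prop :=
  ∀ c, Ch U d c → (∀ F ∈ U, bd c F = 0) → ∃ w, Ch U (d + 1) w ∧ ∀ F ∈ U, bd w F = c F

/-- the open star -/
def st (M : Set (CubeFace a)) (F : CubeFace a) : Set (CubeFace a) := {G | G ∈ M ∧ F ≤ G}

/-- no opposite directions -/
def Vd (F : CubeFace a) (S : Finset (Fin a × Bool)) : Prop :=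
  (∀ i, ¬((i, true) ∈ S ∧ (i, false) ∈ S)) ∧ (∀ i b, F i = some b → (i, b) ∉ S)

/-- all directions of the face are used -/
def Full (F : CubeFace a) (S : Finset (Fin a × Bool)) : Prop := ∀ i, F i = none → ∃ s, (i, s) ∈ S

lemma Vd.both {F : CubeFace a} {S : Finset (Fin a × Bool)} (h : Vd F S) {i : Fin a} {s : Bool}
    (h1 : (i, s) ∈ S) (h2 : (i, !s) ∈ S) : False := by
  rcases s with _ | _
  · exact h.1 i ⟨h2, h1⟩
  · exact h.1 i ⟨h1, h2⟩

lemma Vd.mono {F : CubeFace a} {S T : Finset (Fin a × Bool)} (h : Vd F T) (hS : S ⊆ T) : Vd F S :=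
  ⟨fun i hi => h.1 i ⟨hS hi.1, hS hi.2⟩, fun i b hb hi => h.2 i b hb (hS hi)⟩

lemma sbd_apply {ι : Type*} [Fintype ι] [DecidableEq ι] (z : Finset ι →₀ ZMod 2) (T : Finset ι) :
    sbd z T = ∑ j, if j ∈ T then 0 else z (insert j T) := by
  have : (Finsupp.lapply T) ∘ₗ sbd = (∑ j, if j ∈ T then 0 else Finsupp.lapply (insert j T) :
      (Finset ι →₀ ZMod 2) →ₗ[ZMod 2] ZMod 2) := by
    apply lc_ext
    intro S
    simp only [LinearMap.comp_apply, sbd_sg, sdel, Finsupp.lapply_apply, Finsupp.finsetSum_apply,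
      LinearMap.sum_apply]
    rw [← Finset.sum_subset (Finset.subset_univ S)]
    · refine Finset.sum_congr rfl fun i hi => ?_
      by_cases hT : i ∈ T
      · rw [if_pos hT, LinearMap.zero_apply, Finsupp.single_eq_of_ne]
        rintro rfl; simp at hT
      · rw [if_neg hT, Finsupp.lapply_apply, Finsupp.single_apply, Finsupp.single_apply]
        congr 1
        rw [eq_iff_iff]
        constructor
        · rintro rfl; rw [Finset.insert_erase hi]
        · intro h; rw [h, Finset.erase_insert hT]
    · intro i _ hi
      split_ifs with hT
      · rfl
      · rw [Finsupp.lapply_apply, Finsupp.single_eq_of_ne]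
        rintro rfl; simp at hi
  have h2 := LinearMap.congr_fun this z
  simp only [LinearMap.comp_apply, Finsupp.lapply_apply, LinearMap.sum_apply] at h2
  rw [h2]
  refine Finset.sum_congr rfl fun j _ => ?_
  split_ifs <;> simp

lemma GS_insert (F : CubeFace a) (T : Finset (Fin a × Bool)) (i : Fin a) (s : Bool) :
    GS F (insert (i, s) T) = fr (GS F T) i := by
  funext k
  by_cases hk : k = i
  · subst hk
    rw [GS_of_mem (s := s) (by simp), fr_same]
  · rw [fr_ne _ hk]
    by_cases h : ∃ t, (k, t) ∈ T
    · obtain ⟨t, ht⟩ := h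
      rw [GS_of_mem ht, GS_of_mem (s := t) (by simp [ht])]
    · push Not at h
      rw [GS_of_notMem h, GS_of_notMem]
      intro t ht
      rcases Finset.mem_insert.1 ht with h' | h'
      · simp only [Prod.mk.injEq] at h'; exact hk h'.1
      · exact h t h'

lemma le_GS (F : CubeFace a) (T : Finset (Fin a × Bool)) : F ≤ GS F T := by
  intro i
  by_cases h : ∃ t, (i, t) ∈ T
  · obtain ⟨t, ht⟩ := h
    exact Or.inl (GS_of_mem ht)
  · push Not at h
    exact Or.inr (GS_of_notMem h).symm

lemma card_GS {F : CubeFace a} {S : Finset (Fin a × Bool)} (h : Vd F S) (h' : Full F S) :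
    S.card = dim (GS F S) := by
  classical
  rw [dim_eq, ← Finset.card_image_of_injOn (s := S) (f := Prod.fst)]
  · congr 1
    ext i
    simp only [Finset.mem_image, Prod.exists, exists_and_right, exists_eq_right, Finset.mem_filter,
      Finset.mem_univ, true_and]
    constructor
    · rintro ⟨s, hs⟩; exact GS_of_mem hs
    · intro hi
      by_contra hn
      push Not at hn
      rw [GS_of_notMem hn] at hi
      obtain ⟨s, hs⟩ := h' i hi
      exact hn s hs
  · rintro ⟨i, s⟩ hs ⟨j, t⟩ ht e
    simp only at e
    subst e
    by_contra hne
    have : t = !s := by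
      revert hne; rcases s with _ | _ <;> rcases t with _ | _ <;> simp
    subst this
    exact h.both hs ht

open Classical in
/-- cubical to simplicial chains -/
noncomputable def tau (F : CubeFace a) (c : CubeFace a → ZMod 2) : Finset (Fin a × Bool) →₀ ZMod 2 :=
  Finsupp.equivFunOnFinite.symm (fun S => if Vd F S ∧ Full F S then c (GS F S) else 0)

open Classical in
lemma tau_apply (F : CubeFace a) (c : CubeFace a → ZMod 2) (S) :
    tau F c S = if Vd F S ∧ Full F S then c (GS F S) else 0 := rfl

open Classical in
lemma sum_eq_bd (F : CubeFace a) (T : Finset (Fin a × Bool)) (z : Finset (Fin a × Bool) → ZMod 2)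
    (c : CubeFace a → ZMod 2) (G : CubeFace a)
    (h : ∀ i, (∑ s, if (i, s) ∈ T then 0 else z (insert (i, s) T)) =
      if G i = none then 0 else c (fr G i)) :
    (∑ j, if j ∈ T then 0 else z (insert j T)) = bd c G := by
  rw [Fintype.sum_prod_type, bd]
  exact Finset.sum_congr rfl fun i _ => h i

lemma tau_cycle {M : Set (CubeFace a)} (hM : IsSubcomplex M) {F : CubeFace a}
    {c : CubeFace a → ZMod 2} {d : ℕ}
    (hc : Ch (st M F) d c) (hcy : ∀ G ∈ st M F, bd c G = 0) : sbd (tau F c) = 0 := by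
  classical
  have hcy' : ∀ G, F ≤ G → bd c G = 0 := by
    intro G hG
    by_cases h : G ∈ M
    · exact hcy G ⟨h, hG⟩
    · refine bd_zero_of fun G' h1 _ => ?_
      by_contra hn
      exact h (hM.2 _ (hc _ hn).1.1 _ h1)
  ext T
  rw [sbd_apply, Finsupp.coe_zero, Pi.zero_apply]
  by_cases hV : Vd F T
  swap
  · refine Finset.sum_eq_zero fun j _ => ?_
    split_ifs
    · rfl
    · rw [tau_apply, if_neg]
      exact fun h => hV (h.1.mono (Finset.subset_insert _ _))
  by_cases hf : Full F T
  · refine (sum_eq_bd F T _ _ _ fun i => ?_).trans (hcy' (GS F T) (le_GS F T))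
    rw [Fintype.sum_bool]
    by_cases hi : ∃ s, (i, s) ∈ T
    · obtain ⟨s, hs⟩ := hi
      rw [if_pos (GS_of_mem hs)]
      have : ∀ t, (if (i, t) ∈ T then 0 else tau F c (insert (i, t) T)) = 0 := by
        intro t
        split_ifs with ht
        · rfl
        · rw [tau_apply, if_neg]
          rintro ⟨h, -⟩
          have : t = !s := by
            rcases s with _ | _ <;> rcases t with _ | _ <;> simp_all
          subst this
          exact h.both (i := i) (s := s) (by simp [hs]) (by simp)
      rw [this, this, add_zero]
    · push Not at hi
      have hF : F i ≠ none := fun h => by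
        obtain ⟨s, hs⟩ := hf i h; exact hi s hs
      obtain ⟨b, hb⟩ := Option.ne_none_iff_exists'.1 hF
      rw [if_neg (hi true), if_neg (hi false), if_neg (by rw [GS_of_notMem hi]; exact hF)]
      have k1 : tau F c (insert (i, b) T) = 0 := by
        rw [tau_apply, if_neg]
        rintro ⟨h, -⟩
        exact h.2 i b hb (by simp)
      have k2 : tau F c (insert (i, !b) T) = c (fr (GS F T) i) := by
        rw [tau_apply, if_pos, GS_insert]
        refine ⟨⟨?_, ?_⟩, ?_⟩
        · rintro j ⟨h1, h2⟩
          rw [Finset.mem_insert] at h1 h2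
          by_cases hj : j = i
          · subst hj
            simp only [hi, or_false, Prod.mk.injEq, true_and] at h1 h2
            rw [← h2] at h1; simp at h1
          · simp only [Prod.mk.injEq, hj, false_and, false_or] at h1 h2
            exact hV.1 j ⟨h1, h2⟩
        · intro j t hj h1
          rw [Finset.mem_insert] at h1
          rcases h1 with h1 | h1
          · simp only [Prod.mk.injEq] at h1
            rw [h1.1, hb, h1.2] at hj
            simp at hj
          · exact hV.2 j t hj h1
        · intro j hj
          obtain ⟨s, hs⟩ := hf j hj
          exact ⟨s, by simp [hs]⟩
      rcases b with _ | _
      · rw [k1, ← k2, add_zero]; rfl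
      · rw [k1, ← k2, zero_add]; rfl
  · unfold Full at hf
    push Not at hf
    obtain ⟨i0, hi0, hn⟩ := hf
    rw [Fintype.sum_prod_type, Finset.sum_eq_single_of_mem i0 (Finset.mem_univ _)]
    · rw [Fintype.sum_bool, if_neg (hn _), if_neg (hn _)]
      have : tau F c (insert (i0, true) T) = tau F c (insert (i0, false) T) := by
        have key : ∀ s, Vd F (insert (i0, s) T) ∧ Full F (insert (i0, s) T) ↔
            ∀ i, F i = none → i = i0 ∨ ∃ s, (i, s) ∈ T := by
          intro s
          constructor
          · rintro ⟨-, h⟩ i hi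
            obtain ⟨t, ht⟩ := h i hi
            rcases Finset.mem_insert.1 ht with h' | h'
            · simp only [Prod.mk.injEq] at h'; exact Or.inl h'.1
            · exact Or.inr ⟨t, h'⟩
          · intro h
            refine ⟨⟨?_, ?_⟩, ?_⟩
            · rintro j ⟨h1, h2⟩
              rw [Finset.mem_insert] at h1 h2
              by_cases hj : j = i0
              · subst hj
                simp only [hn, or_false, Prod.mk.injEq, true_and] at h1 h2
                rw [← h2] at h1; simp at h1
              · simp only [Prod.mk.injEq, hj, false_and, false_or] at h1 h2
                exact hV.1 j ⟨h1, h2⟩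
            · intro j t hj h1
              rw [Finset.mem_insert] at h1
              rcases h1 with h1 | h1
              · simp only [Prod.mk.injEq] at h1
                rw [h1.1, hi0] at hj
                simp at hj
              · exact hV.2 j t hj h1
            · intro j hj
              rcases h j hj with rfl | ⟨t, ht⟩
              · exact ⟨s, by simp⟩
              · exact ⟨t, by simp [ht]⟩
        rw [tau_apply, tau_apply, GS_insert, GS_insert]
        simp only [key]
      rw [this]; exact z2_add_self _
    · intro i _ hi
      refine Finset.sum_eq_zero fun s _ => ?_
      split_ifs
      · rfl
      · rw [tau_apply, if_neg]
        rintro ⟨-, h⟩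
        obtain ⟨t, ht⟩ := h i0 hi0
        rcases Finset.mem_insert.1 ht with h' | h'
        · simp only [Prod.mk.injEq] at h'; exact hi h'.1.symm
        · exact hn t h'

lemma tau_mem {M : Set (CubeFace a)} {F : CubeFace a} {c : CubeFace a → ZMod 2} {d : ℕ}
    (hc : Ch (st M F) d c) : tau F c ∈ LS (sx (lk M F) d) := by
  classical
  rw [LS, Finsupp.mem_supported]
  intro S hS
  rw [Finset.mem_coe, Finsupp.mem_support_iff, tau_apply] at hS
  split_ifs at hS with h
  · have := hc _ hS
    exact ⟨⟨h.1.1, h.1.2, this.1.1⟩, by rw [card_GS h.1 h.2, this.2]⟩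
  · exact absurd rfl hS

open Classical in
/-- positive simplex of a face -/
noncomputable def SP (F G : CubeFace a) : Finset (Fin a × Bool) :=
  Finset.univ.filter (fun j => (F j.1 = none ∧ j.2 = true) ∨ (F j.1 = some (!j.2) ∧ G j.1 = none))

lemma mem_SP {F G : CubeFace a} {i : Fin a} {s : Bool} :
    (i, s) ∈ SP F G ↔ (F i = none ∧ s = true) ∨ (F i = some (!s) ∧ G i = none) := by
  simp [SP]

lemma SP_Vd (F G : CubeFace a) : Vd F (SP F G) := by
  constructor
  · rintro i ⟨h1, h2⟩
    rw [mem_SP] at h1 h2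
    rcases h1 with h1 | h1 <;> rcases h2 with h2 | h2 <;> simp [h1.1] at h2
  · intro i b hb h
    rw [mem_SP, hb] at h
    rcases h with h | h
    · simp at h
    · rcases b with _ | _ <;> simp at h

lemma SP_Full (F G : CubeFace a) : Full F (SP F G) := fun i hi => ⟨true, mem_SP.2 (Or.inl ⟨hi, rfl⟩)⟩

lemma GS_SP {F G : CubeFace a} (h : F ≤ G) : GS F (SP F G) = G := by
  funext i
  by_cases hi : ∃ s, (i, s) ∈ SP F G
  · obtain ⟨s, hs⟩ := hi
    rw [GS_of_mem hs]
    rcases mem_SP.1 hs with h' | h'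
    · exact (none_of_le h h'.1).symm
    · exact h'.2.symm
  · push Not at hi
    rw [GS_of_notMem hi]
    rcases h i with h' | h'
    · rcases hF : F i with _ | b
      · exact h'.symm
      · exact absurd (mem_SP.2 (Or.inr ⟨by simpa using hF, h'⟩)) (hi (!b))
    · exact h'

lemma SP_fr {F G : CubeFace a} {i : Fin a} {g : Bool} (hF : F i = some g) :
    SP F (fr G i) = insert (i, !g) (SP F G) := by
  ext ⟨j, s⟩
  rw [Finset.mem_insert, mem_SP, mem_SP]
  by_cases hj : j = i
  · subst hj
    rw [hF, fr_same]
    rcases s with _ | _ <;> rcases g with _ | _ <;> simp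
  · rw [fr_ne _ hj]
    simp [hj]

lemma kappa_bd {M : Set (CubeFace a)} {F : CubeFace a} {d : ℕ}
    {w : Finset (Fin a × Bool) →₀ ZMod 2} (hw : w ∈ LS (sx (lk M F) d)) {G : CubeFace a}
    (hG : F ≤ G) : bd (fun G => w (SP F G)) G = sbd w (SP F G) := by
  classical
  have hwV : ∀ S, ¬ Vd F S → w S = 0 := by
    intro S hS
    by_contra hn
    have := (Finsupp.mem_supported _ _).1 hw (Finsupp.mem_support_iff.2 hn)
    exact hS ⟨this.1.1, this.1.2.1⟩
  rw [sbd_apply]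
  refine (sum_eq_bd F _ _ _ _ fun i => ?_).symm
  rw [Fintype.sum_bool]
  rcases hGi : G i with _ | g
  · simp only [if_true]
    have hs : ∃ s, (i, s) ∈ SP F G := by
      rcases hF : F i with _ | b
      · exact ⟨true, mem_SP.2 (Or.inl ⟨hF, rfl⟩)⟩
      · exact ⟨!b, mem_SP.2 (Or.inr ⟨by simpa using hF, hGi⟩)⟩
    obtain ⟨s, hs⟩ := hs
    have : ∀ t, (if (i, t) ∈ SP F G then 0 else w (insert (i, t) (SP F G))) = 0 := by
      intro t
      split_ifs with ht
      · rfl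
      · apply hwV
        intro h
        have : t = !s := by
          rcases s with _ | _ <;> rcases t with _ | _ <;> simp_all
        subst this
        exact h.both (i := i) (s := s) (by simp [hs]) (by simp)
    rw [this, this, add_zero]
  · have hF := eq_of_le hG hGi
    have hn : ∀ s, (i, s) ∉ SP F G := by
      intro s hs
      rcases mem_SP.1 hs with h | h
      · rw [hF] at h; simp at h
      · rw [hGi] at h; simp at h
    rw [if_neg (hn _), if_neg (hn _), if_neg (by simp), SP_fr hF]
    have k : w (insert (i, g) (SP F G)) = 0 := hwV _ fun h => h.2 i g hF (by simp)
    rcases g with _ | _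
    · rw [k, add_zero]; rfl
    · rw [k, zero_add]; rfl

open Classical in
/-- simplicial to cubical -/
lemma kappa_spec {M : Set (CubeFace a)} {F : CubeFace a} {d : ℕ}
    {w : Finset (Fin a × Bool) →₀ ZMod 2} (hw : w ∈ LS (sx (lk M F) d)) :
    Ch (st M F) d (fun G => if F ≤ G then w (SP F G) else 0) ∧
    ∀ G ∈ st M F, bd (fun G => if F ≤ G then w (SP F G) else 0) G = sbd w (SP F G) := by
  constructor
  · intro G hG
    simp only at hG
    split_ifs at hG with h
    · have := (Finsupp.mem_supported _ _).1 hw (Finsupp.mem_support_iff.2 hG)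
      rw [sx, Set.mem_ofPred_eq, card_GS (SP_Vd F G) (SP_Full F G), GS_SP h] at this
      have h2 := this.1.2.2
      rw [GS_SP h] at h2
      exact ⟨⟨h2, h⟩, this.2⟩
    · exact absurd rfl hG
  · rintro G ⟨-, hG⟩
    rw [← kappa_bd hw hG]
    refine bd_congr fun G' h _ => ?_
    rw [if_pos (hG.trans h)]

lemma tau_SP {F G : CubeFace a} {c : CubeFace a → ZMod 2} (h : F ≤ G) : tau F c (SP F G) = c G := by
  classical
  rw [tau_apply, if_pos ⟨SP_Vd F G, SP_Full F G⟩, GS_SP h]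

lemma bounds_of_tau {M : Set (CubeFace a)} {F : CubeFace a} {c : CubeFace a → ZMod 2} {d : ℕ}
    (h : ∃ w ∈ LS (sx (lk M F) (d + 1)), sbd w = tau F c) :
    ∃ w, Ch (st M F) (d + 1) w ∧ ∀ G ∈ st M F, bd w G = c G := by
  classical
  obtain ⟨w, hw, hw0⟩ := h
  have := kappa_spec hw
  refine ⟨_, this.1, fun G hG => ?_⟩
  rw [this.2 G hG, hw0, tau_SP hG.2]

lemma star_HV {M : Set (CubeFace a)} (hM : IsSubcomplex M) {F : CubeFace a} {d : ℕ}
    (h : Van (lk M F) d) : HV (st M F) d := fun _ hc hcy =>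
  bounds_of_tau (h _ (tau_mem hc) (tau_cycle hM hc hcy))

lemma tau_add (F : CubeFace a) (c c' : CubeFace a → ZMod 2) : tau F (c + c') = tau F c + tau F c' := by
  classical
  ext S
  rw [Finsupp.add_apply, tau_apply, tau_apply, tau_apply]
  split_ifs <;> simp

lemma Ch.add {U : Set (CubeFace a)} {d : ℕ} {c c' : CubeFace a → ZMod 2} (h : Ch U d c)
    (h' : Ch U d c') : Ch U d (c + c') := by
  intro F hF
  by_cases h0 : c F = 0
  · refine h' F fun h1 => hF ?_
    simp [h0, h1]
  · exact h F h0

lemma star_one {M : Set (CubeFace a)} (hM : IsSubcomplex M) {F : CubeFace a} {m : ℕ}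
    (hd : ∀ F ∈ M, dim F ≤ m) (h : One (lk M F) m) {c c' : CubeFace a → ZMod 2}
    (hc : Ch (st M F) m c) (hcy : ∀ G ∈ st M F, bd c G = 0)
    (hc' : Ch (st M F) m c') (hcy' : ∀ G ∈ st M F, bd c' G = 0) :
    c = 0 ∨ c' = 0 ∨ c = c' := by
  have key : ∀ c, Ch (st M F) m c → (∃ w ∈ LS (sx (lk M F) (m + 1)), sbd w = tau F c) → c = 0 := by
    intro c hc hw
    obtain ⟨w, hw, hw'⟩ := bounds_of_tau hw
    have : w = 0 := by
      funext G
      by_contra hn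
      have := hw G hn
      have := hd G this.1.1
      simp only [Pi.zero_apply] at *
      omega
    subst this
    funext G
    by_contra hn
    have h1 := hw' G (hc G hn).1
    apply hn
    rw [← h1]
    exact bd_zero_of fun _ _ _ => rfl
  rcases h _ (tau_mem hc) (tau_cycle hM hc hcy) _ (tau_mem hc') (tau_cycle hM hc' hcy') with h | h | h
  · exact Or.inl (key c hc h)
  · exact Or.inr (Or.inl (key c' hc' h))
  · right; right
    rw [← tau_add] at h
    exact z2_eq_of_add (key _ (hc.add hc') h)

end cub

end CM

/-! ### Part 7: combinatorial manifolds -/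
namespace CM

open Module Submodule CubeFace
set_option linter.unusedSectionVars false

section cman
variable {a : ℕ}

open Classical in
/-- fundamental chain -/
noncomputable def fund (M : Set (CubeFace a)) (m : ℕ) : CubeFace a → ZMod 2 :=
  fun G => if G ∈ M ∧ dim G = m then 1 else 0

lemma exists_fr {F G : CubeFace a} (h : F ≤ G) (hne : F ≠ G) :
    ∃ i, F i ≠ none ∧ fr F i ≤ G ∧ G i = none := by
  have : ∃ i, F i ≠ G i := by
    by_contra hn
    push Not at hn
    exact hne (funext hn)
  obtain ⟨i, hi⟩ := this
  have hG : G i = none := (h i).resolve_right hi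
  refine ⟨i, fun h' => hi (h'.trans hG.symm), fun j => ?_, hG⟩
  by_cases hj : j = i
  · subst hj; exact Or.inl hG
  · rw [fr_ne _ hj]; exact h j

lemma exists_fr_eq {F G : CubeFace a} (h : F ≤ G) (hd : dim G = dim F + 1) :
    ∃ i, F i ≠ none ∧ G = fr F i := by
  obtain ⟨i, hi, hle, -⟩ := exists_fr h (by rintro rfl; omega)
  exact ⟨i, hi, (eq_of_le_dim hle (by rw [dim_fr hi, hd])).symm⟩

lemma fr_inj {F : CubeFace a} {i j : Fin a} (hi : F i ≠ none) (h : fr F i = fr F j) : i = j := by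
  by_contra hn
  have := congrFun h i
  rw [fr_same, fr_ne _ hn] at this
  exact hi this.symm

/-- combinatorial manifold -/
structure CMan (M : Set (CubeFace a)) (m : ℕ) : Prop where
  sub : IsSubcomplex M
  dim_le : ∀ F ∈ M, dim F ≤ m
  pure : ∀ F ∈ M, ∃ G ∈ M, F ≤ G ∧ dim G = m
  hv : ∀ F ∈ M, ∀ d < m, HV (st M F) d
  cyc : ∀ F ∈ M, bd (fund M m) F = 0
  one : ∀ F ∈ M, ∀ c, Ch (st M F) m c → (∀ G ∈ st M F, bd c G = 0) →
    c = 0 ∨ ∀ G ∈ st M F, c G = fund M m G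

lemma bd_single_zero {F G : CubeFace a} {c : CubeFace a → ZMod 2} (h : Ch Set.univ (dim F) c)
    (hG : dim F ≤ dim G) : bd c G = 0 := by
  refine bd_zero_of fun G' _ hd => ?_
  by_contra hn
  have := (h _ hn).2
  omega

open Classical in
lemma bd_two {F : CubeFace a} {i j : Fin a} (hi : F i ≠ none) (hj : F j ≠ none) (hij : i ≠ j) :
    bd (fun G => if G = fr F i ∨ G = fr F j then 1 else 0) F = 0 := by
  unfold bd
  rw [Finset.sum_eq_add_of_mem i j (Finset.mem_univ _) (Finset.mem_univ _) hij]
  · rw [if_neg hi, if_neg hj]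
    simp only [true_or, or_true, if_true]
    exact z2_add_self _
  · intro l _ hl
    by_cases hl0 : F l = none
    · rw [if_pos hl0]
    · rw [if_neg hl0]; dsimp only; rw [if_neg]
      rintro (h | h)
      · exact hl.1 (fr_inj hl0 h)
      · exact hl.2 (fr_inj hl0 h)

theorem cman_of {M : Set (CubeFace a)} (hM : IsSubcomplex M) {m : ℕ}
    (hd : ∀ F ∈ M, dim F ≤ m) (hm : IsCompactManifold (↥(real M)) m) : CMan M m := by
  classical
  have hv : ∀ F ∈ M, ∀ d < m, HV (st M F) d := fun F hF d hdm =>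
    star_HV hM ((lk_local hM hm hF).1 d hdm)
  have pure : ∀ F ∈ M, ∃ G ∈ M, F ≤ G ∧ dim G = m := by
    intro F hF
    have : ∃ G, (G ∈ M ∧ F ≤ G) ∧ ∀ G', (G' ∈ M ∧ F ≤ G') → dim G' ≤ dim G := by
      have hfin : ({G | G ∈ M ∧ F ≤ G} : Set (CubeFace a)).Finite := Set.toFinite _
      obtain ⟨G, hG, hmax⟩ := hfin.exists_maximalFor dim _ ⟨F, hF, le_refl F⟩
      refine ⟨G, hG, fun G' hG' => ?_⟩
      rcases le_total (dim G') (dim G) with h | h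
      · exact h
      · exact hmax hG' h
    obtain ⟨G, ⟨hG, hFG⟩, hmax⟩ := this
    refine ⟨G, hG, hFG, ?_⟩
    by_contra hne
    have hlt : dim G < m := lt_of_le_of_ne (hd G hG) hne
    obtain ⟨w, hw, hw'⟩ := hv G hG _ hlt (fun H => if H = G then 1 else 0) (by
      intro H hH
      simp only at hH
      split_ifs at hH with h
      · subst h; exact ⟨⟨hG, le_refl _⟩, rfl⟩
      · exact absurd rfl hH) (by
      rintro H ⟨hH, hGH⟩
      refine bd_zero_of fun H' h1 h2 => if_neg ?_
      rintro rfl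
      have := dim_mono hGH
      omega)
    have := hw' G ⟨hG, le_refl _⟩
    rw [if_pos rfl, bd_zero_of] at this
    · simp at this
    · intro H hH hdH
      by_contra hn
      have := hmax H ⟨(hw H hn).1.1, hFG.trans hH⟩
      omega
  have cyc : ∀ F ∈ M, bd (fund M m) F = 0 := by
    intro F hF
    by_cases hdF : dim F + 1 = m
    swap
    · refine bd_zero_of fun G _ hdG => if_neg ?_
      rintro ⟨-, h⟩
      omega
    set I := Finset.univ.filter (fun i => F i ≠ none ∧ fr F i ∈ M) with hI
    have hsum : bd (fund M m) F = (I.card : ZMod 2) := by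
      rw [bd, hI, Finset.card_filter]
      push_cast
      refine Finset.sum_congr rfl fun i _ => ?_
      by_cases hi : F i = none
      · simp [hi]
      · rw [if_neg hi, fund, dim_fr hi]
        simp [hi, hdF]
    have h1 : I.Nonempty := by
      obtain ⟨G, hG, hFG, hdG⟩ := pure F hF
      obtain ⟨i, hi, rfl⟩ := exists_fr_eq hFG (by omega)
      exact ⟨i, by simp [hI, hi, hG]⟩
    have h2 : I.card ≠ 1 := by
      intro hc
      obtain ⟨i0, h0⟩ := Finset.card_eq_one.1 hc
      have hi0 : F i0 ≠ none ∧ fr F i0 ∈ M := by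
        have : i0 ∈ I := by rw [h0]; simp
        simpa [hI] using this
      obtain ⟨b, hb⟩ := Option.ne_none_iff_exists'.1 hi0.1
      apply (lk_local hM hm hF).2.2
      intro z hz hz0
      refine scone_acyclic (i := (i0, !b)) ?_ hz hz0
      rintro S ⟨k1, k2, k3⟩
      refine ⟨?_, ?_, ?_⟩
      · rintro j ⟨h1, h2⟩
        rw [Finset.mem_insert] at h1 h2
        by_cases hj : j = i0
        · subst hj
          have := k2 j b hb
          have kk := k1 j
          rcases b with _ | _ <;> simp_all
        · simp only [Prod.mk.injEq, hj, false_and, false_or] at h1 h2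
          exact k1 j ⟨h1, h2⟩
      · intro j t hj h1
        rw [Finset.mem_insert] at h1
        rcases h1 with h1 | h1
        · simp only [Prod.mk.injEq] at h1
          rw [h1.1, hb, h1.2] at hj
          simp at hj
        · exact k2 j t hj h1
      · rw [GS_insert]
        have hle := le_GS F S
        have hdl := hd _ k3
        by_cases hE : F = GS F S
        · rw [← hE]; exact hi0.2
        · have hdd : dim (GS F S) = dim F + 1 := by
            have := dim_mono hle
            by_contra hne
            exact hE (eq_of_le_dim hle (by omega))
          obtain ⟨i, hi, hG⟩ := exists_fr_eq hle hdd
          have : i ∈ I := by simp [hI, hi, ← hG, k3]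
          rw [h0, Finset.mem_singleton] at this
          subst this
          have : fr (GS F S) i = GS F S := by
            rw [hG]
            funext j
            by_cases hj : j = i
            · subst hj; rw [fr_same, fr_same]
            · rw [fr_ne _ hj]
          rw [this]; exact k3
    have h3 : I.card ≤ 2 := by
      by_contra hc
      push Not at hc
      obtain ⟨x, y, z, hx, hy, hz, hxy, hxz, hyz⟩ := Finset.two_lt_card_iff.1 hc
      simp only [hI, Finset.mem_filter, Finset.mem_univ, true_and] at hx hy hz
      have ch : ∀ i j, (F i ≠ none ∧ fr F i ∈ M) → (F j ≠ none ∧ fr F j ∈ M) →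
          Ch (st M F) m (fun G => if G = fr F i ∨ G = fr F j then 1 else 0) := by
        intro i j hi hj G hG
        simp only at hG
        split_ifs at hG with h
        · rcases h with rfl | rfl
          · exact ⟨⟨hi.2, le_fr _ _⟩, by rw [dim_fr hi.1, hdF]⟩
          · exact ⟨⟨hj.2, le_fr _ _⟩, by rw [dim_fr hj.1, hdF]⟩
        · exact absurd rfl hG
      have cy : ∀ i j, (F i ≠ none ∧ fr F i ∈ M) → (F j ≠ none ∧ fr F j ∈ M) → i ≠ j →
          ∀ G ∈ st M F, bd (fun G => if G = fr F i ∨ G = fr F j then 1 else 0) G = 0 := by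
        rintro i j hi hj hij G ⟨hG, hFG⟩
        by_cases hE : F = G
        · subst hE; exact bd_two hi.1 hj.1 hij
        · have : dim F < dim G := by
            by_contra hne
            exact hE (eq_of_le_dim hFG (by omega))
          refine bd_zero_of fun G' _ hdG' => ?_
          by_contra hn
          have := (ch i j hi hj G' hn).2
          omega
      rcases star_one hM hd (lk_local hM hm hF).2.1 (ch x y hx hy) (cy x y hx hy hxy)
        (ch x z hx hz) (cy x z hx hz hxz) with h | h | h
      · have := congrFun h (fr F x); simp at this
      · have := congrFun h (fr F x); simp at this
      · have := congrFun h (fr F y)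
        simp only [or_true, if_true] at this
        rw [if_neg] at this
        · simp at this
        · rintro (h | h)
          · exact hxy (fr_inj hy.1 h).symm
          · exact hyz (fr_inj hy.1 h)
    have h4 : I.card = 2 := by
      have := h1.card_pos
      omega
    rw [hsum, h4]; rfl
  refine ⟨hM, hd, pure, hv, cyc, ?_⟩
  intro F hF c hc hcy
  set φ : CubeFace a → ZMod 2 := fun G => if F ≤ G then fund M m G else 0 with hφ
  have hφc : Ch (st M F) m φ := by
    intro G hG
    simp only [hφ] at hG
    split_ifs at hG with h
    · rw [fund] at hG
      split_ifs at hG with h'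
      · exact ⟨⟨h'.1, h⟩, h'.2⟩
      · exact absurd rfl hG
    · exact absurd rfl hG
  have hφb : ∀ G ∈ st M F, bd φ G = 0 := by
    rintro G ⟨hG, hFG⟩
    rw [← cyc G hG]
    refine bd_congr fun G' h _ => ?_
    simp only [hφ]
    rw [if_pos (hFG.trans h)]
  rcases star_one hM hd (lk_local hM hm hF).2.1 hc hcy hφc hφb with h | h | h
  · exact Or.inl h
  · exfalso
    obtain ⟨G, hG, hFG, hdG⟩ := pure F hF
    have := congrFun h G
    simp only [hφ, Pi.zero_apply] at this
    rw [if_pos hFG, fund, if_pos ⟨hG, hdG⟩] at this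
    simp at this
  · right
    rintro G ⟨hG, hFG⟩
    rw [h]
    simp only [hφ]
    rw [if_pos hFG]

end cman

end CM

/-! ### Part 8: Mayer-Vietoris and duality -/
namespace CM

open Module Submodule CubeFace
set_option linter.unusedSectionVars false

section dual
variable {a : ℕ}

open Classical in
/-- restriction of a chain -/
noncomputable def res (U : Set (CubeFace a)) (c : CubeFace a → ZMod 2) : CubeFace a → ZMod 2 :=
  fun G => if G ∈ U then c G else 0

lemma res_of {U : Set (CubeFace a)} {c : CubeFace a → ZMod 2} {G : CubeFace a} (h : G ∈ U) :
    res U c G = c G := if_pos h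

lemma res_not {U : Set (CubeFace a)} {c : CubeFace a → ZMod 2} {G : CubeFace a} (h : G ∉ U) :
    res U c G = 0 := if_neg h

/-- open subsets -/
def Up (M U : Set (CubeFace a)) : Prop := U ⊆ M ∧ ∀ F ∈ U, ∀ G ∈ M, F ≤ G → G ∈ U

lemma Ch.mono {U V : Set (CubeFace a)} {d : ℕ} {c : CubeFace a → ZMod 2} (h : Ch U d c)
    (hUV : U ⊆ V) : Ch V d c := fun F hF => ⟨hUV (h F hF).1, (h F hF).2⟩

lemma Ch.zero_of {U : Set (CubeFace a)} {d : ℕ} {c : CubeFace a → ZMod 2} (h : Ch U d c)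
    {F : CubeFace a} (hF : F ∉ U) : c F = 0 := by
  by_contra hn
  exact hF (h F hn).1

lemma Ch.res {U : Set (CubeFace a)} {d : ℕ} {c : CubeFace a → ZMod 2} (h : Ch U d c)
    (V : Set (CubeFace a)) : Ch V d (res V c) := by
  intro F hF
  by_cases hV : F ∈ V
  · rw [res_of hV] at hF
    exact ⟨hV, (h F hF).2⟩
  · exact absurd (res_not hV) hF

lemma bd_congr_up {M U : Set (CubeFace a)} (hU : Up M U) {c c' : CubeFace a → ZMod 2} {d d' : ℕ}
    (hc : Ch M d c) (hc' : Ch M d' c') {F : CubeFace a} (hF : F ∈ U)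
    (h : ∀ G ∈ U, F ≤ G → c G = c' G) : bd c F = bd c' F := by
  refine bd_congr fun G hG _ => ?_
  by_cases hGM : G ∈ M
  · exact h G (hU.2 F hF G hGM hG) hG
  · rw [hc.zero_of hGM, hc'.zero_of hGM]

lemma bd_res {M U : Set (CubeFace a)} (hU : Up M U) {c : CubeFace a → ZMod 2} {d : ℕ}
    (hc : Ch M d c) {F : CubeFace a} (hF : F ∈ U) : bd (res U c) F = bd c F :=
  bd_congr_up hU ((hc.res U).mono hU.1) hc hF fun _ hG _ => res_of hG

lemma bd_ne {c : CubeFace a → ZMod 2} {F : CubeFace a} (h : bd c F ≠ 0) :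
    ∃ G, F ≤ G ∧ dim G = dim F + 1 ∧ c G ≠ 0 := by
  by_contra hn
  push Not at hn
  exact h (bd_zero_of hn)

lemma Ch.bd {M : Set (CubeFace a)} (hM : IsSubcomplex M) {c : CubeFace a → ZMod 2} {d : ℕ}
    (hc : Ch M (d + 1) c) : Ch M d (bd c) := by
  intro F hF
  obtain ⟨G, h1, h2, h3⟩ := bd_ne hF
  have := hc G h3
  exact ⟨hM.2 _ this.1 _ h1, by omega⟩

/-- the chain bounds -/
def Bnd (U : Set (CubeFace a)) (d : ℕ) (c : CubeFace a → ZMod 2) : Prop :=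
  ∃ w, Ch U (d + 1) w ∧ ∀ F ∈ U, bd w F = c F

/-- homologically trivial open sets -/
structure Good (M : Set (CubeFace a)) (m : ℕ) (U : Set (CubeFace a)) : Prop where
  up : Up M U
  hom : ∀ d c, Ch U d c → (∀ F ∈ U, bd c F = 0) → Bnd U d c ∨ (d = m ∧ ∀ F ∈ U, c F = fund M m F)
  ne : ∃ G ∈ U, dim G = m

lemma Up.union {M U V : Set (CubeFace a)} (hU : Up M U) (hV : Up M V) : Up M (U ∪ V) := by
  refine ⟨Set.union_subset hU.1 hV.1, ?_⟩
  rintro F (hF | hF) G hG hFG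
  · exact Or.inl (hU.2 F hF G hG hFG)
  · exact Or.inr (hV.2 F hF G hG hFG)

lemma Up.inter {M U V : Set (CubeFace a)} (hU : Up M U) (hV : Up M V) : Up M (U ∩ V) :=
  ⟨fun _ h => hU.1 h.1, fun F hF G hG hFG => ⟨hU.2 F hF.1 G hG hFG, hV.2 F hF.2 G hG hFG⟩⟩

lemma fund_Ch (M : Set (CubeFace a)) (m : ℕ) : Ch M m (fund M m) := by
  intro F hF
  rw [fund] at hF
  split_ifs at hF with h
  · exact h
  · exact absurd rfl hF

lemma Bnd.zero_top {M U : Set (CubeFace a)} {m : ℕ} (hM : CMan M m) (hU : U ⊆ M) {d : ℕ}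
    (hd : m ≤ d) {c : CubeFace a → ZMod 2} (h : Bnd U d c) : ∀ F ∈ U, c F = 0 := by
  obtain ⟨w, hw, hw'⟩ := h
  intro F hF
  rw [← hw' F hF]
  refine bd_zero_of fun G _ _ => ?_
  by_contra hn
  have h1 := hw G hn
  have := hM.dim_le G (hU h1.1)
  omega

lemma Good.union {M U V : Set (CubeFace a)} {m : ℕ} (hM : CMan M m) (hU : Good M m U)
    (hV : Good M m V) (hUV : Good M m (U ∩ V)) : Good M m (U ∪ V) := by
  classical
  refine ⟨hU.up.union hV.up, ?_, ?_⟩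
  swap
  · obtain ⟨G, hG, hd⟩ := hU.ne
    exact ⟨G, Or.inl hG, hd⟩
  intro d z hz hcy
  have hzM : Ch M d z := hz.mono (hU.up.union hV.up).1
  have zU := hU.hom d (res U z) (hz.res U) fun F hF => by
    rw [bd_res hU.up hzM hF]; exact hcy F (Or.inl hF)
  have zV := hV.hom d (res V z) (hz.res V) fun F hF => by
    rw [bd_res hV.up hzM hF]; exact hcy F (Or.inr hF)
  obtain ⟨G0, hG0, hd0⟩ := hUV.ne
  have hf0 : fund M m G0 = 1 := if_pos ⟨hUV.up.1 hG0, hd0⟩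
  rcases zU with zU | ⟨hdm, zU⟩
  · rcases zV with zV | ⟨hdm, zV⟩
    · left
      obtain ⟨u, hu, hu'⟩ := zU
      obtain ⟨v, hv, hv'⟩ := zV
      have huM := hu.mono hU.up.1
      have hvM := hv.mono hV.up.1
      have hs : Ch M (d + 1) (u + v) := huM.add hvM
      have key : ∃ t, Ch U (d + 1) t ∧ (∀ F ∈ U, bd t F = 0) ∧ ∀ F ∈ U ∩ V, t F = u F + v F := by
        rcases hUV.hom (d + 1) (res (U ∩ V) (u + v)) (hs.res _) (fun F hF => by
          rw [bd_res hUV.up hs hF, bd_add, hu' F hF.1, hv' F hF.2, res_of hF.1, res_of hF.2]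
          exact z2_add_self _) with ⟨w, hw, hw'⟩ | ⟨hdm, h⟩
        · have hwM := hw.mono hUV.up.1
          refine ⟨res U (bd w), (hwM.bd hM.sub).res U, fun F hF => ?_, fun F hF => ?_⟩
          · rw [bd_res hU.up (hwM.bd hM.sub) hF, bd_bd]
          · rw [res_of hF.1, hw' F hF, res_of hF]; rfl
        · refine ⟨res U (fund M m), by rw [hdm]; exact (fund_Ch M m).res U, fun F hF => ?_,
            fun F hF => ?_⟩
          · rw [bd_res hU.up (fund_Ch M m) hF, hM.cyc F (hU.up.1 hF)]
          · rw [res_of hF.1, ← h F hF, res_of hF]; rfl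
      obtain ⟨t, ht, ht0, ht'⟩ := key
      have htM := ht.mono hU.up.1
      set w : CubeFace a → ZMod 2 := fun G => if G ∈ U then u G + t G else v G with hw
      have hwU : ∀ G ∈ U, w G = (u + t) G := fun G hG => if_pos hG
      have hwV : ∀ G ∈ V, w G = v G := by
        intro G hG
        by_cases hGU : G ∈ U
        · rw [hwU G hGU, Pi.add_apply, ht' G ⟨hGU, hG⟩, ← add_assoc, z2_add_self, zero_add]
        · exact if_neg hGU
      have hwc : Ch (U ∪ V) (d + 1) w := by
        intro G hG
        by_cases hGU : G ∈ U
        · rw [hwU G hGU] at hG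
          have := (hu.add ht) G hG
          exact ⟨Or.inl this.1, this.2⟩
        · have : w G = v G := if_neg hGU
          rw [this] at hG
          exact ⟨Or.inr (hv G hG).1, (hv G hG).2⟩
      have hwM := hwc.mono (hU.up.union hV.up).1
      refine ⟨w, hwc, ?_⟩
      rintro F (hF | hF)
      · rw [bd_congr_up hU.up hwM (huM.add htM) hF fun G hG _ => hwU G hG, bd_add, ht0 F hF,
          hu' F hF, res_of hF, add_zero]
      · rw [bd_congr_up hV.up hwM hvM hF fun G hG _ => hwV G hG, hv' F hF, res_of hF]
    · exfalso
      have h1 := zU.zero_top hM hU.up.1 hdm.ge G0 hG0.1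
      have h2 := zV G0 hG0.2
      rw [res_of hG0.1] at h1
      rw [res_of hG0.2, h1, hf0] at h2
      simp at h2
  · rcases zV with zV | ⟨-, zV⟩
    · exfalso
      have h1 := zV.zero_top hM hV.up.1 hdm.ge G0 hG0.2
      have h2 := zU G0 hG0.1
      rw [res_of hG0.2] at h1
      rw [res_of hG0.1, h1, hf0] at h2
      simp at h2
    · right
      refine ⟨hdm, ?_⟩
      rintro F (hF | hF)
      · rw [← zU F hF, res_of hF]
      · rw [← zV F hF, res_of hF]

/-- homologically nontrivial open sets -/
def Bad (M : Set (CubeFace a)) (m : ℕ) (U : Set (CubeFace a)) (d : ℕ) : Prop :=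
  ∃ c, Ch U d c ∧ (∀ F ∈ U, bd c F = 0) ∧ ¬ Bnd U d c ∧ ¬ (d = m ∧ ∀ F ∈ U, c F = fund M m F)

lemma Bad.union {M U V : Set (CubeFace a)} {m d : ℕ} (hM : CMan M m) (hU : Good M m U)
    (hV : Good M m V) (hUV : Bad M m (U ∩ V) (d + 1)) (hd : d < m) : Bad M m (U ∪ V) d := by
  classical
  obtain ⟨z, hz, hcy, hnb, hnf⟩ := hUV
  have hzM : Ch M (d + 1) z := hz.mono (fun _ h => hU.up.1 h.1)
  have hy := hzM.bd hM.sub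
  have hup := hU.up.inter hV.up
  have hyz : ∀ F ∈ V, res U (bd z) F = 0 := by
    intro F hF
    by_cases hFU : F ∈ U
    · rw [res_of hFU, hcy F ⟨hFU, hF⟩]
    · exact res_not hFU
  have hyc : Ch U d (res U (bd z)) := hy.res U
  refine ⟨res U (bd z), hyc.mono Set.subset_union_left, ?_, ?_, fun h => by omega⟩
  · rintro F (hF | hF)
    · rw [bd_res hU.up hy hF, bd_bd]
    · refine bd_zero_of fun G hG _ => ?_
      by_cases hGM : G ∈ M
      · exact hyz G (hV.up.2 F hF G hGM hG)
      · exact hyc.zero_of fun h => hGM (hU.up.1 h)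
  · rintro ⟨w, hw, hw'⟩
    have hwM := hw.mono (hU.up.union hV.up).1
    have h1 := hU.hom (d + 1) (res U (w + z)) ((hwM.add hzM).res U) (fun F hF => by
      rw [bd_res hU.up (hwM.add hzM) hF, bd_add, hw' F (Or.inl hF), res_of hF]
      exact z2_add_self _)
    have h2 := hV.hom (d + 1) (res V w) (hwM.res V) (fun F hF => by
      rw [bd_res hV.up hwM hF, hw' F (Or.inr hF), hyz F hF])
    have tr : ∀ {W : Set (CubeFace a)} {c : CubeFace a → ZMod 2}, Up M W → U ∩ V ⊆ W → Bnd W (d + 1) c →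
        Bnd (U ∩ V) (d + 1) c := by
      rintro W c hWu hW ⟨x, hx, hx'⟩
      refine ⟨res (U ∩ V) x, hx.res _, fun F hF => ?_⟩
      rw [bd_res hup (hx.mono hWu.1) hF, hx' F (hW hF)]
    have g1 : Bnd (U ∩ V) (d + 1) (w + z) ∨ (d + 1 = m ∧ ∀ F ∈ U ∩ V, (w + z) F = fund M m F) := by
      rcases h1 with h1 | ⟨e, h1⟩
      · left
        obtain ⟨x, hx, hx'⟩ := tr hU.up Set.inter_subset_left h1
        exact ⟨x, hx, fun F hF => by rw [hx' F hF, res_of hF.1]⟩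
      · exact Or.inr ⟨e, fun F hF => by rw [← h1 F hF.1, res_of hF.1]⟩
    have g2 : Bnd (U ∩ V) (d + 1) w ∨ (d + 1 = m ∧ ∀ F ∈ U ∩ V, w F = fund M m F) := by
      rcases h2 with h1 | ⟨e, h1⟩
      · left
        obtain ⟨x, hx, hx'⟩ := tr hV.up Set.inter_subset_right h1
        exact ⟨x, hx, fun F hF => by rw [hx' F hF, res_of hF.2]⟩
      · exact Or.inr ⟨e, fun F hF => by rw [← h1 F hF.2, res_of hF.2]⟩
    have ez : ∀ F, z F = (w + z) F + w F := by
      intro F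
      rw [Pi.add_apply, add_comm (w F), add_assoc, z2_add_self, add_zero]
    rcases g1 with g1 | ⟨e, g1⟩
    · rcases g2 with ⟨y, hy1, hy2⟩ | ⟨e, g2⟩
      · obtain ⟨x, hx1, hx2⟩ := g1
        exact hnb ⟨x + y, hx1.add hy1, fun F hF => by rw [bd_add, hx2 F hF, hy2 F hF, ← ez]⟩
      · refine hnf ⟨e, fun F hF => ?_⟩
        have := g1.zero_top hM hup.1 e.ge F hF
        rw [ez, this, zero_add, g2 F hF]
    · rcases g2 with g2 | ⟨e, g2⟩
      · refine hnf ⟨e, fun F hF => ?_⟩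
        have := g2.zero_top hM hup.1 e.ge F hF
        rw [ez, this, add_zero, g1 F hF]
      · refine hnb ⟨0, fun F hF => absurd rfl hF, fun F hF => ?_⟩
        rw [ez, g1 F hF, g2 F hF, z2_add_self]
        exact bd_zero_of fun _ _ _ => rfl

/-- faces meeting `σ`, free along `T` -/
def UU (M : Set (CubeFace a)) (T : Finset (Fin a)) (σ : CubeFace a) : Set (CubeFace a) :=
  {G | G ∈ M ∧ (∀ i, G i = none ∨ σ i = none ∨ G i = σ i) ∧ ∀ i ∈ T, G i = none}

open Classical in
/-- free coordinates -/
noncomputable def FS (σ : CubeFace a) : Finset (Fin a) := Finset.univ.filter fun i => σ i = none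

lemma mem_FS {σ : CubeFace a} {i : Fin a} : i ∈ FS σ ↔ σ i = none := by simp [FS]

lemma card_FS (σ : CubeFace a) : (FS σ).card = dim σ := by rw [dim_eq]; rfl

/-- fix a coordinate -/
def fx (σ : CubeFace a) (i : Fin a) (b : Bool) : CubeFace a :=
  Function.update (β := fun _ => Option Bool) σ i (some b)

lemma fx_same (σ : CubeFace a) (i : Fin a) (b : Bool) : fx σ i b i = some b :=
  Function.update_self (β := fun _ => Option Bool) i (some b) σ

lemma fx_ne (σ : CubeFace a) {i j : Fin a} (b : Bool) (h : j ≠ i) : fx σ i b j = σ j :=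
  Function.update_of_ne (β := fun _ => Option Bool) h (some b) σ

lemma fx_le {σ : CubeFace a} {i : Fin a} (h : σ i = none) (b : Bool) : fx σ i b ≤ σ := by
  intro j
  by_cases hj : j = i
  · subst hj; exact Or.inl h
  · exact Or.inr (fx_ne σ b hj)

lemma FS_fx (σ : CubeFace a) (i : Fin a) (b : Bool) : FS (fx σ i b) = (FS σ).erase i := by
  ext j
  rw [Finset.mem_erase, mem_FS, mem_FS]
  by_cases hj : j = i
  · subst hj; simp [fx_same]
  · simp [fx_ne σ b hj, hj]

lemma UU_up {M : Set (CubeFace a)} (T : Finset (Fin a)) (σ : CubeFace a) : Up M (UU M T σ) := by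
  refine ⟨fun _ h => h.1, ?_⟩
  rintro F ⟨-, h1, h2⟩ G hG hFG
  refine ⟨hG, fun i => ?_, fun i hi => none_of_le hFG (h2 i hi)⟩
  rcases hFG i with h | h
  · exact Or.inl h
  · rw [← h]; exact h1 i

lemma UU_union {M : Set (CubeFace a)} (T : Finset (Fin a)) {σ : CubeFace a} {i : Fin a}
    (hi : σ i = none) : UU M T σ = UU M T (fx σ i false) ∪ UU M T (fx σ i true) := by
  ext G
  constructor
  · rintro ⟨h0, h1, h2⟩
    have key : ∀ b, (G i = none ∨ G i = some b) → G ∈ UU M T (fx σ i b) := by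
      intro b hb
      refine ⟨h0, fun j => ?_, h2⟩
      by_cases hj : j = i
      · subst hj; rw [fx_same]; tauto
      · rw [fx_ne σ b hj]; exact h1 j
    rcases hG : G i with _ | b
    · exact Or.inl (key _ (Or.inl hG))
    · rcases b with _ | _
      · exact Or.inl (key _ (Or.inr hG))
      · exact Or.inr (key _ (Or.inr hG))
  · have key : ∀ b, G ∈ UU M T (fx σ i b) → G ∈ UU M T σ := by
      rintro b ⟨h0, h1, h2⟩
      refine ⟨h0, fun j => ?_, h2⟩
      by_cases hj : j = i
      · subst hj; exact Or.inr (Or.inl hi)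
      · have := h1 j
        rwa [fx_ne σ b hj] at this
    rintro (h | h)
    · exact key _ h
    · exact key _ h

lemma UU_inter {M : Set (CubeFace a)} (T : Finset (Fin a)) {σ : CubeFace a} {i : Fin a}
    (hi : σ i = none) :
    UU M (insert i T) σ = UU M T (fx σ i false) ∩ UU M T (fx σ i true) := by
  ext G
  constructor
  · rintro ⟨h0, h1, h2⟩
    have key : ∀ b, G ∈ UU M T (fx σ i b) := by
      intro b
      refine ⟨h0, fun j => ?_, fun j hj => h2 j (by simp [hj])⟩
      by_cases hj : j = i
      · subst hj; exact Or.inl (h2 j (by simp))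
      · rw [fx_ne σ b hj]; exact h1 j
    exact ⟨key _, key _⟩
  · rintro ⟨⟨h0, h1, h2⟩, ⟨-, h1', -⟩⟩
    have hG : G i = none := by
      have e1 := h1 i
      have e2 := h1' i
      rw [fx_same] at e1 e2
      rcases e1 with h | h | h
      · exact h
      · simp at h
      · rw [h] at e2; simp at e2
    refine ⟨h0, fun j => ?_, fun j hj => ?_⟩
    · by_cases hj : j = i
      · subst hj; exact Or.inl hG
      · have := h1 j
        rwa [fx_ne σ _ hj] at this
    · rcases Finset.mem_insert.1 hj with rfl | h
      · exact hG
      · exact h2 j h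

lemma UU_st {M : Set (CubeFace a)} {T : Finset (Fin a)} {σ : CubeFace a}
    (hT : T = FS σ) : UU M T σ = st M σ := by
  subst hT
  ext G
  constructor
  · rintro ⟨h0, h1, h2⟩
    refine ⟨h0, fun i => ?_⟩
    rcases h1 i with h | h | h
    · exact Or.inl h
    · exact Or.inl (h2 i (mem_FS.2 h))
    · exact Or.inr h.symm
  · rintro ⟨h0, h1⟩
    refine ⟨h0, fun i => ?_, fun i hi => none_of_le h1 (mem_FS.1 hi)⟩
    rcases h1 i with h | h
    · exact Or.inl h
    · exact Or.inr (Or.inr h.symm)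

lemma st_good {M : Set (CubeFace a)} {m : ℕ} (hM : CMan M m) {σ : CubeFace a} (hσ : σ ∈ M) :
    Good M m (st M σ) := by
  refine ⟨⟨fun _ h => h.1, fun F hF G hG h => ⟨hG, hF.2.trans h⟩⟩, ?_, ?_⟩
  · intro d c hc hcy
    have h0 : c = 0 → Bnd (st M σ) d c := by
      rintro rfl
      exact ⟨0, fun F hF => absurd rfl hF, fun F _ => bd_zero_of fun _ _ _ => rfl⟩
    rcases lt_trichotomy d m with h | h | h
    · exact Or.inl (hM.hv σ hσ d h c hc hcy)
    · subst h
      rcases hM.one σ hσ c hc hcy with h | h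
      · exact Or.inl (h0 h)
      · exact Or.inr ⟨rfl, h⟩
    · left
      apply h0
      funext F
      by_contra hn
      have h1 := hc F hn
      have := hM.dim_le F h1.1.1
      omega
  · obtain ⟨G, hG, hle, hd⟩ := hM.pure σ hσ
    exact ⟨G, ⟨hG, hle⟩, hd⟩

theorem D1 {M : Set (CubeFace a)} {m : ℕ} (hM : CMan M m) (n : ℕ) :
    ∀ (T : Finset (Fin a)) (σ : CubeFace a), σ ∈ M → T ⊆ FS σ → (FS σ \ T).card = n →
      Good M m (UU M T σ) := by
  induction n with
  | zero =>
    intro T σ hσ hT hc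
    rw [UU_st]
    · exact st_good hM hσ
    · refine hT.antisymm ?_
      rwa [Finset.card_eq_zero, Finset.sdiff_eq_empty_iff_subset] at hc
  | succ n ih =>
    intro T σ hσ hT hc
    have hne : (FS σ \ T).Nonempty := by
      rw [← Finset.card_pos]; omega
    obtain ⟨i, hi⟩ := hne
    rw [Finset.mem_sdiff] at hi
    have hi0 := mem_FS.1 hi.1
    rw [UU_union T hi0]
    have hc1 : ∀ b, (FS (fx σ i b) \ T).card = n := by
      intro b
      rw [FS_fx, Finset.erase_sdiff_comm, Finset.card_erase_of_mem (Finset.mem_sdiff.2 hi), hc]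
      rfl
    have hT1 : ∀ b, T ⊆ FS (fx σ i b) := by
      intro b
      rw [FS_fx]
      exact Finset.subset_erase.2 ⟨hT, hi.2⟩
    have hM1 : ∀ b, fx σ i b ∈ M := fun b => hM.sub.2 _ hσ _ (fx_le hi0 b)
    refine Good.union hM (ih _ _ (hM1 _) (hT1 _) (hc1 _)) (ih _ _ (hM1 _) (hT1 _) (hc1 _)) ?_
    rw [← UU_inter T hi0]
    refine ih _ _ hσ ?_ ?_
    · exact Finset.insert_subset hi.1 hT
    · rw [Finset.sdiff_insert, Finset.card_erase_of_mem (Finset.mem_sdiff.2 hi), hc]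
      rfl

theorem D2 {M : Set (CubeFace a)} {m : ℕ} (hM : CMan M m) {σ : CubeFace a} (hσ : σ ∉ M)
    (hpr : ∀ τ, τ ≤ σ → τ ≠ σ → τ ∈ M) (n : ℕ) :
    ∀ (T : Finset (Fin a)) (d : ℕ), T ⊆ FS σ → (FS σ \ T).card = n + 1 → d + n = m →
      Bad M m (UU M T σ) d := by
  classical
  induction n with
  | zero =>
    intro T d hT hc hd
    obtain ⟨i, hi'⟩ := Finset.card_eq_one.1 hc
    have hi : i ∈ FS σ \ T := by rw [hi']; simp
    rw [Finset.mem_sdiff] at hi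
    have hi0 := mem_FS.1 hi.1
    have hM1 : ∀ b, fx σ i b ∈ M := fun b => hpr _ (fx_le hi0 b) fun h => by
      have := congrFun h i
      rw [fx_same, hi0] at this
      simp at this
    have hTe : ∀ b, T = FS (fx σ i b) := by
      intro b
      rw [FS_fx]
      refine (Finset.subset_erase.2 ⟨hT, hi.2⟩).antisymm fun j hj => ?_
      rw [Finset.mem_erase] at hj
      by_contra hn
      have : j ∈ FS σ \ T := Finset.mem_sdiff.2 ⟨hj.2, hn⟩
      rw [hi', Finset.mem_singleton] at this
      exact hj.1 this
    have hdis : ∀ G, G ∈ st M (fx σ i false) → G ∈ st M (fx σ i true) → False := by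
      intro G h1 h2
      rw [← UU_st (hTe _)] at h1 h2
      have : G ∈ UU M (insert i T) σ := by rw [UU_inter T hi0]; exact ⟨h1, h2⟩
      rw [UU_st] at this
      · exact hσ (hM.sub.2 _ this.1 _ this.2)
      · refine (Finset.insert_subset hi.1 hT).antisymm fun j hj => ?_
        by_cases hji : j = i
        · simp [hji]
        · refine Finset.mem_insert_of_mem ?_
          rw [hTe true, FS_fx]
          exact Finset.mem_erase.2 ⟨hji, hj⟩
    rw [UU_union T hi0, UU_st (hTe _), UU_st (hTe _)]
    have hupf := (st_good hM (hM1 false)).up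
    have hupt := (st_good hM (hM1 true)).up
    obtain ⟨G0, hG0, hd0⟩ := (st_good hM (hM1 false)).ne
    obtain ⟨G1, hG1, hd1⟩ := (st_good hM (hM1 true)).ne
    have hdm : d = m := by omega
    subst hdm
    have hch : Ch (st M (fx σ i false)) d (res (st M (fx σ i false)) (fund M d)) := (fund_Ch M d).res _
    refine ⟨res (st M (fx σ i false)) (fund M d), hch.mono Set.subset_union_left, ?_, ?_, ?_⟩
    · rintro F (hF | hF)
      · rw [bd_res hupf (fund_Ch M d) hF, hM.cyc F hF.1]
      · refine bd_zero_of fun G hG _ => ?_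
        by_contra hn
        have h1 := hch G hn
        exact hdis G h1.1 (hupt.2 F hF G h1.1.1 hG)
    · intro h
      have := h.zero_top hM (hupf.union hupt).1 le_rfl G0 (Or.inl hG0)
      rw [res_of hG0, fund, if_pos ⟨hG0.1, hd0⟩] at this
      simp at this
    · rintro ⟨-, h⟩
      have := h G1 (Or.inr hG1)
      rw [res_not (fun h => hdis G1 h hG1), fund, if_pos ⟨hG1.1, hd1⟩] at this
      simp at this
  | succ n ih =>
    intro T d hT hc hd
    have hne : (FS σ \ T).Nonempty := by
      rw [← Finset.card_pos]; omega
    obtain ⟨i, hi⟩ := hne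
    rw [Finset.mem_sdiff] at hi
    have hi0 := mem_FS.1 hi.1
    rw [UU_union T hi0]
    have hc1 : ∀ b, (FS (fx σ i b) \ T).card = n + 1 := by
      intro b
      rw [FS_fx, Finset.erase_sdiff_comm, Finset.card_erase_of_mem (Finset.mem_sdiff.2 hi), hc]
      rfl
    have hT1 : ∀ b, T ⊆ FS (fx σ i b) := by
      intro b
      rw [FS_fx]
      exact Finset.subset_erase.2 ⟨hT, hi.2⟩
    have hM1 : ∀ b, fx σ i b ∈ M := fun b => hpr _ (fx_le hi0 b) fun h => by
      have := congrFun h i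
      rw [fx_same, hi0] at this
      simp at this
    refine Bad.union hM (D1 hM _ _ _ (hM1 _) (hT1 _) (hc1 _)) (D1 hM _ _ _ (hM1 _) (hT1 _) (hc1 _))
      ?_ (by omega)
    rw [← UU_inter T hi0]
    refine ih _ _ ?_ ?_ (by omega)
    · exact Finset.insert_subset hi.1 hT
    · rw [Finset.sdiff_insert, Finset.card_erase_of_mem (Finset.mem_sdiff.2 hi), hc]
      rfl

/-- faces meeting `σ` -/
def Nb (M : Set (CubeFace a)) (σ : CubeFace a) : Set (CubeFace a) := UU M ∅ σ

lemma Nb_up (M : Set (CubeFace a)) (σ : CubeFace a) : Up M (Nb M σ) := UU_up _ _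

theorem Nb_good {M : Set (CubeFace a)} {m : ℕ} (hM : CMan M m) {σ : CubeFace a} (hσ : σ ∈ M) :
    Good M m (Nb M σ) := D1 hM _ _ _ hσ (by simp) rfl

theorem Nb_bad {M : Set (CubeFace a)} {m d : ℕ} (hM : CMan M m) {σ : CubeFace a} (hσ : σ ∉ M)
    (hpr : ∀ τ, τ ≤ σ → τ ≠ σ → τ ∈ M) (h1 : 1 ≤ dim σ) (hd : d + dim σ = m + 1) :
    Bad M m (Nb M σ) d :=
  D2 hM hσ hpr (dim σ - 1) ∅ d (by simp) (by rw [Finset.sdiff_empty, card_FS]; omega) (by omega)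

end dual

end CM

/-! ### Part 9: singular homology made explicit -/
namespace CM

open Module Submodule CubeFace CategoryTheory Simplicial
set_option linter.unusedSectionVars false

section sing
variable (X : Type) [TopologicalSpace X]

/-- singular simplices -/
abbrev SS (p : ℕ) := C(stdSimplex ℝ (Fin (p + 1)), X)

/-- face inclusion -/
noncomputable def dl {p : ℕ} (i : Fin (p + 2)) :
    C(stdSimplex ℝ (Fin (p + 1)), stdSimplex ℝ (Fin (p + 2))) :=
  ⟨stdSimplex.map i.succAbove, stdSimplex.continuous_map _⟩

/-- singular boundary -/
noncomputable def sd (p : ℕ) : (SS X (p + 1) →₀ ZMod 2) →ₗ[ZMod 2] (SS X p →₀ ZMod 2) :=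
  Finsupp.linearCombination (ZMod 2) (fun τ => ∑ i : Fin (p + 2), sg (τ.comp (dl i)))

lemma sd_sg (p : ℕ) (τ : SS X (p + 1)) : sd X p (sg τ) = ∑ i : Fin (p + 2), sg (τ.comp (dl i)) := by
  simp [sd]

/-- the singular complex -/
noncomputable abbrev SK : ChainComplex (ModuleCat (ZMod 2)) ℕ :=
  (AlgebraicTopology.alternatingFaceMapComplex (ModuleCat (ZMod 2))).obj
    (((SimplicialObject.whiskering _ _).obj (ModuleCat.free (ZMod 2))).obj
      (TopCat.toSSet.obj (TopCat.of X)))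

/-- identification of chains -/
noncomputable def psi (p : ℕ) : (SS X p →₀ ZMod 2) ≃ₗ[ZMod 2] (SK X).X p :=
  Finsupp.domLCongr ((TopCat.of X).toSSetObjEquiv (Opposite.op ⦋p⦌)).symm

lemma neg_pow_smul {D : Type*} [AddCommGroup D] [Module (ZMod 2) D] (n : ℕ) (x : D) :
    (-1 : ℤ) ^ n • x = x := by
  have h : -x = x := by
    rw [neg_eq_iff_add_eq_zero]; exact z2_add_self x
  rcases neg_one_pow_eq_or ℤ n with e | e <;> rw [e] <;> simp [h]

lemma psi_d (p : ℕ) (c : SS X (p + 1) →₀ ZMod 2) :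
    ((SK X).d (p + 1) p).hom (psi X (p + 1) c) = psi X p (sd X p c) := by
  have : ((SK X).d (p + 1) p).hom ∘ₗ (psi X (p + 1)).toLinearMap = (psi X p).toLinearMap ∘ₗ sd X p := by
    apply lc_ext
    intro τ
    rw [LinearMap.comp_apply, LinearMap.comp_apply, sd_sg]
    erw [AlgebraicTopology.AlternatingFaceMapComplex.obj_d_eq]
    rw [ModuleCat.hom_sum, LinearMap.sum_apply, map_sum]
    refine Finset.sum_congr rfl fun i _ => ?_
    rw [ModuleCat.hom_zsmul, LinearMap.smul_apply, neg_pow_smul]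
    have e1 : (psi X (p + 1)).toLinearMap (sg τ) = ModuleCat.freeMk
      (((TopCat.of X).toSSetObjEquiv (Opposite.op ⦋p + 1⦌)).symm τ) := by
      exact Finsupp.domLCongr_single _ _ _
    have e2 : (psi X p).toLinearMap (sg (τ.comp (dl i))) = ModuleCat.freeMk
      (((TopCat.of X).toSSetObjEquiv (Opposite.op ⦋p⦌)).symm (τ.comp (dl i))) := by
      exact Finsupp.domLCongr_single _ _ _
    rw [e1, e2]
    exact ModuleCat.free_map_apply _ _
  exact LinearMap.congr_fun this c

theorem sing_exact {p : ℕ} (h : Subsingleton (sHomology (ZMod 2) X (p + 1)))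
    (c : SS X (p + 1) →₀ ZMod 2) (hc : sd X p c = 0) : ∃ w, sd X (p + 1) w = c := by
  have : Subsingleton ((SK X).homology (p + 1)) := h
  have hz : Limits.IsZero ((SK X).homology (p + 1)) := ModuleCat.isZero_of_subsingleton _
  rw [← HomologicalComplex.exactAt_iff_isZero_homology,
    HomologicalComplex.exactAt_iff' (SK X) (p + 2) (p + 1) p (by simp) (by simp),
    ShortComplex.moduleCat_exact_iff] at hz
  obtain ⟨x, hx⟩ : ∃ x : (SK X).X (p + 2), ((SK X).d (p + 2) (p + 1)).hom x = psi X (p + 1) c :=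
    hz (psi X (p + 1) c) ((psi_d X p c).trans (by rw [hc, map_zero]; rfl))
  refine ⟨(psi X (p + 2)).symm x, (psi X (p + 1)).injective ?_⟩
  rw [← psi_d, LinearEquiv.apply_symm_apply]
  exact hx

end sing

end CM

/-! ### Part 10: the augmented cubical complex -/
namespace CM

open Module Submodule CubeFace
set_option linter.unusedSectionVars false

section aug
variable {a : ℕ}

/-- augmented cubical chains -/
abbrev AC (a : ℕ) := Option (CubeFace a) → ZMod 2

/-- chains supported in a set -/
def ZP {B : Type*} (A : Set B) : Submodule (ZMod 2) (B → ZMod 2) where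
  carrier := {c | ∀ b, c b ≠ 0 → b ∈ A}
  zero_mem' := fun b hb => absurd rfl hb
  add_mem' := by
    intro x y hx hy b hb
    by_cases h : x b = 0
    · refine hy b fun h' => hb ?_
      simp [h, h']
    · exact hx b h
  smul_mem' := by
    intro r x hx b hb
    refine hx b fun h' => hb ?_
    simp [h']

lemma mem_ZP {B : Type*} {A : Set B} {c : B → ZMod 2} : c ∈ ZP A ↔ ∀ b, c b ≠ 0 → b ∈ A := Iff.rfl

lemma ZP_mono {B : Type*} {A A' : Set B} (h : A ⊆ A') : ZP A ≤ ZP A' :=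
  fun _ hc b hb => h (hc b hb)

lemma ZP_span {B : Type*} [Finite B] {A : Set B} {c : B → ZMod 2} (hc : c ∈ ZP A) :
    c ∈ span (ZMod 2) (Pi.basisFun (ZMod 2) B '' A) := by
  classical
  have := Fintype.ofFinite B
  rw [← (Pi.basisFun (ZMod 2) B).sum_repr c]
  refine sum_mem fun b _ => ?_
  by_cases h : c b = 0
  · simp [h]
  · exact smul_mem _ _ (subset_span ⟨b, hc b h, rfl⟩)

/-- degree of an augmented cell -/
noncomputable def odeg : Option (CubeFace a) → ℕ
  | none => 0
  | some F => dim F + 1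

/-- augmented boundary -/
noncomputable def abd : AC a →ₗ[ZMod 2] AC a where
  toFun c o := match o with
    | none => ∑ v : Fin a → Bool, c (some (toFace v))
    | some F => bd (fun G => c (some G)) F
  map_add' c c' := by
    funext o
    rcases o with _ | F
    · simp [Finset.sum_add_distrib]
    · exact bd_add (fun G => c (some G)) (fun G => c' (some G)) F
  map_smul' r c := by
    funext o
    rcases z2_cases r with rfl | rfl
    · rcases o with _ | F
      · simp
      · simp [bd]
    · rcases o with _ | F <;> simp

lemma abd_none (c : AC a) : abd c none = ∑ v : Fin a → Bool, c (some (toFace v)) := rfl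
lemma abd_some (c : AC a) (F : CubeFace a) : abd c (some F) = bd (fun G => c (some G)) F := rfl

lemma dim_toFace (v : Fin a → Bool) : dim (toFace v) = 0 := by
  rw [dim_eq]; simp [toFace]

lemma exists_toFace {F : CubeFace a} (h : dim F = 0) : ∃ v, F = toFace v := by
  classical
  rw [dim_eq, Finset.card_eq_zero, Finset.filter_eq_empty_iff] at h
  have : ∀ i, ∃ b, F i = some b := fun i => Option.ne_none_iff_exists'.1 (h (Finset.mem_univ i))
  choose v hv using this
  exact ⟨v, funext hv⟩

lemma abd_abd (c : AC a) : abd (abd c) = 0 := by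
  classical
  funext o
  rcases o with _ | F
  · rw [abd_none]
    simp only [abd_some, bd]
    rw [Finset.sum_comm]
    refine Finset.sum_eq_zero fun i _ => ?_
    refine Finset.sum_involution (fun v _ => Function.update v i (!(v i))) ?_ ?_ ?_ ?_
    · intro v _
      have e : fr (toFace (Function.update v i (!(v i)))) i = fr (toFace v) i := by
        funext j
        by_cases hj : j = i
        · subst hj; rw [fr_same, fr_same]
        · rw [fr_ne _ hj, fr_ne _ hj]; simp [toFace, hj]
      have h1 : ∀ w : Fin a → Bool, toFace w i ≠ none := fun w => by simp [toFace]
      rw [if_neg (h1 _), if_neg (h1 _), e]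
      exact z2_add_self _
    · intro v _ _ h
      have := congrFun h i
      simp at this
    · simp
    · intro v _
      simp
  · rw [abd_some]
    exact bd_bd (fun G => c (some G)) F

lemma abd_mem {n : ℕ} {A : CubeFace a → Prop} (hA : ∀ F G, F ≤ G → A G → A F) {c : AC a}
    (hc : c ∈ ZP {o | odeg o = n ∧ ∀ G, o = some G → A G}) :
    abd c ∈ ZP {o | odeg o + 1 = n ∧ ∀ G, o = some G → A G} := by
  intro o ho
  rcases o with _ | F
  · rw [abd_none] at ho
    obtain ⟨v, -, hv⟩ := Finset.exists_ne_zero_of_sum_ne_zero ho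
    have := (hc _ hv).1
    refine ⟨?_, by simp⟩
    simpa [odeg, dim_toFace] using this
  · rw [abd_some, bd] at ho
    obtain ⟨i, -, hi⟩ := Finset.exists_ne_zero_of_sum_ne_zero ho
    split_ifs at hi with h
    · exact absurd rfl hi
    · obtain ⟨h1, h2⟩ := hc _ hi
      have h3 : dim (fr F i) + 1 = n := h1
      rw [dim_fr h] at h3
      refine ⟨h3, ?_⟩
      rintro G hG
      cases hG
      exact hA _ _ (le_fr F i) (h2 _ rfl)

/-- the subcomplex of a face -/
def cub (F : CubeFace a) (n : ℕ) : Set (Option (CubeFace a)) :=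
  {o | odeg o = n ∧ ∀ G, o = some G → G ≤ F}

lemma dim_fx {F : CubeFace a} {i : Fin a} (h : F i = none) (b : Bool) :
    dim (fx F i b) + 1 = dim F := by
  have e : fr (fx F i b) i = F := by
    funext j
    by_cases hj : j = i
    · subst hj; rw [fr_same, h]
    · rw [fr_ne _ hj, fx_ne _ _ hj]
  rw [← dim_fr (by rw [fx_same]; simp), e]

lemma fr_fx {F : CubeFace a} {i : Fin a} (h : F i = none) (b : Bool) : fr (fx F i b) i = F := by
    funext j
    by_cases hj : j = i
    · subst hj; rw [fr_same, h]
    · rw [fr_ne _ hj, fx_ne _ _ hj]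

lemma fx_fr (F : CubeFace a) (i : Fin a) (b : Bool) : fx (fr F i) i b = fx F i b := by
    funext j
    by_cases hj : j = i
    · subst hj; rw [fx_same, fx_same]
    · rw [fx_ne _ _ hj, fr_ne _ hj, fx_ne _ _ hj]

lemma fx_self {F : CubeFace a} {i : Fin a} {b : Bool} (h : F i = some b) : fx F i b = F := by
    funext j
    by_cases hj : j = i
    · subst hj; rw [fx_same, h]
    · rw [fx_ne _ _ hj]

lemma fx_fr_comm (F : CubeFace a) {i j : Fin a} (h : j ≠ i) (b : Bool) :
    fx (fr F j) i b = fr (fx F i b) j := by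
  funext k
  by_cases hj : k = i
  · subst hj; rw [fx_same, fr_ne _ h.symm, fx_same]
  · rw [fx_ne _ _ hj]
    by_cases hk : k = j
    · subst hk; rw [fr_same, fr_same]
    · rw [fr_ne _ hk, fr_ne _ hk, fx_ne _ _ hj]

lemma dim_fx_some {F : CubeFace a} {i : Fin a} {s : Bool} (h : F i = some s) (b : Bool) :
    dim (fx F i b) = dim F := by
  have h1 := dim_fx (fr_same F i) b
  rw [fx_fr, dim_fr (by rw [h]; simp)] at h1
  omega

open Classical in
/-- contraction in a direction -/
noncomputable def hh (i : Fin a) (c : AC a) : AC a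
  | none => 0
  | some G => if G i = none then c (some (fx G i true)) else 0

open Classical in
/-- projection -/
noncomputable def pp (i : Fin a) (c : AC a) : AC a
  | none => c none
  | some G => if G i = some false then c (some G) + c (some (fx G i true)) else 0

lemma hh_formula (i : Fin a) (c : AC a) : abd (hh i c) + hh i (abd c) = c + pp i c := by
  classical
  funext o
  rcases o with _ | G
  · simp only [Pi.add_apply, abd_none, hh, pp]
    have : ∀ v : Fin a → Bool, toFace v i ≠ none := fun v => by simp [toFace]
    simp [this, z2_add_self]
  · simp only [Pi.add_apply, abd_some, pp]
    rcases hG : G i with _ | _ | _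
    · have e1 : bd (fun G => hh i c (some G)) G + hh i (abd c) (some G) = c (some G) := by
        simp only [hh, if_pos hG, abd_some, bd]
        rw [← Finset.sum_add_distrib, Finset.sum_eq_single i]
        · simp [hG, fx_same, fr_fx hG]
        · intro j _ hj
          rw [fx_ne _ _ hj, fr_ne _ hj.symm, if_pos hG, fx_fr_comm _ hj]
          exact z2_add_self _
        · simp
      simpa using e1
    · have e1 : bd (fun G => hh i c (some G)) G = c (some (fx G i true)) := by
        simp only [hh, bd]
        rw [Finset.sum_eq_single i]
        · simp [hG, fr_same, fx_fr]
        · intro j _ hj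
          rw [fr_ne _ hj.symm, hG]; simp
        · simp
      rw [e1]
      simp [hh, hG, ← add_assoc, z2_add_self]
    · have e1 : bd (fun G => hh i c (some G)) G = c (some (fx G i true)) := by
        simp only [hh, bd]
        rw [Finset.sum_eq_single i]
        · simp [hG, fr_same, fx_fr]
        · intro j _ hj
          rw [fr_ne _ hj.symm, hG]; simp
        · simp
      rw [e1]
      simp [hh, hG, fx_self hG]

lemma fx_le_of {G F : CubeFace a} {i : Fin a} {b : Bool} (h : fx G i b ≤ F) (hF : F i = none) :
    G ≤ F := by
  intro j
  by_cases hj : j = i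
  · subst hj; exact Or.inl hF
  · have := h j
    rwa [fx_ne _ _ hj] at this

theorem cub_acyclic (F : CubeFace a) : ∀ (n : ℕ) (z : AC a), z ∈ ZP (cub F n) → abd z = 0 →
    ∃ w ∈ ZP (cub F (n + 1)), abd w = z := by
  classical
  induction hd : dim F generalizing F with
  | zero =>
    obtain ⟨v, rfl⟩ := exists_toFace hd
    have hmax : ∀ G, G ≤ toFace v → G = toFace v := fun G hG =>
      eq_of_le_dim hG (by rw [hd]; exact Nat.zero_le _)
    intro n z hz hz0
    rcases n with _ | n
    · refine ⟨Pi.single (some (toFace v)) (z none), ?_, ?_⟩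
      · intro o ho
        have : o = some (toFace v) := by
          by_contra h
          exact ho (by simp [h])
        subst this
        refine ⟨by simp [odeg, dim_toFace], ?_⟩
        rintro G hG; cases hG; exact le_rfl
      · funext o
        rcases o with _ | G
        · rw [abd_none, Finset.sum_eq_single v]
          · simp
          · intro w _ hw
            rw [Pi.single_apply, if_neg]
            intro h
            apply hw
            have : toFace w = toFace v := by simpa using h
            funext i
            have := congrFun this i
            simpa [toFace] using this
          · simp
        · rw [abd_some]
          have h1 : z (some G) = 0 := by
            by_contra h
            have := (hz _ h).1
            simp [odeg] at this
          rw [h1]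
          apply bd_zero_of
          intro H _ hH
          rw [Pi.single_apply, if_neg]
          intro h
          have : H = toFace v := by simpa using h
          rw [this, dim_toFace] at hH
          omega
    · have hz1 : ∀ o, o ≠ some (toFace v) → z o = 0 := by
        intro o ho
        by_contra h
        obtain ⟨h1, h2⟩ := hz _ h
        rcases o with _ | G
        · simp [odeg] at h1
        · exact ho (by rw [hmax G (h2 G rfl)])
      have hz2 : z (some (toFace v)) = 0 := by
        have := congrFun hz0 none
        rw [abd_none, Finset.sum_eq_single v] at this
        · exact this
        · intro w _ hw
          apply hz1
          intro h
          apply hw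
          have : toFace w = toFace v := by simpa using h
          funext i
          have := congrFun this i
          simpa [toFace] using this
        · simp
      have : z = 0 := by
        funext o
        by_cases ho : o = some (toFace v)
        · rw [ho, hz2]; rfl
        · exact hz1 o ho
      exact ⟨0, zero_mem _, by rw [this, map_zero]⟩
  | succ d ih =>
    intro n z hz hz0
    obtain ⟨i, hi⟩ : ∃ i, F i = none := by
      by_contra hn
      push Not at hn
      rw [dim_eq, Finset.filter_false_of_mem (fun i _ => hn i)] at hd
      simp at hd
    have hf := hh_formula i z
    have hh0 : hh i (abd z) = 0 := by
      rw [hz0]; funext o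
      rcases o with _ | G <;> simp [hh]
    rw [hh0, add_zero] at hf
    have hp0 : abd (pp i z) = 0 := by
      have := congrArg abd hf
      rwa [abd_abd, map_add, hz0, zero_add, eq_comm] at this
    have hp : pp i z ∈ ZP (cub (fx F i false) n) := by
      intro o ho
      rcases o with _ | G
      · exact ⟨(hz _ ho).1, by simp⟩
      · simp only [pp] at ho
        split_ifs at ho with hG
        · have key : dim G + 1 = n ∧ G ≤ F := by
            by_cases h1 : z (some G) = 0
            · rw [h1, zero_add] at ho
              obtain ⟨h2, h3⟩ := hz _ ho
              refine ⟨?_, fx_le_of (h3 _ rfl) hi⟩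
              rw [← dim_fx_some hG true]; exact h2
            · exact ⟨(hz _ h1).1, (hz _ h1).2 _ rfl⟩
          refine ⟨key.1, ?_⟩
          rintro G' hG'
          cases hG'
          intro j
          by_cases hj : j = i
          · subst hj; right; rw [fx_same, hG]
          · rw [fx_ne _ _ hj]; exact key.2 j
        · exact absurd rfl ho
    obtain ⟨w, hw, hw'⟩ := ih (fx F i false) (by have := dim_fx hi false; omega) n _ hp hp0
    refine ⟨hh i z + w, add_mem ?_ (ZP_mono ?_ hw), ?_⟩
    · intro o ho
      rcases o with _ | G
      · exact absurd rfl ho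
      · simp only [hh] at ho
        split_ifs at ho with hG
        · obtain ⟨h2, h3⟩ := hz _ ho
          refine ⟨?_, ?_⟩
          · have := dim_fx hG true
            have h4 : dim (fx G i true) + 1 = n := h2
            simp only [odeg]
            omega
          · rintro G' hG'
            cases hG'
            exact fx_le_of (h3 _ rfl) hi
        · exact absurd rfl ho
    · rintro o ⟨h1, h2⟩
      exact ⟨h1, fun G hG => (h2 G hG).trans (fx_le hi _)⟩
    · rw [map_add, hf, hw', add_assoc, z2_add_self, add_zero]

end aug

end CM

/-! ### Part 11: subdivision of singular simplices -/
namespace CM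

open Module Submodule CubeFace
set_option linter.unusedSectionVars false

section subdiv

/-- insertion of a zero -/
def ins {n : ℕ} (i : Fin (n + 1)) (x : Fin n → ℝ) : Fin (n + 1) → ℝ :=
  Fin.insertNth (α := fun _ => ℝ) i 0 x

lemma ins_same {n : ℕ} (i : Fin (n + 1)) (x : Fin n → ℝ) : ins i x i = 0 := by simp [ins]

lemma ins_succAbove {n : ℕ} (i : Fin (n + 1)) (x : Fin n → ℝ) (j : Fin n) :
    ins i x (i.succAbove j) = x j := by simp [ins]

lemma ins_ins {n : ℕ} (i : Fin (n + 2)) (j : Fin (n + 1)) (x : Fin n → ℝ) :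
    ins i (ins j x) = ins (i.succAbove j) (ins (j.predAbove i) x) := by
  funext t
  rcases Fin.eq_self_or_eq_succAbove i t with rfl | ⟨s, rfl⟩
  · rw [ins_same]
    have := ins_succAbove (t.succAbove j) (ins (j.predAbove t) x) (j.predAbove t)
    rw [Fin.succAbove_succAbove_predAbove, ins_same] at this
    exact this.symm
  · rw [ins_succAbove]
    rcases Fin.eq_self_or_eq_succAbove j s with rfl | ⟨k, rfl⟩
    · rw [ins_same, ins_same]
    · rw [ins_succAbove, ← Fin.succAbove_succAbove_succAbove_predAbove, ins_succAbove, ins_succAbove]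

/-- sum of the faces -/
noncomputable def fsum {n : ℕ} (c : LC (Fin n → ℝ)) : LC (Fin (n + 1) → ℝ) :=
  ∑ i : Fin (n + 1), lmap (ins i) c

lemma fsum_fsum {n : ℕ} (c : LC (Fin n → ℝ)) : fsum (fsum c) = 0 := by
  unfold fsum
  simp only [map_sum, lmap_lmap]
  refine (Fintype.sum_prod_type (f := fun p : Fin (n + 2) × Fin (n + 1) =>
      lmap (ins p.1 ∘ ins p.2) c)).symm.trans ?_
  refine Finset.sum_involution (fun p _ => (p.1.succAbove p.2, p.2.predAbove p.1)) ?_ ?_ ?_ ?_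
  · rintro ⟨i, j⟩ -
    have : (ins i ∘ ins j : (Fin n → ℝ) → _) = ins (i.succAbove j) ∘ ins (j.predAbove i) := by
      funext x; exact ins_ins i j x
    dsimp only
    rw [this]
    exact z2_add_self _
  · rintro ⟨i, j⟩ - _ h
    simp only [Prod.mk.injEq] at h
    exact Fin.succAbove_ne i j h.1
  · simp
  · rintro ⟨i, j⟩ -
    simp only [Fin.succAbove_succAbove_predAbove, Fin.predAbove_predAbove_succAbove]

lemma lbd_fsum {n : ℕ} (c : LC (Fin n → ℝ)) : lbd (fsum c) = ∑ i : Fin (n + 1), lmap (ins i) (lbd c) := by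
  unfold fsum
  rw [map_sum]
  exact Finset.sum_congr rfl fun i _ => (lmap_lbd _ _).symm

lemma ins_simplex {n : ℕ} (i : Fin (n + 1)) {x : Fin n → ℝ} (hx : x ∈ stdSimplex ℝ (Fin n)) :
    ins i x ∈ stdSimplex ℝ (Fin (n + 1)) := by
  refine ⟨fun t => ?_, ?_⟩
  · rcases Fin.eq_self_or_eq_succAbove i t with rfl | ⟨s, rfl⟩
    · rw [ins_same]
    · rw [ins_succAbove]; exact hx.1 s
  · rw [Fin.sum_univ_succAbove _ i, ins_same, zero_add, ← hx.2]
    exact Finset.sum_congr rfl fun j _ => ins_succAbove i x j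

lemma fsum_mem {n : ℕ} {η : ℝ} {c : LC (Fin n → ℝ)}
    (hc : c ∈ LS (sml (stdSimplex ℝ (Fin n)) η n)) :
    fsum c ∈ LS (sml (stdSimplex ℝ (Fin (n + 1))) η n) := by
  refine sum_mem fun i _ => lmap_mem ?_ hc
  rintro l ⟨h1, h2, h3⟩
  refine ⟨by simp [h1], ?_, ?_⟩
  · intro y hy
    obtain ⟨x, hx, rfl⟩ := List.mem_map.1 hy
    exact ins_simplex i (h2 x hx)
  · intro y hy y' hy'
    obtain ⟨x, hx, rfl⟩ := List.mem_map.1 hy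
    obtain ⟨x', hx', rfl⟩ := List.mem_map.1 hy'
    have := h3 x hx x' hx'
    unfold ins
    rw [Fin.dist_insertNth_insertNth]
    simpa using this

theorem exists_e {η : ℝ} (hη : 0 < η) : ∃ e : ∀ n, LC (Fin n → ℝ), e 0 = sg [] ∧
    (∀ n, e n ∈ LS (sml (stdSimplex ℝ (Fin n)) η n)) ∧ ∀ n, lbd (e (n + 1)) = fsum (e n) := by
  have step : ∀ n (c : LC (Fin n → ℝ)), c ∈ LS (sml (stdSimplex ℝ (Fin n)) η n) →
      lbd (fsum c) = 0 → ∃ w, (w ∈ LS (sml (stdSimplex ℝ (Fin (n + 1))) η (n + 1)) ∧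
        lbd (fsum w) = 0) ∧ lbd w = fsum c := by
    intro n c hc hc0
    obtain ⟨w, hw, hw'⟩ := convex_acyclic (convex_stdSimplex ℝ (Fin (n + 1)))
      (single_mem_stdSimplex ℝ (0 : Fin (n + 1))) hη (fsum_mem hc) hc0
    refine ⟨w, ⟨hw, ?_⟩, hw'⟩
    rw [lbd_fsum, hw']
    exact fsum_fsum c
  let es : ∀ n, {c : LC (Fin n → ℝ) // c ∈ LS (sml (stdSimplex ℝ (Fin n)) η n) ∧ lbd (fsum c) = 0} :=
    fun n => Nat.rec ⟨sg [], sg_mem ⟨rfl, by simp, by simp⟩, by simp [fsum, ldel]⟩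
      (fun n c => ⟨(step n c.1 c.2.1 c.2.2).choose, (step n c.1 c.2.1 c.2.2).choose_spec.1⟩) n
  refine ⟨fun n => (es n).1, rfl, fun n => (es n).2.1, fun n => ?_⟩
  exact (step n (es n).1 (es n).2.1 (es n).2.2).choose_spec.2

variable {E : Type} [NormedAddCommGroup E] [NormedSpace ℝ E]

lemma ldel_ofFn {X : Type*} {n : ℕ} (v : Fin (n + 1) → X) :
    ldel (List.ofFn v) = ∑ i : Fin (n + 1), sg (List.ofFn (v ∘ i.succAbove)) := by
  induction n with
  | zero => simp [ldel]
  | succ n ih =>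
    rw [List.ofFn_succ, ldel, ih, map_sum, Fin.sum_univ_succ (n := n + 1)]
    congr 1
    refine Finset.sum_congr rfl fun i _ => ?_
    rw [lcons_sg, List.ofFn_succ]
    simp only [Function.comp_apply, Fin.succ_succAbove_zero, Function.comp_def,
      Fin.succ_succAbove_succ]

/-- affine map of a list -/
noncomputable def aff {n : ℕ} (l : List E) (t : Fin n → ℝ) : E := ∑ i, t i • l.getD i 0

lemma aff_ins {n : ℕ} (v : Fin (n + 1) → E) (i : Fin (n + 1)) (t : Fin n → ℝ) :
    aff (List.ofFn v) (ins i t) = aff (List.ofFn (v ∘ i.succAbove)) t := by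
  unfold aff
  rw [Fin.sum_univ_succAbove _ i, ins_same, zero_smul, zero_add]
  refine Finset.sum_congr rfl fun j _ => ?_
  rw [ins_succAbove, List.getD_eq_getElem _ _ (by simp; omega), List.getD_eq_getElem _ _ (by simp),
    List.getElem_ofFn, List.getElem_ofFn]
  rfl

lemma aff_continuous {n : ℕ} (l : List E) : Continuous (aff (n := n) l) := by
  unfold aff; fun_prop

lemma aff_mem {n : ℕ} {K : Set E} (hK : Convex ℝ K) {l : List E} (hl : l.length = n)
    (hlK : ∀ x ∈ l, x ∈ K) {t : Fin n → ℝ} (ht : t ∈ stdSimplex ℝ (Fin n)) : aff l t ∈ K := by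
  refine hK.sum_mem (fun i _ => ht.1 i) ht.2 fun i _ => hlK _ ?_
  have hi : i.1 < l.length := by omega
  rw [List.getD_eq_getElem _ _ hi]
  exact List.getElem_mem hi

variable (e : ∀ n, LC (Fin n → ℝ))

/-- subdivision of lists -/
noncomputable def Sub : LC E →ₗ[ZMod 2] LC E :=
  Finsupp.linearCombination (ZMod 2) (fun l => lmap (aff l) (e l.length))

lemma Sub_sg (l : List E) : Sub e (sg l) = lmap (aff l) (e l.length) := by simp [Sub]

lemma exists_ofFn {X : Type*} {n : ℕ} {l : List X} (h : l.length = n) : ∃ v : Fin n → X, l = List.ofFn v := by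
  subst h; exact ⟨l.get, (List.ofFn_get l).symm⟩

variable {e} in
lemma lbd_Sub (he0 : e 0 = sg []) (he : ∀ n, lbd (e (n + 1)) = fsum (e n)) (c : LC E) :
    lbd (Sub e c) = Sub e (lbd c) := by
  have : lbd ∘ₗ Sub e = Sub e ∘ₗ lbd (X := E) := by
    apply lc_ext
    intro l
    simp only [LinearMap.comp_apply, Sub_sg, lbd_sg]
    rcases hl : l.length with _ | n
    · rw [List.length_eq_zero_iff] at hl
      subst hl
      simp [he0, ldel]
    · obtain ⟨v, rfl⟩ := exists_ofFn hl
      rw [ldel_ofFn, ← lmap_lbd, he, fsum, map_sum, map_sum]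
      refine Finset.sum_congr rfl fun i _ => ?_
      rw [Sub_sg, lmap_lmap, List.length_ofFn]
      congr 2
      funext t
      exact aff_ins v i t
  exact LinearMap.congr_fun this c

lemma lmap_congr {X Y : Type*} {f g : X → Y} {K : Set X} (h : ∀ x ∈ K, f x = g x) {A : Set (List X)}
    (hA : ∀ l ∈ A, ∀ x ∈ l, x ∈ K) {c : LC X} (hc : c ∈ LS A) : lmap f c = lmap g c := by
  have : lmap f c + lmap g c ∈ (⊥ : Submodule (ZMod 2) (LC Y)) := by
    refine LS_map (lmap f + lmap g) ⊥ (fun l hl => ?_) hc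
    have e1 : l.map f = l.map g := List.map_congr_left fun x hx => h x (hA l hl x hx)
    rw [LinearMap.add_apply, lmap_sg, lmap_sg, e1]
    exact z2_add_self _
  exact z2_eq_of_add this

variable {R : Set E}

open Classical in
/-- extension of a singular simplex -/
noncomputable def ext {p : ℕ} (τ : SS R p) (t : Fin (p + 1) → ℝ) : E :=
  if h : t ∈ stdSimplex ℝ (Fin (p + 1)) then (τ ⟨t, h⟩ : E) else 0

lemma ext_of {p : ℕ} (τ : SS R p) (t : stdSimplex ℝ (Fin (p + 1))) : ext τ t.1 = τ t := by
  unfold ext; rw [dif_pos t.2]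

/-- subdivision of singular simplices -/
noncomputable def EE (p : ℕ) : (SS R p →₀ ZMod 2) →ₗ[ZMod 2] LC E :=
  Finsupp.linearCombination (ZMod 2) (fun τ => lmap (ext τ) (e (p + 1)))

lemma EE_sg {p : ℕ} (τ : SS R p) : EE e p (sg τ) = lmap (ext τ) (e (p + 1)) := by simp [EE]

lemma dl_coe {p : ℕ} (i : Fin (p + 2)) (t : stdSimplex ℝ (Fin (p + 1))) :
    (dl i t).1 = ins i t.1 := by
  classical
  funext s
  change FunOnFinite.linearMap ℝ ℝ i.succAbove t.1 s = _
  rw [FunOnFinite.linearMap_apply_apply]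
  rcases Fin.eq_self_or_eq_succAbove i s with rfl | ⟨s, rfl⟩
  · rw [ins_same, Finset.sum_eq_zero]
    intro x hx
    simp [Fin.succAbove_ne] at hx
  · rw [ins_succAbove, Finset.sum_eq_single s]
    · intro b hb hne
      simp at hb; exact absurd hb hne
    · simp

variable {e} in
lemma lbd_EE {η : ℝ} (hem : ∀ n, e n ∈ LS (sml (stdSimplex ℝ (Fin n)) η n))
    (he : ∀ n, lbd (e (n + 1)) = fsum (e n)) {p : ℕ} (w : SS R (p + 1) →₀ ZMod 2) :
    lbd (EE e (p + 1) w) = EE e p (sd R p w) := by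
  have : lbd ∘ₗ EE e (p + 1) = EE e p ∘ₗ sd R p := by
    apply lc_ext
    intro τ
    simp only [LinearMap.comp_apply, EE_sg, sd_sg]
    rw [← lmap_lbd, he, fsum, map_sum, map_sum]
    refine Finset.sum_congr rfl fun i _ => ?_
    rw [EE_sg, lmap_lmap]
    refine lmap_congr (K := stdSimplex ℝ (Fin (p + 1))) ?_ ?_ (hem (p + 1))
    · intro t ht
      have h1 := ext_of (τ.comp (dl i)) ⟨t, ht⟩
      have h2 := ext_of τ (dl i ⟨t, ht⟩)
      rw [dl_coe] at h2
      dsimp only at h1 h2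
      rw [Function.comp_apply, h1, h2]
      rfl
    · intro l hl; exact hl.2.1
  exact LinearMap.congr_fun this w

open Classical in
/-- affine singular simplices -/
noncomputable def SX (R : Set E) (p : ℕ) : LC E →ₗ[ZMod 2] (SS R p →₀ ZMod 2) :=
  Finsupp.linearCombination (ZMod 2) (fun l =>
    if h : ∃ τ : SS R p, ∀ t, (τ t : E) = aff l t.1 then sg h.choose else 0)

lemma SX_sg {p : ℕ} {l : List E} (τ : SS R p) (h : ∀ t, (τ t : E) = aff l t.1) :
    SX R p (sg l) = sg τ := by
  have hex : ∃ τ : SS R p, ∀ t, (τ t : E) = aff l t.1 := ⟨τ, h⟩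
  have : SX R p (sg l) = sg hex.choose := by
    simp only [SX, Finsupp.linearCombination_single, one_smul, dif_pos hex]
  rw [this]
  congr 1
  ext t
  rw [hex.choose_spec t, h t]

lemma exists_SX {p : ℕ} {l : List E} {K : Set E} (hK : Convex ℝ K) (hKR : K ⊆ R)
    (hl : l.length = p + 1) (hlK : ∀ x ∈ l, x ∈ K) :
    ∃ τ : SS R p, (∀ t, (τ t : E) = aff l t.1) ∧ SX R p (sg l) = sg τ := by
  let τ : SS R p := ⟨fun t => ⟨aff l t.1, hKR (aff_mem hK hl hlK t.2)⟩,
    Continuous.subtype_mk ((aff_continuous l).comp continuous_subtype_val) _⟩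
  exact ⟨τ, fun t => rfl, SX_sg τ fun t => rfl⟩

lemma SX_sd {p : ℕ} {l : List E} {K : Set E} (hK : Convex ℝ K) (hKR : K ⊆ R)
    (hl : l.length = p + 2) (hlK : ∀ x ∈ l, x ∈ K) :
    sd R p (SX R (p + 1) (sg l)) = SX R p (lbd (sg l)) := by
  obtain ⟨τ, hτ, h⟩ := exists_SX hK hKR hl hlK
  obtain ⟨v, rfl⟩ := exists_ofFn hl
  rw [h, sd_sg, lbd_sg, ldel_ofFn, map_sum]
  refine Finset.sum_congr rfl fun i _ => ?_
  refine (SX_sg _ fun t => ?_).symm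
  rw [ContinuousMap.comp_apply, hτ, dl_coe, aff_ins]

variable {e} in
lemma EE_SX {η : ℝ} (hem : ∀ n, e n ∈ LS (sml (stdSimplex ℝ (Fin n)) η n))
    {p : ℕ} {l : List E} {K : Set E} (hK : Convex ℝ K) (hKR : K ⊆ R)
    (hl : l.length = p + 1) (hlK : ∀ x ∈ l, x ∈ K) :
    EE e p (SX R p (sg l)) = Sub e (sg l) := by
  obtain ⟨τ, hτ, h⟩ := exists_SX hK hKR hl hlK
  rw [h, EE_sg, Sub_sg, hl]
  refine lmap_congr (K := stdSimplex ℝ (Fin (p + 1))) ?_ (fun l hl => hl.2.1) (hem (p + 1))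
  intro t ht
  have h1 := ext_of τ ⟨t, ht⟩
  dsimp only at h1
  rw [h1, hτ]

/-- smallness of one singular simplex -/
lemma unif {p : ℕ} (τ : SS R p) {ε : ℝ} (hε : 0 < ε) : ∃ η > 0, ∀ t ∈ stdSimplex ℝ (Fin (p + 1)),
    ∀ t' ∈ stdSimplex ℝ (Fin (p + 1)), dist t t' < η → dist (ext τ t) (ext τ t') < ε := by
  have : CompactSpace (stdSimplex ℝ (Fin (p + 1))) :=
    isCompact_iff_compactSpace.1 (isCompact_stdSimplex ℝ (Fin (p + 1)))
  have hu := CompactSpace.uniformContinuous_of_continuous τ.continuous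
  obtain ⟨η, hη, h⟩ := Metric.uniformContinuous_iff.1 hu ε hε
  refine ⟨η, hη, fun t ht t' ht' hd => ?_⟩
  have := h (a := ⟨t, ht⟩) (b := ⟨t', ht'⟩) hd
  have h1 := ext_of τ ⟨t, ht⟩
  have h2 := ext_of τ ⟨t', ht'⟩
  dsimp only at h1 h2
  rw [h1, h2]
  exact this

lemma unif_aff {n : ℕ} (l : List E) {ε : ℝ} (hε : 0 < ε) : ∃ η > 0, ∀ t ∈ stdSimplex ℝ (Fin n),
    ∀ t' ∈ stdSimplex ℝ (Fin n), dist t t' < η → dist (aff l t) (aff l t') < ε := by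
  have hu := (isCompact_stdSimplex ℝ (Fin n)).uniformContinuousOn_of_continuous
    (aff_continuous l).continuousOn
  obtain ⟨η, hη, h⟩ := Metric.uniformContinuousOn_iff.1 hu ε hε
  exact ⟨η, hη, h⟩

lemma finset_eta {B : Type*} (s : Finset B) (Q : B → ℝ → Prop) (hQ : ∀ b ∈ s, ∃ η > 0, Q b η)
    (hmono : ∀ b η η', 0 < η' → η' ≤ η → Q b η → Q b η') : ∃ η > 0, ∀ b ∈ s, Q b η := by
  classical
  induction s using Finset.induction_on with
  | empty => exact ⟨1, one_pos, by simp⟩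
  | insert x s hx ih =>
    obtain ⟨η, hη, h⟩ := ih fun b hb => hQ b (Finset.mem_insert_of_mem hb)
    obtain ⟨η', hη', h'⟩ := hQ x (Finset.mem_insert_self x s)
    refine ⟨min η η', lt_min hη hη', fun b hb => ?_⟩
    rcases Finset.mem_insert.1 hb with rfl | hb
    · exact hmono _ _ _ (lt_min hη hη') (min_le_right _ _) h'
    · exact hmono _ _ _ (lt_min hη hη') (min_le_left _ _) (h b hb)

end subdiv

end CM

/-! ### Part 12: singular homology controls cubical homology -/
namespace CM

open Module Submodule CubeFace
set_option linter.unusedSectionVars false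

section compare
variable {a : ℕ}

/-- closed face -/
def clf (F : CubeFace a) : Set (Fin a → ℝ) := {x | (∀ i, 0 ≤ x i ∧ x i ≤ 1) ∧
    ∀ i, (F i = some false → x i = 0) ∧ (F i = some true → x i = 1)}

lemma clf_convex (F : CubeFace a) : Convex ℝ (clf F) := by
  intro x hx y hy s t hs ht hst
  refine ⟨fun i => ?_, fun i => ⟨fun h => ?_, fun h => ?_⟩⟩
  · have h1 := hx.1 i
    have h2 := hy.1 i
    simp only [Pi.add_apply, Pi.smul_apply, smul_eq_mul]
    constructor
    · nlinarith [mul_nonneg hs h1.1, mul_nonneg ht h2.1]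
    · nlinarith [mul_nonneg hs (sub_nonneg.2 h1.2), mul_nonneg ht (sub_nonneg.2 h2.2)]
  · simp [(hx.2 i).1 h, (hy.2 i).1 h]
  · simp [(hx.2 i).2 h, (hy.2 i).2 h, hst]

lemma clf_sub {M : Set (CubeFace a)} {F : CubeFace a} (hF : F ∈ M) : clf F ⊆ real M :=
  fun x hx => Set.mem_iUnion₂.2 ⟨F, hF, hx⟩

lemma mem_real {M : Set (CubeFace a)} {x : Fin a → ℝ} (h : x ∈ real M) : ∃ F ∈ M, x ∈ clf F := by
  obtain ⟨F, hF, hx⟩ := Set.mem_iUnion₂.1 h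
  exact ⟨F, hF, hx⟩

lemma clf_mono {F G : CubeFace a} (h : F ≤ G) : clf F ⊆ clf G :=
  fun _ hx => ⟨hx.1, fun i => ⟨fun hi => (hx.2 i).1 (eq_of_le h hi), fun hi => (hx.2 i).2 (eq_of_le h hi)⟩⟩

lemma clf_nonempty (F : CubeFace a) : (clf F).Nonempty := by
  classical
  refine ⟨fun i => if F i = some true then 1 else 0, fun i => ?_, fun i => ⟨fun h => ?_, fun h => ?_⟩⟩
  · dsimp only; split_ifs <;> simp
  · simp [h]
  · simp [h]

lemma clf_dist {F : CubeFace a} {x y : Fin a → ℝ} (hx : x ∈ clf F) (hy : y ∈ clf F) :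
    dist x y < 2 := by
  refine lt_of_le_of_lt ((dist_pi_le_iff zero_le_one).2 fun i => ?_) one_lt_two
  have h1 := hx.1 i
  have h2 := hy.1 i
  rw [Real.dist_eq, abs_le]
  constructor <;> linarith

/-- closed sets of augmented cells -/
def ocl : Option (CubeFace a) → Set (Fin a → ℝ)
  | none => ∅
  | some F => clf F

/-- order on augmented cells -/
def ole (o' o : Option (CubeFace a)) : Prop := ∀ G, o' = some G → ∃ F, o = some F ∧ G ≤ F

lemma ole.trans {o o' o'' : Option (CubeFace a)} (h : ole o o') (h' : ole o' o'') : ole o o'' := by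
  intro G hG
  obtain ⟨F, hF, h1⟩ := h G hG
  obtain ⟨F', hF', h2⟩ := h' F hF
  exact ⟨F', hF', h1.trans h2⟩

lemma ole.rfl' (o : Option (CubeFace a)) : ole o o := fun G hG => ⟨G, hG, le_rfl⟩

lemma ocl_mono {o o' : Option (CubeFace a)} (h : ole o o') : ocl o ⊆ ocl o' := by
  rcases o with _ | F
  · exact Set.empty_subset _
  · obtain ⟨G, rfl, hG⟩ := h F rfl
    exact clf_mono hG

lemma ocl_convex (o : Option (CubeFace a)) : Convex ℝ (ocl o) := by
  rcases o with _ | F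
  · exact convex_empty
  · exact clf_convex F

/-- basis vector -/
noncomputable abbrev bv (o : Option (CubeFace a)) : AC a := Pi.basisFun (ZMod 2) (Option (CubeFace a)) o

lemma bv_apply (o o' : Option (CubeFace a)) (h : bv o o' ≠ 0) : o' = o := by
  classical
  by_contra hn
  apply h
  simp [bv, Pi.basisFun_apply, hn]

lemma bv_mem (o : Option (CubeFace a)) : bv o ∈ ZP {o' | odeg o' = odeg o ∧ ole o' o} := by
  intro o' h
  rw [bv_apply o o' h]
  exact ⟨rfl, ole.rfl' o⟩

lemma abd_bv (o : Option (CubeFace a)) : abd (bv o) ∈ ZP {o' | odeg o' + 1 = odeg o ∧ ole o' o} := by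
  refine abd_mem (A := fun G => ∃ F, o = some F ∧ G ≤ F) ?_ (bv_mem o)
  rintro F G h ⟨H, rfl, h'⟩
  exact ⟨H, rfl, h.trans h'⟩

lemma AC_ext {D : Type*} [AddCommGroup D] [Module (ZMod 2) D] {f g : AC a →ₗ[ZMod 2] D}
    (h : ∀ o, f (bv o) = g (bv o)) : f = g := (Pi.basisFun (ZMod 2) (Option (CubeFace a))).ext h

lemma ZP_map {D : Type*} [AddCommGroup D] [Module (ZMod 2) D] {A : Set (Option (CubeFace a))}
    (T : AC a →ₗ[ZMod 2] D) (Q : Submodule (ZMod 2) D) (h : ∀ o ∈ A, T (bv o) ∈ Q)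
    {c : AC a} (hc : c ∈ ZP A) : T c ∈ Q := by
  have : span (ZMod 2) (Pi.basisFun (ZMod 2) (Option (CubeFace a)) '' A) ≤ Q.comap T := by
    rw [span_le]
    rintro _ ⟨b, hb, rfl⟩
    exact h b hb
  exact this (ZP_span hc)

lemma LS_eq {B D : Type*} [AddCommGroup D] [Module (ZMod 2) D] {A : Set B}
    {T T' : (B →₀ ZMod 2) →ₗ[ZMod 2] D} (h : ∀ b ∈ A, T (sg b) = T' (sg b))
    {c : B →₀ ZMod 2} (hc : c ∈ LS A) : T c = T' c := by
  have : T c + T' c ∈ (⊥ : Submodule (ZMod 2) D) := by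
    refine LS_map (T + T') ⊥ (fun l hl => ?_) hc
    rw [LinearMap.add_apply, h l hl]
    exact z2_add_self _
  exact z2_eq_of_add this

/-- cellular chains as small list chains -/
theorem exists_lam (a : ℕ) : ∃ L : AC a →ₗ[ZMod 2] LC (Fin a → ℝ), (∀ c, lbd (L c) = L (abd c)) ∧
    (∀ o, L (bv o) ∈ LS (sml (ocl o) 2 (odeg o))) ∧ L (bv none) = sg [] := by
  obtain ⟨L, h1, h2, h3⟩ := carrier (Pi.basisFun (ZMod 2) (Option (CubeFace a))) abd lbd odeg 0
    Set.univ (fun o n => LS (sml (ocl o) 2 n))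
    (by
      intro o _
      refine ZP_span (ZP_mono ?_ (abd_bv o))
      rintro o' ⟨h, h'⟩
      exact ⟨trivial, h, fun n => Finsupp.supported_mono (sml_mono (ocl_mono h') le_rfl)⟩)
    (fun o _ => abd_abd _) 0 (by simp) (by simp)
    (by
      intro o _ d hd z hz hz0
      rcases o with _ | F
      · simp [odeg] at hd
      · obtain ⟨x, hx⟩ := clf_nonempty F
        exact convex_acyclic (clf_convex F) hx two_pos hz hz0)
    (fun _ => sg [])
    (by
      intro o _ ho
      exact ⟨sg_mem ⟨rfl, by simp, by simp⟩, by simp [ldel]⟩)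
  refine ⟨L, fun c => ?_, fun o => h2 o trivial, h3 none trivial rfl⟩
  have : lbd ∘ₗ L = L ∘ₗ abd := by
    apply AC_ext
    intro o
    have := h1 o trivial
    simpa using this
  exact LinearMap.congr_fun this c

open Classical in
/-- rounding -/
noncomputable def rnd (x : Fin a → ℝ) (i : Fin a) : Bool := decide (1 / 2 ≤ x i)

/-- faces spanned by rounded points -/
def JP (l : List (Fin a → ℝ)) (G : CubeFace a) : Prop :=
  ∀ i b, (∀ x ∈ l, rnd x i = b) → G i = some b

lemma rnd_near {F : CubeFace a} {x y : Fin a → ℝ} (hx : x ∈ clf F) (hd : dist x y < 1 / 2)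
    {i : Fin a} {b : Bool} (h : F i = some b) : rnd y i = b := by
  have h1 : |x i - y i| < 1 / 2 := by
    rw [← Real.dist_eq]; exact lt_of_le_of_lt (dist_le_pi_dist x y i) hd
  rw [abs_lt] at h1
  cases b
  · rw [(hx.2 i).1 h] at h1
    simp only [rnd, decide_eq_false_iff_not, not_le]
    linarith [h1.1]
  · rw [(hx.2 i).2 h] at h1
    simp only [rnd, decide_eq_true_eq]
    linarith [h1.2]

lemma JP_le {F : CubeFace a} {l : List (Fin a → ℝ)} {x : Fin a → ℝ} (hx : x ∈ clf F)
    (hl : ∀ y ∈ l, dist x y < 1 / 2) {G : CubeFace a} (hG : JP l G) : G ≤ F := by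
  intro i
  rcases h : F i with _ | b
  · exact Or.inl rfl
  · exact Or.inr (hG i b fun y hy => rnd_near hx (hl y hy) h)

lemma JP_face (l : List (Fin a → ℝ)) (hl : l ≠ []) : ∃ J : CubeFace a, ∀ G, JP l G ↔ G ≤ J := by
  classical
  obtain ⟨x, hx⟩ := List.exists_mem_of_ne_nil l hl
  let J : CubeFace a := fun i => if ∀ y ∈ l, rnd y i = rnd x i then some (rnd x i) else none
  have J1 : ∀ i, (∀ y ∈ l, rnd y i = rnd x i) → J i = some (rnd x i) := fun i hi => if_pos hi
  have J2 : ∀ i, ¬ (∀ y ∈ l, rnd y i = rnd x i) → J i = none := fun i hi => if_neg hi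
  refine ⟨J, fun G => ?_⟩
  constructor
  · intro h i
    by_cases hi : ∀ y ∈ l, rnd y i = rnd x i
    · right; rw [h i _ hi, J1 i hi]
    · left; rw [J2 i hi]
  · intro h i b hb
    have hi : ∀ y ∈ l, rnd y i = rnd x i := fun y hy => (hb y hy).trans (hb x hx).symm
    rcases h i with h | h
    · rw [J1 i hi] at h; simp at h
    · rw [J1 i hi] at h
      rw [h, hb x hx]

lemma abd_none_zero : abd (bv (none : Option (CubeFace a))) = 0 := by
  funext o
  by_contra h
  have := (abd_bv none o h).1
  simp [odeg] at this

/-- small list chains to cellular chains -/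
theorem exists_beta (M : Set (CubeFace a)) : ∃ B : LC (Fin a → ℝ) →ₗ[ZMod 2] AC a,
    (∀ n, ∀ c ∈ LS (sml (real M) (1 / 2) n), abd (B c) = B (lbd c)) ∧
    (∀ n, ∀ l ∈ sml (real M) (1 / 2) n, B (sg l) ∈ ZP {o | odeg o = n ∧ ∀ G, o = some G → JP l G}) ∧
    B (sg []) = bv none := by
  obtain ⟨B, h1, h2, h3⟩ := carrier (Finsupp.basisSingleOne (R := ZMod 2) (ι := List (Fin a → ℝ)))
    lbd abd List.length 0 {l | l ∈ sml (real M) (1 / 2) l.length}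
    (fun l n => ZP {o | odeg o = n ∧ ∀ G, o = some G → JP l G})
    (by
      intro l hl
      rw [Finsupp.coe_basisSingleOne, lbd_sg]
      have := ldel_mem l
      rw [LS, Finsupp.supported_eq_span_single] at this
      refine span_mono (Set.image_mono ?_) this
      rintro l' ⟨h, h'⟩
      refine ⟨⟨rfl, fun x hx => hl.2.1 x (h' hx), fun x hx y hy => hl.2.2 x (h' hx) y (h' hy)⟩, h, ?_⟩
      intro n
      refine ZP_mono ?_
      rintro o ⟨ho, ho'⟩
      refine ⟨ho, fun G hG i b hb => ho' G hG i b fun x hx => hb x (h' hx)⟩)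
    (fun l _ => lbd_lbd _) 0 (by simp) (by simp)
    (by
      intro l hl d hd z hz hz0
      obtain ⟨J, hJ⟩ := JP_face l (by rintro rfl; simp at hd)
      simp only [hJ] at hz ⊢
      exact cub_acyclic J _ z hz hz0)
    (fun _ => bv none)
    (by
      intro l hl hl0
      refine ⟨?_, ?_⟩
      · intro o ho
        rw [bv_apply _ _ ho]
        exact ⟨rfl, by simp⟩
      · rw [abd_none_zero]; simp)
  simp only [Finsupp.coe_basisSingleOne] at h1 h2 h3
  refine ⟨B, fun n c hc => ?_, fun n l hl => ?_, h3 [] ⟨rfl, by simp, by simp⟩ rfl⟩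
  · refine LS_eq (T := abd ∘ₗ B) (T' := B ∘ₗ lbd) (fun l hl => ?_) hc
    have := h1 l ⟨rfl, hl.2⟩
    simpa using this
  · have := h2 l ⟨rfl, hl.2⟩
    rw [hl.1] at this
    exact this

theorem cub_exact {M : Set (CubeFace a)} (hM : IsSubcomplex M) {p : ℕ}
    (h : Subsingleton (sHomology (ZMod 2) (↥(real M)) (p + 1))) : HV M (p + 1) := by
  classical
  have := Fintype.ofFinite (CubeFace a)
  intro z hz hz0
  obtain ⟨L, L1, L2, L3⟩ := exists_lam a
  obtain ⟨B, B1, B2, B3⟩ := exists_beta M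
  let zh : AC a := fun o => o.elim 0 z
  have zh_mem : zh ∈ ZP {o | odeg o = p + 2 ∧ ∃ F ∈ M, o = some F} := by
    intro o ho
    rcases o with _ | F
    · exact absurd rfl ho
    · obtain ⟨h1, h2⟩ := hz F ho
      exact ⟨by simp [odeg, h2], F, h1, rfl⟩
  have zh0 : abd zh = 0 := by
    funext o
    rcases o with _ | F
    · rw [abd_none]
      refine Finset.sum_eq_zero fun v _ => ?_
      by_contra hv
      have := (hz _ hv).2
      rw [dim_toFace] at this
      omega
    · rw [abd_some]
      by_cases hF : F ∈ M
      · exact hz0 F hF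
      · apply bd_zero_of
        intro G hFG _
        by_contra hv
        exact hF (hM.2 G (hz _ hv).1 F hFG)
  have c_mem : L zh ∈ LS {l | l.length = p + 2 ∧ ∃ F ∈ M, ∀ x ∈ l, x ∈ clf F} := by
    refine ZP_map L _ ?_ zh_mem
    rintro o ⟨ho, F, hF, rfl⟩
    have := L2 (some F)
    refine Finsupp.supported_mono ?_ this
    intro l hl
    exact ⟨hl.1.trans ho, F, hF, hl.2.1⟩
  have c_cyc : sd (real M) p (SX (real M) (p + 1) (L zh)) = 0 := by
    have : sd (real M) p (SX (real M) (p + 1) (L zh)) = SX (real M) p (lbd (L zh)) := by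
      refine LS_eq (T := sd (real M) p ∘ₗ SX (real M) (p + 1)) (T' := SX (real M) p ∘ₗ lbd)
        (fun l hl => ?_) c_mem
      obtain ⟨hl1, F, hF, hl2⟩ := hl
      exact SX_sd (clf_convex F) (clf_sub hF) hl1 hl2
    rw [this, L1, zh0, map_zero, map_zero]
  obtain ⟨W, hW⟩ := sing_exact (real M) h _ c_cyc
  obtain ⟨η1, hη1, hQ1⟩ := finset_eta W.support (fun τ η => ∀ t ∈ stdSimplex ℝ (Fin (p + 2 + 1)),
    ∀ t' ∈ stdSimplex ℝ (Fin (p + 2 + 1)), dist t t' < η → dist (ext τ t) (ext τ t') < 1 / 2)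
    (fun τ _ => unif τ (by norm_num))
    (fun τ η η' _ hle hq t ht t' ht' hd => hq t ht t' ht' (lt_of_lt_of_le hd hle))
  obtain ⟨η2, hη2, hQ2⟩ := finset_eta
    ((Finset.univ : Finset (Option (CubeFace a))).biUnion fun o => (L (bv o)).support)
    (fun l η => ∀ t ∈ stdSimplex ℝ (Fin l.length),
      ∀ t' ∈ stdSimplex ℝ (Fin l.length), dist t t' < η → dist (aff l t) (aff l t') < 1 / 2)
    (fun l _ => unif_aff l (by norm_num))
    (fun τ η η' _ hle hq t ht t' ht' hd => hq t ht t' ht' (lt_of_lt_of_le hd hle))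
  obtain ⟨e, he0, hem, hee⟩ := exists_e (lt_min hη1 hη2)
  have EW : EE e (p + 2) W ∈ LS (sml (real M) (1 / 2) (p + 3)) := by
    refine LS_map (A := (W.support : Set (SS (real M) (p + 2)))) _ _ (fun τ hτ => ?_)
      (Finsupp.mem_supported (ZMod 2) W |>.2 subset_rfl)
    rw [EE_sg]
    refine lmap_mem ?_ (hem (p + 3))
    rintro l ⟨hl1, hl2, hl3⟩
    refine ⟨by simp [hl1], ?_, ?_⟩
    · intro y hy
      obtain ⟨x, hx, rfl⟩ := List.mem_map.1 hy
      have h1 := ext_of τ ⟨x, hl2 x hx⟩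
      dsimp only at h1
      rw [h1]
      exact Subtype.coe_prop _
    · intro y hy y' hy'
      obtain ⟨x, hx, rfl⟩ := List.mem_map.1 hy
      obtain ⟨x', hx', rfl⟩ := List.mem_map.1 hy'
      exact hQ1 τ hτ _ (hl2 x hx) _ (hl2 x' hx')
        (lt_of_lt_of_le (hl3 x hx x' hx') (min_le_left _ _))
  have SL : ∀ o, Sub e (L (bv o)) ∈ LS (sml (ocl o) (1 / 2) (odeg o)) := by
    intro o
    have hsup : L (bv o) ∈ LS {l | l ∈ sml (ocl o) 2 (odeg o) ∧ l ∈ (L (bv o)).support} := by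
      rw [Finsupp.mem_supported]
      intro l hl
      exact ⟨(Finsupp.mem_supported _ _).1 (L2 o) hl, hl⟩
    refine LS_map _ _ (fun l hl => ?_) hsup
    obtain ⟨hl1, hl2⟩ := hl
    rw [Sub_sg]
    have hq := hQ2 l (Finset.mem_biUnion.2 ⟨o, Finset.mem_univ _, hl2⟩)
    refine lmap_mem ?_ (hem l.length)
    rintro l' ⟨h1, h2, h3⟩
    refine ⟨by simp [h1, hl1.1], ?_, ?_⟩
    · intro y hy
      obtain ⟨x, hx, rfl⟩ := List.mem_map.1 hy
      exact aff_mem (ocl_convex o) rfl hl1.2.1 (h2 x hx)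
    · intro y hy y' hy'
      obtain ⟨x, hx, rfl⟩ := List.mem_map.1 hy
      obtain ⟨x', hx', rfl⟩ := List.mem_map.1 hy'
      exact hq _ (h2 x hx) _ (h2 x' hx') (lt_of_lt_of_le (h3 x hx x' hx') (min_le_right _ _))
  have oclM : ∀ o : Option (CubeFace a), (∀ F, o = some F → F ∈ M) → ocl o ⊆ real M := by
    rintro (_ | F) ho
    · exact Set.empty_subset _
    · exact clf_sub (ho F rfl)
  let T : AC a →ₗ[ZMod 2] AC a := B ∘ₗ Sub e ∘ₗ L
  have hT : ∀ o : Option (CubeFace a), (∀ F, o = some F → F ∈ M) → abd (T (bv o)) = T (abd (bv o)) := by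
    intro o ho
    change abd (B (Sub e (L (bv o)))) = B (Sub e (L (abd (bv o))))
    rw [B1 (odeg o) _ (Finsupp.supported_mono (sml_mono (oclM o ho) le_rfl) (SL o)),
      lbd_Sub he0 hee, L1]
  have hTm : ∀ o : Option (CubeFace a), (∀ F, o = some F → F ∈ M) →
      T (bv o) ∈ ZP {o' | odeg o' = odeg o ∧ ole o' o} := by
    intro o ho
    refine LS_map B _ (fun l hl => ?_) (SL o)
    refine ZP_mono ?_ (B2 (odeg o) l (sml_mono (oclM o ho) le_rfl hl))
    rintro o' ⟨h1, h2⟩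
    refine ⟨h1, ?_⟩
    rintro G rfl
    have hne : l ≠ [] := by
      rintro rfl
      have := hl.1
      rw [← h1] at this
      simp [odeg] at this
    obtain ⟨x, hx⟩ := List.exists_mem_of_ne_nil l hne
    have hx' := hl.2.1 x hx
    rcases o with _ | F
    · exact absurd hx' (Set.notMem_empty _)
    · exact ⟨F, rfl, JP_le hx' (fun y hy => hl.2.2 x hx y hy) (h2 G rfl)⟩
  obtain ⟨D, D1, D2, -⟩ := carrier (Pi.basisFun (ZMod 2) (Option (CubeFace a))) abd abd odeg 1
    {o | ∀ F, o = some F → F ∈ M} (fun o n => ZP {o' | odeg o' = n ∧ ole o' o})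
    (by
      intro o ho
      refine ZP_span (ZP_mono ?_ (abd_bv o))
      rintro o' ⟨h, h'⟩
      refine ⟨?_, h, fun n => ZP_mono ?_⟩
      · rintro F rfl
        obtain ⟨G, hG, hle⟩ := h' F rfl
        exact hM.2 G (ho G hG) F hle
      · rintro o'' ⟨h1, h2⟩
        exact ⟨h1, h2.trans h'⟩)
    (fun o _ => abd_abd _) (LinearMap.id + T)
    (by
      intro o ho
      rw [LinearMap.add_apply, LinearMap.add_apply, map_add, hT o ho]
      rfl)
    (by
      intro o ho d hd
      rw [← hd]
      exact add_mem (bv_mem o) (hTm o ho))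
    (by
      intro o ho d hd z hz hz0
      rcases o with _ | F
      · simp [odeg] at hd
      · have : ∀ n, {o' | odeg o' = n ∧ ole o' (some F)} = cub F n := by
          intro n
          ext o'
          simp [cub, ole]
        rw [this] at hz ⊢
        exact cub_acyclic F _ z hz hz0)
    (fun _ => 0)
    (by
      intro o ho hd
      refine ⟨zero_mem _, ?_⟩
      rcases o with _ | F
      · rw [map_zero, LinearMap.add_apply]
        change 0 = bv none + B (Sub e (L (bv none)))
        rw [L3, Sub_sg]
        have : e ([] : List (Fin a → ℝ)).length = sg [] := he0
        rw [this, lmap_sg]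
        change 0 = bv none + B (sg [])
        rw [B3, z2_add_self]
      · simp [odeg] at hd)
  have hzD : abd (D zh) = zh + T zh := by
    have : (abd ∘ₗ D + (LinearMap.id + T + D ∘ₗ abd) : AC a →ₗ[ZMod 2] AC a) zh ∈ (⊥ : Submodule (ZMod 2) (AC a)) := by
      refine ZP_map _ _ ?_ zh_mem
      rintro o ⟨ho, F, hF, rfl⟩
      have := D1 (some F) (by rintro G hG; cases hG; exact hF)
      rw [LinearMap.add_apply, LinearMap.comp_apply, LinearMap.add_apply, LinearMap.comp_apply]
      refine (Submodule.mem_bot _).2 ?_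
      rw [this]
      exact z2_add_self _
    have this := (Submodule.mem_bot _).1 this
    rw [LinearMap.add_apply] at this
    have := z2_eq_of_add this
    rw [LinearMap.comp_apply, LinearMap.add_apply, LinearMap.comp_apply, zh0, map_zero, add_zero] at this
    exact this
  have hTz : T zh = abd (B (EE e (p + 2) W)) := by
    rw [B1 _ _ EW, lbd_EE hem hee, hW]
    change B (Sub e (L zh)) = _
    congr 1
    refine (LS_eq (T := EE e (p + 1) ∘ₗ SX (real M) (p + 1)) (T' := Sub e) (fun l hl => ?_) c_mem).symm
    obtain ⟨hl1, F, hF, hl2⟩ := hl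
    exact EE_SX hem (clf_convex F) (clf_sub hF) hl1 hl2
  have hw_mem : D zh + B (EE e (p + 2) W) ∈ ZP {o | odeg o = p + 3 ∧ ∀ G, o = some G → G ∈ M} := by
    refine add_mem ?_ ?_
    · refine ZP_map _ _ ?_ zh_mem
      rintro o ⟨ho, F, hF, rfl⟩
      refine ZP_mono ?_ (D2 (some F) (by rintro G hG; cases hG; exact hF))
      rintro o' ⟨h1, h2⟩
      refine ⟨by rw [h1, ho], ?_⟩
      rintro G rfl
      obtain ⟨F', hF', hle⟩ := h2 G rfl
      cases hF'
      exact hM.2 F hF G hle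
    · refine LS_map B _ (fun l hl => ?_) EW
      refine ZP_mono ?_ (B2 _ l hl)
      rintro o' ⟨h1, h2⟩
      refine ⟨h1, ?_⟩
      rintro G rfl
      have hne : l ≠ [] := by
        rintro rfl
        have := hl.1
        simp at this
      obtain ⟨x, hx⟩ := List.exists_mem_of_ne_nil l hne
      obtain ⟨F, hF, hxF⟩ := mem_real (hl.2.1 x hx)
      exact hM.2 F hF G (JP_le hxF (fun y hy => hl.2.2 x hx y hy) (h2 G rfl))
  refine ⟨fun G => (D zh + B (EE e (p + 2) W)) (some G), ?_, ?_⟩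
  · intro F hF
    obtain ⟨h1, h2⟩ := hw_mem _ hF
    have h1' : dim F + 1 = p + 3 := h1
    exact ⟨h2 F rfl, by omega⟩
  · intro F _
    have : abd (D zh + B (EE e (p + 2) W)) = zh := by
      rw [map_add, hzD, hTz, add_assoc, z2_add_self, add_zero]
    have := congrFun this (some F)
    exact this

end compare

end CM

set_option linter.unusedSectionVars false

namespace CM

open Module Submodule CubeFace

section vmap

variable {a b : ℕ}

lemma mem_verts {F : CubeFace a} {v : Fin a → Bool} :
    v ∈ verts F ↔ ∀ i, F i = none ∨ some (v i) = F i := Iff.rfl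

lemma getD_mem_verts (F : CubeFace a) (c : Bool) : (fun j => (F j).getD c) ∈ verts F := by
  intro i
  rcases h : F i with _ | e
  · exact Or.inl rfl
  · right
    change some ((F i).getD c) = some e
    rw [h]; rfl

lemma verts_sub {F G : CubeFace a} : verts F ⊆ verts G ↔ F ≤ G := by
  constructor
  · intro h i
    rcases hG : G i with _ | e
    · exact Or.inl rfl
    · right
      have h1 := h (getD_mem_verts F (!e)) i
      rw [hG] at h1
      have h2 : some ((F i).getD (!e)) = some e := by
        rcases h1 with h1 | h1
        · cases h1
        · exact h1
      rcases hF : F i with _ | e'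
      · rw [hF] at h2
        revert h2
        cases e <;> simp
      · rw [hF] at h2
        exact h2
  · intro h v hv
    exact le_trans (b := F) hv h

lemma verts_inj {F G : CubeFace a} (h : verts F = verts G) : F = G :=
  le_antisymm (verts_sub.1 h.subset) (verts_sub.1 h.symm.subset)

lemma verts_toFace (v : Fin a → Bool) : verts (toFace v) = {v} := by
  ext w
  simp only [Set.mem_singleton_iff]
  constructor
  · intro h
    funext i
    rcases h i with h | h
    · cases h
    · exact Option.some.inj h
  · rintro rfl
    exact le_refl (toFace w)

/-- flip a coordinate -/
def fl (v : Fin a → Bool) (i : Fin a) : Fin a → Bool := Function.update v i (!v i)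

lemma fl_same (v : Fin a → Bool) (i : Fin a) : fl v i i = !v i := Function.update_self ..

lemma fl_ne (v : Fin a → Bool) {i j : Fin a} (h : j ≠ i) : fl v i j = v j :=
  Function.update_of_ne h ..

lemma fl_fl (v : Fin a → Bool) (i : Fin a) : fl (fl v i) i = v := by
  funext j
  by_cases h : j = i
  · subst h; rw [fl_same, fl_same, Bool.not_not]
  · rw [fl_ne _ h, fl_ne _ h]

lemma fl_comm (v : Fin a → Bool) (i j : Fin a) : fl (fl v i) j = fl (fl v j) i := by
  by_cases h : i = j
  · rw [h]
  · funext l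
    by_cases h1 : l = j
    · subst h1
      rw [fl_same, fl_ne _ (Ne.symm h), fl_ne _ (Ne.symm h), fl_same]
    · by_cases h2 : l = i
      · subst h2
        rw [fl_ne _ h1, fl_same, fl_same, fl_ne _ h1]
      · rw [fl_ne _ h1, fl_ne _ h2, fl_ne _ h2, fl_ne _ h1]

lemma fl_ne_self (v : Fin a → Bool) (i : Fin a) : fl v i ≠ v := by
  intro h
  have := congrFun h i
  rw [fl_same] at this
  revert this
  cases v i <;> simp

lemma fl_inj {v : Fin a → Bool} {i j : Fin a} (h : fl v i = fl v j) : i = j := by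
  by_contra hne
  have := congrFun h i
  rw [fl_same, fl_ne _ hne] at this
  revert this
  cases v i <;> simp

lemma fl_mem {F : CubeFace a} {v : Fin a → Bool} (hv : v ∈ verts F) {i : Fin a} (hi : F i = none) :
    fl v i ∈ verts F := by
  intro j
  by_cases h : j = i
  · exact Or.inl (h ▸ hi)
  · have := hv j
    change F j = none ∨ some (fl v i j) = F j
    rw [fl_ne _ h]
    exact this

lemma none_of_two {F : CubeFace a} {v w : Fin a → Bool} (hv : v ∈ verts F) (hw : w ∈ verts F)
    {i : Fin a} (h : v i ≠ w i) : F i = none := by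
  rcases mem_verts.1 hv i with h1 | h1
  · exact h1
  rcases mem_verts.1 hw i with h2 | h2
  · exact h2
  exact absurd (Option.some.inj (h1.trans h2.symm)) h

lemma none_of_fl {F : CubeFace a} {v : Fin a → Bool} {i : Fin a} (hv : v ∈ verts F)
    (h : fl v i ∈ verts F) : F i = none := by
  refine none_of_two hv h (i := i) ?_
  rw [fl_same]
  cases v i <;> simp

/-- vertices of the enlarged face -/
lemma verts_fr (F : CubeFace a) {i : Fin a} (hi : F i ≠ none) {v : Fin a → Bool} :
    v ∈ verts (fr F i) ↔ v ∈ verts F ∨ fl v i ∈ verts F := by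
  constructor
  · intro h
    have h' : ∀ j, j ≠ i → F j = none ∨ some (v j) = F j := by
      intro j hj
      have := mem_verts.1 h j
      rwa [fr_ne _ hj] at this
    rcases hF : F i with _ | e
    · exact absurd hF hi
    · by_cases hv : v i = e
      · left
        intro j
        by_cases hj : j = i
        · subst hj; right; change some (v j) = F j; rw [hF, hv]
        · exact h' j hj
      · right
        intro j
        by_cases hj : j = i
        · subst hj; right; change some (fl v j j) = F j
          rw [hF, fl_same]
          revert hv
          cases v j <;> cases e <;> simp
        · have := h' j hj
          change F j = none ∨ some (fl v i j) = F j
          rwa [fl_ne _ hj]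
  · rintro (h | h)
    · exact verts_sub.2 (le_fr F i) h
    · have := fl_mem (verts_sub.2 (le_fr F i) h) (fr_same F i)
      rwa [fl_fl] at this

lemma const_of {β : Type*} {F : CubeFace a} (P : (Fin a → Bool) → β)
    (h : ∀ v ∈ verts F, ∀ i, F i = none → P (fl v i) = P v) :
    ∀ v ∈ verts F, ∀ w ∈ verts F, P v = P w := by
  classical
  have key : ∀ S : Finset (Fin a), ∀ v ∈ verts F, ∀ w ∈ verts F, (∀ i ∉ S, v i = w i) → P v = P w := by
    intro S
    induction S using Finset.induction_on with
    | empty =>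
      intro v hv w hw hvw
      rw [show v = w from funext fun i => hvw i (by simp)]
    | insert i S hi ih =>
      intro v hv w hw hvw
      by_cases he : v i = w i
      · refine ih v hv w hw fun j hj => ?_
        by_cases hji : j = i
        · rw [hji, he]
        · exact hvw j (by simp [hji, hj])
      · have hn := none_of_two hv hw he
        rw [← h v hv i hn]
        refine ih _ (fl_mem hv hn) w hw fun j hj => ?_
        by_cases hji : j = i
        · subst hji
          rw [fl_same]
          revert he
          cases v j <;> cases w j <;> simp
        · rw [fl_ne _ hji]
          exact hvw j (by simp [hji, hj])
  intro v hv w hw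
  exact key Finset.univ v hv w hw (by simp)

/-- the face spanned by a vertex and a set of directions -/
lemma edge_flip {f : (Fin a → Bool) → (Fin b → Bool)} {v : Fin a → Bool} {i : Fin a}
    (hne : f (fl v i) ≠ f v) {E : CubeFace b} (hE : verts E = f '' verts (fr (toFace v) i)) :
    ∃ j, f (fl v i) = fl (f v) j := by
  have hi : toFace v i ≠ none := by change some (v i) ≠ none; simp
  have hm : ∀ w, w ∈ verts (fr (toFace v) i) ↔ w = v ∨ w = fl v i := by
    intro w
    rw [verts_fr _ hi, verts_toFace, Set.mem_singleton_iff, Set.mem_singleton_iff]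
    refine or_congr Iff.rfl ⟨fun h => ?_, fun h => ?_⟩
    · rw [← h, fl_fl]
    · rw [h, fl_fl]
  have h1 : f v ∈ verts E := hE ▸ ⟨v, (hm _).2 (Or.inl rfl), rfl⟩
  have h2 : f (fl v i) ∈ verts E := hE ▸ ⟨_, (hm _).2 (Or.inr rfl), rfl⟩
  obtain ⟨j, hj⟩ := Function.ne_iff.1 hne
  have h3 := fl_mem h1 (none_of_two h2 h1 hj)
  rw [hE] at h3
  obtain ⟨w, hw, hw'⟩ := h3
  rcases (hm w).1 hw with rfl | rfl
  · exact absurd hw'.symm (fl_ne_self _ _)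
  · exact ⟨j, hw'⟩

lemma square_flip {f : (Fin a → Bool) → (Fin b → Bool)} {v : Fin a → Bool} {i l : Fin a} (hil : i ≠ l)
    {E : CubeFace b} (hE : verts E = f '' verts (fr (fr (toFace v) i) l))
    (hinj : Set.InjOn f (verts (fr (fr (toFace v) i) l))) {j j' q : Fin b}
    (h1 : f (fl v i) = fl (f v) j) (h2 : f (fl v l) = fl (f v) q)
    (h3 : f (fl (fl v l) i) = fl (f (fl v l)) j') : j' = j := by
  have hi : toFace v i ≠ none := by change some (v i) ≠ none; simp
  have hl : fr (toFace v) i l ≠ none := by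
    rw [fr_ne _ (Ne.symm hil)]; change some (v l) ≠ none; simp
  have hm : ∀ w, w ∈ verts (fr (fr (toFace v) i) l) ↔
      w = v ∨ w = fl v i ∨ w = fl v l ∨ w = fl (fl v l) i := by
    intro w
    rw [verts_fr _ hl, verts_fr _ hi, verts_fr _ hi, verts_toFace]
    simp only [Set.mem_singleton_iff]
    constructor
    · rintro ((h | h) | (h | h))
      · exact Or.inl h
      · exact Or.inr (Or.inl (by rw [← h, fl_fl]))
      · exact Or.inr (Or.inr (Or.inl (by rw [← h, fl_fl])))
      · exact Or.inr (Or.inr (Or.inr (by rw [← h, fl_comm _ i l, fl_fl, fl_fl])))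
    · rintro (h | h | h | h)
      · exact Or.inl (Or.inl h)
      · exact Or.inl (Or.inr (by rw [h, fl_fl]))
      · exact Or.inr (Or.inl (by rw [h, fl_fl]))
      · exact Or.inr (Or.inr (by rw [h, fl_comm _ l i, fl_fl, fl_fl]))
  have m0 := (hm v).2 (Or.inl rfl)
  have m1 := (hm (fl v i)).2 (Or.inr (Or.inl rfl))
  have m2 := (hm (fl v l)).2 (Or.inr (Or.inr (Or.inl rfl)))
  have hjq : j ≠ q := by
    rintro rfl
    exact hil (fl_inj (hinj m1 m2 (h1.trans h2.symm)))
  have e0 : f v ∈ verts E := hE ▸ ⟨v, m0, rfl⟩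
  have e1 : fl (f v) j ∈ verts E := hE ▸ ⟨_, m1, h1⟩
  have e2 : fl (f v) q ∈ verts E := hE ▸ ⟨_, m2, h2⟩
  have e3 := fl_mem e2 (none_of_fl e0 e1)
  rw [hE] at e3
  obtain ⟨w, hw, hw'⟩ := e3
  rcases (hm w).1 hw with rfl | rfl | rfl | rfl
  · have := congrFun hw' j
    rw [fl_same, fl_ne _ hjq] at this
    revert this
    cases f w j <;> simp
  · rw [h1, fl_comm] at hw'
    exact absurd hw'.symm (fl_ne_self _ _)
  · rw [h2] at hw'
    exact absurd hw'.symm (fl_ne_self _ _)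
  · rw [h3, h2] at hw'
    exact fl_inj hw'

lemma fr_le {F G : CubeFace a} (h : F ≤ G) {i : Fin a} (hi : G i = none) : fr F i ≤ G := by
  intro j
  by_cases hj : j = i
  · exact Or.inl (hj ▸ hi)
  · rw [fr_ne _ hj]
    exact h j

theorem face_image (f : (Fin a → Bool) → (Fin b → Bool)) (s : ℕ) : ∀ F : CubeFace a, dim F = s →
    Set.InjOn f (verts F) → (∀ E, E ≤ F → dim E ≤ 2 → ∃ G, verts G = f '' verts E) →
    ∃ G, dim G = dim F ∧ verts G = f '' verts F ∧ ∀ τ, τ ≤ G → ∃ E, E ≤ F ∧ verts τ = f '' verts E := by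
  classical
  induction s with
  | zero =>
    intro F hF hinj h2
    obtain ⟨v, rfl⟩ := exists_toFace hF
    have hv : verts (toFace (f v)) = f '' verts (toFace v) := by
      rw [verts_toFace, verts_toFace, Set.image_singleton]
    refine ⟨toFace (f v), by rw [dim_toFace, dim_toFace], hv, ?_⟩
    intro τ hτ
    have : τ = toFace (f v) := eq_of_le_dim hτ (by rw [dim_toFace]; exact Nat.zero_le _)
    exact ⟨_, le_refl _, this ▸ hv⟩
  | succ s ih =>
    intro F hF hinj h2
    have : ∃ i, F i = none := by
      by_contra hn
      push Not at hn
      have h0 : dim F = 0 := by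
        rw [dim_eq, Finset.card_eq_zero, Finset.filter_eq_empty_iff]
        exact fun i _ => hn i
      omega
    obtain ⟨i, hi⟩ := this
    have L : ∀ c, fx F i c ≤ F := fun c => fx_le hi c
    have key := fun c => ih (fx F i c) (by have := dim_fx hi c; omega)
      (hinj.mono (verts_sub.2 (L c))) (fun E hE hd => h2 E (hE.trans (L c)) hd)
    choose G hGd hGv hGs using key
    have vfx : ∀ c v, v ∈ verts (fx F i c) ↔ v ∈ verts F ∧ v i = c := by
      intro c v
      constructor
      · intro h
        refine ⟨verts_sub.2 (L c) h, ?_⟩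
        rcases mem_verts.1 h i with h | h
        · rw [fx_same] at h; cases h
        · rw [fx_same] at h; exact Option.some.inj h
      · rintro ⟨h, rfl⟩ j
        by_cases hj : j = i
        · subst hj; right; rw [fx_same]; rfl
        · rw [fx_ne _ _ hj]; exact h j
    have tl : ∀ v ∈ verts F, toFace v ≤ F := fun v hv => hv
    have ex : ∀ v ∈ verts F, ∀ l, F l = none → ∃ j, f (fl v l) = fl (f v) j := by
      intro v hv l hl
      obtain ⟨E, hE⟩ := h2 (fr (toFace v) l) (fr_le (tl v hv) hl) (by
        rw [dim_fr (by change some (v l) ≠ none; simp), dim_toFace]; omega)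
      exact edge_flip (fun h => fl_ne_self _ _ (hinj (fl_mem hv hl) hv h)) hE
    obtain ⟨v0, hv0⟩ : ∃ v, v ∈ verts (fx F i false) := ⟨_, getD_mem_verts _ false⟩
    have hex : ∀ v, ∃ j, v ∈ verts F → f (fl v i) = fl (f v) j := by
      intro v
      by_cases hv : v ∈ verts F
      · obtain ⟨j, hj⟩ := ex v hv i hi
        exact ⟨j, fun _ => hj⟩
      · obtain ⟨j, hj⟩ := ex v0 ((vfx _ _).1 hv0).1 i hi
        exact ⟨j, fun h => absurd h hv⟩
    choose J hJ using hex
    have Jc : ∀ v ∈ verts F, ∀ w ∈ verts F, J v = J w := by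
      refine const_of J fun v hv l hl => ?_
      by_cases hil : i = l
      · subst hil
        have h1 := hJ v hv
        have h3 := hJ _ (fl_mem hv hi)
        rw [fl_fl] at h3
        rw [h1] at h3
        have h4 : fl (fl (f v) (J v)) (J v) = fl (fl (f v) (J v)) (J (fl v i)) := by
          rw [fl_fl]; exact h3
        exact (fl_inj h4).symm
      · have hsub : fr (fr (toFace v) i) l ≤ F := fr_le (fr_le (tl v hv) hi) hl
        obtain ⟨E, hE⟩ := h2 _ hsub (by
          rw [dim_fr (by rw [fr_ne _ (Ne.symm hil)]; change some (v l) ≠ none; simp),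
            dim_fr (by change some (v i) ≠ none; simp), dim_toFace])
        obtain ⟨q, hq⟩ := ex v hv l hl
        exact square_flip hil hE (hinj.mono (verts_sub.2 hsub)) (hJ v hv) hq (hJ _ (fl_mem hv hl))
    obtain ⟨j, hj⟩ : ∃ j, ∀ v ∈ verts F, f (fl v i) = fl (f v) j :=
      ⟨J v0, fun v hv => by rw [hJ v hv, Jc v hv v0 ((vfx _ _).1 hv0).1]⟩
    have hGj : ∀ c, G c j ≠ none := by
      intro c hn
      obtain ⟨v, hv⟩ : ∃ v, v ∈ verts (fx F i c) := ⟨_, getD_mem_verts _ false⟩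
      have h1 : f v ∈ verts (G c) := hGv c ▸ ⟨v, hv, rfl⟩
      have h3 := fl_mem h1 hn
      have hv' := (vfx c v).1 hv
      rw [← hj v hv'.1, hGv] at h3
      obtain ⟨w, hw, hw'⟩ := h3
      have hww := (vfx c w).1 hw
      have := hinj hww.1 (fl_mem hv'.1 hi) hw'
      rw [this, fl_same, hv'.2] at hww
      revert hww
      cases c <;> simp
    have hflv : ∀ c v, v ∈ verts (fx F i c) → fl v i ∈ verts (fx F i (!c)) := by
      intro c v hv
      have hv' := (vfx c v).1 hv
      exact (vfx _ _).2 ⟨fl_mem hv'.1 hi, by rw [fl_same, hv'.2]⟩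
    have hfG : ∀ c p, fl p j ∈ verts (G c) ↔ p ∈ verts (G (!c)) := by
      have one : ∀ c p, p ∈ verts (G c) → fl p j ∈ verts (G (!c)) := by
        intro c p hp
        rw [hGv] at hp ⊢
        obtain ⟨v, hv, rfl⟩ := hp
        exact ⟨fl v i, hflv c v hv, hj v ((vfx c v).1 hv).1⟩
      intro c p
      constructor
      · intro h
        have := one c _ h
        rwa [fl_fl] at this
      · intro h
        have := one (!c) p h
        rwa [Bool.not_not] at this
    have hfr : ∀ c, verts (fr (G c) j) = f '' verts F := by
      intro c
      ext p
      rw [verts_fr _ (hGj c), hfG, hGv, hGv]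
      constructor
      · rintro (⟨v, hv, rfl⟩ | ⟨v, hv, rfl⟩)
        · exact ⟨v, ((vfx _ _).1 hv).1, rfl⟩
        · exact ⟨v, ((vfx _ _).1 hv).1, rfl⟩
      · rintro ⟨v, hv, rfl⟩
        by_cases hvi : v i = c
        · exact Or.inl ⟨v, (vfx _ _).2 ⟨hv, hvi⟩, rfl⟩
        · exact Or.inr ⟨v, (vfx _ _).2 ⟨hv, by revert hvi; cases v i <;> cases c <;> simp⟩, rfl⟩
    refine ⟨fr (G false) j, ?_, hfr false, ?_⟩
    · rw [dim_fr (hGj _), hGd, dim_fx hi]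
    · intro τ hτ
      have small : ∀ c τ, τ ≤ fr (G c) j → τ j = G c j → ∃ E, E ≤ fx F i c ∧ verts τ = f '' verts E := by
        intro c τ h1 h3
        refine hGs c τ fun l => ?_
        by_cases hl : l = j
        · right; rw [hl, h3]
        · have := h1 l
          rwa [fr_ne _ hl] at this
      have frs : ∀ c, fr (G c) j = fr (G false) j := fun c => verts_inj ((hfr c).trans (hfr false).symm)
      obtain ⟨e, he⟩ : ∃ e, G false j = some e := Option.ne_none_iff_exists'.1 (hGj false)
      have he' : G true j = some (!e) := by
        obtain ⟨p, hp⟩ : ∃ p, p ∈ verts (G false) := ⟨_, getD_mem_verts _ false⟩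
        have h1 : fl p j ∈ verts (G true) := (hfG true p).2 hp
        rcases mem_verts.1 hp j with h | h
        · exact absurd h (hGj _)
        rcases mem_verts.1 h1 j with h' | h'
        · exact absurd h' (hGj _)
        rw [fl_same] at h'
        rw [he] at h
        rw [← h', Option.some.inj h]
      have big : ∀ c, τ j = G c j → ∃ E, E ≤ F ∧ verts τ = f '' verts E := by
        intro c h
        obtain ⟨E, hE, hE'⟩ := small c τ (by rw [frs]; exact hτ) h
        exact ⟨E, hE.trans (L c), hE'⟩
      rcases hτj : τ j with _ | e'
      · have hle : fx τ j e ≤ τ := fx_le hτj e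
        obtain ⟨E, hE, hE'⟩ := small false (fx τ j e) (hle.trans hτ) (by rw [fx_same, he])
        have hEi : E i ≠ none := by
          rw [eq_of_le hE (fx_same F i false)]; simp
        refine ⟨fr E i, fr_le (hE.trans (L _)) hi, ?_⟩
        have hEF := verts_sub.2 (hE.trans (L false))
        have hτe : fr (fx τ j e) j = τ := by
          funext l
          by_cases hl : l = j
          · subst hl; rw [fr_same, hτj]
          · rw [fr_ne _ hl, fx_ne _ _ hl]
        ext p
        rw [← hτe, verts_fr _ (by rw [fx_same]; simp), hE']
        constructor
        · rintro (⟨v, hv, rfl⟩ | ⟨v, hv, hvp⟩)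
          · exact ⟨v, (verts_fr _ hEi).2 (Or.inl hv), rfl⟩
          · refine ⟨fl v i, (verts_fr _ hEi).2 (Or.inr (by rwa [fl_fl])), ?_⟩
            rw [hj v (hEF hv), hvp, fl_fl]
        · rintro ⟨v, hv, rfl⟩
          rcases (verts_fr _ hEi).1 hv with hv | hv
          · exact Or.inl ⟨v, hv, rfl⟩
          · refine Or.inr ⟨fl v i, hv, ?_⟩
            have := hj _ (hEF hv)
            rw [fl_fl] at this
            rw [this, fl_fl]
      · by_cases hee : e' = e
        · exact big false (by rw [hτj, he, hee])
        · refine big true ?_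
          rw [hτj, he']
          revert hee
          cases e <;> cases e' <;> simp

end vmap

end CM

set_option linter.unusedSectionVars false

namespace CM

open Module Submodule CubeFace

section final

variable {a b : ℕ}

open Classical in
lemma bd_eq_sum [Fintype (CubeFace a)] (c : CubeFace a → ZMod 2) (F : CubeFace a) :
    bd c F = ∑ G ∈ Finset.univ.filter (fun G => F ≤ G ∧ dim G = dim F + 1), c G := by
  unfold bd
  rw [← Finset.sum_filter_add_sum_filter_not _ (fun i => F i = none)]
  refine Eq.trans (add_eq_right.2 (Finset.sum_eq_zero fun i hi => if_pos (Finset.mem_filter.1 hi).2)) ?_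
  refine Finset.sum_bij (fun i _ => fr F i) ?_ ?_ ?_ ?_
  · intro i hi
    have := (Finset.mem_filter.1 hi).2
    exact Finset.mem_filter.2 ⟨Finset.mem_univ _, le_fr F i, dim_fr this⟩
  · intro i hi j hj h
    exact fr_inj (Finset.mem_filter.1 hi).2 h
  · intro G hG
    obtain ⟨h1, h2⟩ := (Finset.mem_filter.1 hG).2
    obtain ⟨i, hi, hi'⟩ := exists_fr_eq h1 h2
    exact ⟨i, Finset.mem_filter.2 ⟨Finset.mem_univ _, hi⟩, hi'.symm⟩
  · intro i hi
    exact if_neg (Finset.mem_filter.1 hi).2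

/-- vertex bijections preserving low dimensional faces -/
structure Rel (M : Set (CubeFace a)) (N : Set (CubeFace b)) (k : ℕ)
    (f : (Fin a → Bool) → (Fin b → Bool)) (g : (Fin b → Bool) → (Fin a → Bool)) : Prop where
  sM : ∀ F ∈ M, ∀ G, G ≤ F → G ∈ M
  sN : ∀ F ∈ N, ∀ G, G ≤ F → G ∈ N
  fm : ∀ v ∈ cvert M, f v ∈ cvert N
  gm : ∀ v ∈ cvert N, g v ∈ cvert M
  gf : ∀ v ∈ cvert M, g (f v) = v
  fg : ∀ v ∈ cvert N, f (g v) = v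
  fwd : ∀ F ∈ M, dim F ≤ k → ∃ G ∈ N, verts G = f '' verts F
  bwd : ∀ G ∈ N, dim G ≤ k → ∃ F ∈ M, verts F = g '' verts G

variable {M : Set (CubeFace a)} {N : Set (CubeFace b)} {k : ℕ}
  {f : (Fin a → Bool) → (Fin b → Bool)} {g : (Fin b → Bool) → (Fin a → Bool)}

lemma Rel.symm (R : Rel M N k f g) : Rel N M k g f :=
  ⟨R.sN, R.sM, R.gm, R.fm, R.fg, R.gf, R.bwd, R.fwd⟩

lemma Rel.vM (R : Rel M N k f g) {F : CubeFace a} (hF : F ∈ M) : verts F ⊆ cvert M :=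
  fun _ hv => R.sM F hF _ hv

lemma Rel.inj (R : Rel M N k f g) {F : CubeFace a} (hF : F ∈ M) : Set.InjOn f (verts F) := by
  intro v hv w hw h
  rw [← R.gf v (R.vM hF hv), ← R.gf w (R.vM hF hw), h]

lemma Rel.gfi (R : Rel M N k f g) {W : Set (Fin a → Bool)} (hW : W ⊆ cvert M) : g '' (f '' W) = W := by
  ext v
  constructor
  · rintro ⟨_, ⟨w, hw, rfl⟩, rfl⟩
    rwa [R.gf w (hW hw)]
  · intro hv
    exact ⟨f v, ⟨v, hv, rfl⟩, R.gf v (hW hv)⟩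

lemma Rel.img (R : Rel M N k f g) (hk : 2 ≤ k) {F : CubeFace a} (hF : F ∈ M) :
    ∃ G, dim G = dim F ∧ verts G = f '' verts F ∧
      ∀ τ, τ ≤ G → ∃ E, E ≤ F ∧ verts τ = f '' verts E :=
  face_image f _ F rfl (R.inj hF) fun E hE hd => by
    obtain ⟨G, _, h⟩ := R.fwd E (R.sM F hF E hE) (hd.trans hk)
    exact ⟨G, h⟩

open Classical in
/-- the image face -/
noncomputable def ph (f : (Fin a → Bool) → (Fin b → Bool)) (F : CubeFace a) : CubeFace b :=
  if h : ∃ G, verts G = f '' verts F then h.choose else toFace fun _ => false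

lemma ph_eq {F : CubeFace a} {G : CubeFace b} (h : verts G = f '' verts F) : ph f F = G := by
  have hex : ∃ G, verts G = f '' verts F := ⟨G, h⟩
  unfold ph
  rw [dif_pos hex]
  exact verts_inj (hex.choose_spec.trans h.symm)

lemma Rel.pv (R : Rel M N k f g) (hk : 2 ≤ k) {F : CubeFace a} (hF : F ∈ M) :
    verts (ph f F) = f '' verts F := by
  obtain ⟨G, _, h, _⟩ := R.img hk hF
  rw [ph_eq h, h]

lemma Rel.pd (R : Rel M N k f g) (hk : 2 ≤ k) {F : CubeFace a} (hF : F ∈ M) :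
    dim (ph f F) = dim F := by
  obtain ⟨G, h', h, _⟩ := R.img hk hF
  rw [ph_eq h, h']

lemma Rel.ps (R : Rel M N k f g) (hk : 2 ≤ k) {F : CubeFace a} (hF : F ∈ M) {τ : CubeFace b}
    (hτ : τ ≤ ph f F) : ∃ E, E ≤ F ∧ τ = ph f E := by
  obtain ⟨G, h', h, h3⟩ := R.img hk hF
  rw [ph_eq h] at hτ
  obtain ⟨E, hE, hE'⟩ := h3 τ hτ
  exact ⟨E, hE, (ph_eq hE').symm⟩

lemma Rel.pm (R : Rel M N k f g) {F : CubeFace a} (hF : F ∈ M) (hd : dim F ≤ k) :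
    ph f F ∈ N := by
  obtain ⟨G, h', h⟩ := R.fwd F hF hd
  rwa [ph_eq h]

lemma Rel.pp (R : Rel M N k f g) (hk : 2 ≤ k) {F : CubeFace a} (hF : F ∈ M) :
    ph g (ph f F) = F :=
  ph_eq (by rw [R.pv hk hF, R.gfi (R.vM hF)])

lemma Rel.pmono (R : Rel M N k f g) (hk : 2 ≤ k) {F F' : CubeFace a} (hF : F ∈ M) (hF' : F' ∈ M)
    (h : F ≤ F') : ph f F ≤ ph f F' := by
  rw [← verts_sub, R.pv hk hF, R.pv hk hF']
  exact Set.image_mono (verts_sub.2 h)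

open Classical in
/-- transport of chains -/
noncomputable def tr (N : Set (CubeFace b)) (k : ℕ) (g : (Fin b → Bool) → (Fin a → Bool))
    (c : CubeFace a → ZMod 2) : CubeFace b → ZMod 2 :=
  fun G => if G ∈ N ∧ dim G ≤ k then c (ph g G) else 0

lemma tr_of {c : CubeFace a → ZMod 2} {G : CubeFace b} (h : G ∈ N) (hd : dim G ≤ k) :
    tr N k g c G = c (ph g G) := if_pos ⟨h, hd⟩

lemma tr_ne {c : CubeFace a → ZMod 2} {G : CubeFace b} (h : tr N k g c G ≠ 0) :
    G ∈ N ∧ dim G ≤ k ∧ c (ph g G) ≠ 0 := by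
  unfold tr at h
  split_ifs at h with h'
  · exact ⟨h'.1, h'.2, h⟩
  · exact absurd rfl h

lemma Rel.tr_Ch (R : Rel M N k f g) (hk : 2 ≤ k) {U : Set (CubeFace a)} {V : Set (CubeFace b)}
    {d : ℕ} {c : CubeFace a → ZMod 2} (hc : Ch U d c)
    (hUV : ∀ G ∈ N, dim G ≤ k → ph g G ∈ U → G ∈ V) : Ch V d (tr N k g c) := by
  intro G hG
  obtain ⟨h1, h2, h3⟩ := tr_ne hG
  obtain ⟨h4, h5⟩ := hc _ h3
  exact ⟨hUV G h1 h2 h4, by rw [← h5, R.symm.pd hk h1]⟩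

lemma Rel.tr_bd (R : Rel M N k f g) (hk : 2 ≤ k) {d : ℕ} (hd : d ≤ k) {c : CubeFace a → ZMod 2}
    (hc : Ch M d c) {G : CubeFace b} (hG : G ∈ N) : bd (tr N k g c) G = bd c (ph g G) := by
  classical
  have S := R.symm
  have htr : Ch N d (tr N k g c) := R.tr_Ch hk hc fun G h _ _ => h
  by_cases hGd : dim G + 1 = d
  · have := Fintype.ofFinite (CubeFace a)
    have := Fintype.ofFinite (CubeFace b)
    have hgd := S.pd hk hG
    rw [bd_eq_sum, bd_eq_sum]
    have cut : ∀ {e : ℕ} {K : Set (CubeFace e)} [Fintype (CubeFace e)] {c : CubeFace e → ZMod 2}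
        (_ : Ch K d c) (E : CubeFace e),
        ∑ G ∈ Finset.univ.filter (fun G => E ≤ G ∧ dim G = dim E + 1), c G =
        ∑ G ∈ Finset.univ.filter (fun G => G ∈ K ∧ E ≤ G ∧ dim G = dim E + 1), c G := by
      intro e K _ c hc E
      symm
      refine Finset.sum_subset ?_ ?_
      · intro G hG
        simp only [Finset.mem_filter, Finset.mem_univ, true_and] at hG ⊢
        exact hG.2
      · intro G hG hG'
        simp only [Finset.mem_filter, Finset.mem_univ, true_and] at hG hG'
        exact hc.zero_of fun h => hG' ⟨h, hG⟩
    rw [cut htr, cut hc]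
    refine Finset.sum_bij' (fun E _ => ph g E) (fun E _ => ph f E) ?_ ?_ ?_ ?_ ?_
    · intro E hE
      simp only [Finset.mem_filter, Finset.mem_univ, true_and] at hE ⊢
      obtain ⟨h1, h2, h3⟩ := hE
      exact ⟨S.pm h1 (by omega), S.pmono hk hG h1 h2, by rw [S.pd hk h1, h3, hgd]⟩
    · intro E hE
      simp only [Finset.mem_filter, Finset.mem_univ, true_and] at hE ⊢
      obtain ⟨h1, h2, h3⟩ := hE
      have := R.pmono hk (S.pm hG (by omega)) h1 h2
      rw [S.pp hk hG] at this
      exact ⟨R.pm h1 (by omega), this, by rw [R.pd hk h1, h3, hgd]⟩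
    · intro E hE
      simp only [Finset.mem_filter, Finset.mem_univ, true_and] at hE
      exact S.pp hk hE.1
    · intro E hE
      simp only [Finset.mem_filter, Finset.mem_univ, true_and] at hE
      exact R.pp hk hE.1
    · intro E hE
      simp only [Finset.mem_filter, Finset.mem_univ, true_and] at hE
      exact tr_of hE.1 (by omega)
  · have h1 : bd (tr N k g c) G = 0 := by
      by_contra h
      obtain ⟨E, _, h2, h3⟩ := bd_ne h
      have := (htr E h3).2
      omega
    have h2 : bd c (ph g G) = 0 := by
      by_contra h
      obtain ⟨E, _, h2, h3⟩ := bd_ne h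
      have := (hc E h3).2
      rw [S.pd hk hG] at h2
      omega
    rw [h1, h2]

lemma mem_Nb {F G : CubeFace a} : G ∈ Nb M F ↔ G ∈ M ∧ (verts G ∩ verts F).Nonempty := by
  constructor
  · rintro ⟨h1, h2, _⟩
    refine ⟨h1, fun i => ((G i).getD ((F i).getD false)), ?_, ?_⟩
    · intro i
      rcases h : G i with _ | e
      · exact Or.inl rfl
      · right
        change some ((G i).getD _) = some e
        rw [h]; rfl
    · intro i
      rcases h : F i with _ | e
      · exact Or.inl rfl
      · right
        change some ((G i).getD ((F i).getD false)) = some e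
        rcases h2 i with h3 | h3 | h3
        · rw [h3, h]; rfl
        · rw [h3] at h; cases h
        · rw [h3, h]; rfl
  · rintro ⟨h1, v, hv, hw⟩
    refine ⟨h1, fun i => ?_, by simp⟩
    rcases mem_verts.1 hv i with h | h
    · exact Or.inl h
    rcases mem_verts.1 hw i with h' | h'
    · exact Or.inr (Or.inl h')
    exact Or.inr (Or.inr (h.symm.trans h'))

lemma Rel.nb (R : Rel M N k f g) (hk : 2 ≤ k) {F : CubeFace a} {σ : CubeFace b}
    (h : verts σ = f '' verts F) (h' : verts F = g '' verts σ) {G : CubeFace b} (hG : G ∈ N)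
    (hd : dim G ≤ k) : ph g G ∈ Nb M F ↔ G ∈ Nb N σ := by
  have S := R.symm
  rw [mem_Nb, mem_Nb, S.pv hk hG]
  refine and_congr ⟨fun _ => hG, fun _ => S.pm hG hd⟩ ?_
  constructor
  · rintro ⟨_, ⟨v, hv, rfl⟩, hw⟩
    refine ⟨v, hv, ?_⟩
    rw [h]
    exact ⟨g v, hw, R.fg v (S.vM hG hv)⟩
  · rintro ⟨v, hv, hw⟩
    exact ⟨g v, ⟨v, hv, rfl⟩, h' ▸ ⟨v, hw, rfl⟩⟩

lemma Rel.tr_cyc (R : Rel M N k f g) (hk : 2 ≤ k) {d : ℕ} (hd : d ≤ k)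
    {U : Set (CubeFace a)} {V : Set (CubeFace b)} (hU : U ⊆ M) (hV : V ⊆ N)
    (hUV : ∀ G ∈ N, dim G ≤ k → (ph g G ∈ U ↔ G ∈ V)) {c : CubeFace a → ZMod 2}
    (hc : Ch U d c) (hz : ∀ F ∈ U, bd c F = 0) : ∀ G ∈ V, bd (tr N k g c) G = 0 := by
  intro G hG
  by_cases hGd : dim G ≤ k
  · rw [R.tr_bd hk hd (hc.mono hU) (hV hG)]
    exact hz _ ((hUV G (hV hG) hGd).2 hG)
  · by_contra h
    obtain ⟨E, _, h2, h3⟩ := bd_ne h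
    have := (tr_ne h3).2.1
    omega

/-- the low degree obstruction -/
lemma Rel.caseA (R : Rel M N k f g) (hk : 2 ≤ k) {m n d : ℕ} (hM : CMan M m) (hN : CMan N n)
    {F : CubeFace a} (hF : F ∈ M) (hsub : ∀ E, E ≤ F → E ≠ F → ph f E ∈ N)
    (h1 : 1 ≤ dim F) (hd : d + dim F = n + 1) (hdk : d + 1 ≤ k) (hdm : d < m) : ph f F ∈ N := by
  by_contra hσ
  have S := R.symm
  have hv := R.pv hk hF
  have hv' : verts F = g '' verts (ph f F) := by rw [hv, R.gfi (R.vM hF)]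
  have hdim := R.pd hk hF
  have hpr : ∀ τ, τ ≤ ph f F → τ ≠ ph f F → τ ∈ N := by
    intro τ h h'
    obtain ⟨E, hE, rfl⟩ := R.ps hk hF h
    exact hsub E hE fun he => h' (by rw [he])
  obtain ⟨c, hc, hz, hnb, _⟩ := Nb_bad hN hσ hpr (by omega) (d := d) (by omega)
  have corr : ∀ G ∈ N, dim G ≤ k → (ph g G ∈ Nb M F ↔ G ∈ Nb N (ph f F)) :=
    fun G hG hd => R.nb hk hv hv' hG hd
  have corr' : ∀ G ∈ M, dim G ≤ k → (ph f G ∈ Nb N (ph f F) ↔ G ∈ Nb M F) :=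
    fun G hG hd => S.nb hk hv' hv hG hd
  have hc' : Ch (Nb M F) d (tr M k f c) := S.tr_Ch hk hc fun G hG hd h => (corr' G hG hd).1 h
  have hz' := S.tr_cyc hk (by omega) (Nb_up N (ph f F)).1 (Nb_up M F).1 corr' hc hz
  rcases (Nb_good hM hF).hom d _ hc' hz' with ⟨w, hw, hw'⟩ | ⟨h, _⟩
  · refine hnb ⟨tr N k g w, R.tr_Ch hk hw fun G hG hd h => (corr G hG hd).1 h, fun G hG => ?_⟩
    have hGN := (Nb_up N (ph f F)).1 hG
    rw [R.tr_bd hk (by omega) (hw.mono (Nb_up M F).1) hGN]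
    by_cases hGd : dim G ≤ k
    · rw [hw' _ ((corr G hGN hGd).2 hG), tr_of (S.pm hGN hGd) (by rw [S.pd hk hGN]; exact hGd),
        S.pp hk hGN]
    · have e1 : c G = 0 := by
        by_contra h
        have := (hc G h).2
        omega
      have e2 : bd w (ph g G) = 0 := by
        by_contra h
        obtain ⟨E, _, h2, h3⟩ := bd_ne h
        have := (hw E h3).2
        rw [S.pd hk hGN] at h2
        omega
      rw [e1, e2]
  · omega

/-- the middle degree obstruction -/
lemma Rel.caseB (R : Rel M N k f g) (hk : 2 ≤ k) (hM : CMan M (2 * k)) (hN : CMan N (2 * k))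
    (hv : HV M k) {G : CubeFace b} (hG : G ∈ N) (hGk : dim G = k + 1) : ph g G ∈ M := by
  by_contra hσ
  have S := R.symm
  have v1 := S.pv hk hG
  have v2 : verts G = f '' verts (ph g G) := by rw [v1, S.gfi (S.vM hG)]
  have hdim := S.pd hk hG
  have hpr : ∀ τ, τ ≤ ph g G → τ ≠ ph g G → τ ∈ M := by
    intro τ h h'
    obtain ⟨E, hE, rfl⟩ := S.ps hk hG h
    have hne : E ≠ G := fun he => h' (by rw [he])
    have : ¬ dim G ≤ dim E := fun h => hne (eq_of_le_dim hE h)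
    exact S.pm (R.sN G hG E hE) (by omega)
  obtain ⟨c, hc, hz, hnb, _⟩ := Nb_bad hM hσ hpr (by omega) (d := k) (by omega)
  have corr : ∀ E ∈ N, dim E ≤ k → (ph g E ∈ Nb M (ph g G) ↔ E ∈ Nb N G) :=
    fun E hE hd => R.nb hk v2 v1 hE hd
  have corr' : ∀ E ∈ M, dim E ≤ k → (ph f E ∈ Nb N G ↔ E ∈ Nb M (ph g G)) :=
    fun E hE hd => S.nb hk v1 v2 hE hd
  have uM := Nb_up M (ph g G)
  have uN := Nb_up N G
  have hc' : Ch (Nb N G) k (tr N k g c) := R.tr_Ch hk hc fun E hE hd h => (corr E hE hd).1 h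
  have hz' := R.tr_cyc hk le_rfl uM.1 uN.1 corr hc hz
  rcases (Nb_good hN hG).hom k _ hc' hz' with ⟨w, hw, hw'⟩ | ⟨h, _⟩
  · have hy : Ch N k (tr N k g c + bd w) :=
      (hc'.mono uN.1).add (Ch.bd hN.sub (hw.mono uN.1))
    have hy' : Ch M k (tr M k f (tr N k g c + bd w)) := S.tr_Ch hk hy fun E hE _ _ => hE
    have hzz : Ch M k (c + tr M k f (tr N k g c + bd w)) := (hc.mono uM.1).add hy'
    obtain ⟨x, hx, hx'⟩ := hv _ hzz (by
      intro E hE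
      by_cases hEd : dim E ≤ k
      · rw [bd_add, S.tr_bd hk le_rfl hy hE, bd_add, bd_bd, add_zero,
          R.tr_bd hk le_rfl (hc.mono uM.1) (R.pm hE hEd), R.pp hk hE, z2_add_self]
      · by_contra h
        obtain ⟨E', _, h2, h3⟩ := bd_ne h
        have := (hzz E' h3).2
        omega)
    refine hnb ⟨res (Nb M (ph g G)) x, hx.res _, fun E hE => ?_⟩
    rw [bd_res uM hx hE, hx' E (uM.1 hE)]
    have : tr M k f (tr N k g c + bd w) E = 0 := by
      by_contra h
      obtain ⟨h1, h2, h3⟩ := tr_ne h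
      refine h3 ?_
      rw [Pi.add_apply, hw' _ ((corr' E h1 h2).2 hE), z2_add_self]
    rw [Pi.add_apply, this, add_zero]
  · omega

lemma exists_sub_dim (F : CubeFace a) {d : ℕ} (h : d ≤ dim F) : ∃ E, E ≤ F ∧ dim E = d := by
  classical
  induction hs : dim F generalizing F with
  | zero => exact ⟨F, le_refl _, by omega⟩
  | succ s ih =>
    by_cases hd : d = dim F
    · exact ⟨F, le_refl _, hd.symm⟩
    · have : ∃ i, F i = none := by
        by_contra hn
        push Not at hn
        have h0 : dim F = 0 := by
          rw [dim_eq, Finset.card_eq_zero, Finset.filter_eq_empty_iff]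
          exact fun i _ => hn i
        omega
      obtain ⟨i, hi⟩ := this
      have hfx := dim_fx hi false
      obtain ⟨E, hE, hE'⟩ := ih (fx F i false) (by omega) (by omega)
      exact ⟨E, hE.trans (fx_le hi _), hE'⟩

lemma Rel.lt_false (R : Rel M N k f g) (hk : 2 ≤ k) {n : ℕ} (hM : CMan M (2 * k)) (hN : CMan N n)
    (hn : n < 2 * k) : False := by
  have key : ∀ s, ∀ F ∈ M, dim F = s → s ≤ n + 1 → ph f F ∈ N := by
    intro s
    induction s using Nat.strong_induction_on with
    | _ s ih =>
      intro F hF hs hsn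
      by_cases hsk : s ≤ k
      · exact R.pm hF (by omega)
      · refine R.caseA hk hM hN hF ?_ (by omega) (d := n + 1 - s) (by omega) (by omega) (by omega)
        intro E hE hne
        have : ¬ dim F ≤ dim E := fun h => hne (eq_of_le_dim hE h)
        exact ih (dim E) (by omega) E (R.sM F hF E hE) rfl (by omega)
  obtain ⟨F, hF⟩ := hM.sub.1
  obtain ⟨G, hG, _, hGd⟩ := hM.pure F hF
  obtain ⟨E, hE, hEd⟩ := exists_sub_dim G (d := n + 1) (by omega)
  have hEM := R.sM G hG E hE
  have := hN.dim_le _ (key _ E hEM hEd le_rfl)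
  rw [R.pd hk hEM] at this
  omega

lemma Rel.eq_back (R : Rel M N k f g) (hk : 2 ≤ k) (hM : CMan M (2 * k)) (hN : CMan N (2 * k))
    (hv : HV M k) : ∀ G ∈ N, ph g G ∈ M := by
  have key : ∀ s, ∀ G ∈ N, dim G = s → ph g G ∈ M := by
    intro s
    induction s using Nat.strong_induction_on with
    | _ s ih =>
      intro G hG hs
      have hle := hN.dim_le G hG
      by_cases hsk : s ≤ k
      · exact R.symm.pm hG (by omega)
      by_cases hsk' : s = k + 1
      · exact R.caseB hk hM hN hv hG (by omega)
      · refine R.symm.caseA hk hN hM hG ?_ (by omega) (d := 2 * k + 1 - s) (by omega) (by omega)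
          (by omega)
        intro E hE hne
        have : ¬ dim G ≤ dim E := fun h => hne (eq_of_le_dim hE h)
        exact ih (dim E) (by omega) E (R.sN G hG E hE) rfl
  exact fun G hG => key _ G hG rfl

lemma Rel.eq_fwd (R : Rel M N k f g) (hk : 2 ≤ k) {m : ℕ} (hM : CMan M m) (hN : CMan N m)
    (hmk : 2 ≤ m) (hback : ∀ G ∈ N, ph g G ∈ M) : ∀ F ∈ M, ph f F ∈ N := by
  have S := R.symm
  have R' : Rel {F | F ∈ M ∧ ph f F ∈ N} N m f g := by
    refine ⟨?_, R.sN, ?_, ?_, ?_, R.fg, ?_, ?_⟩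
    · intro F hF G hG
      have hGM := R.sM F hF.1 G hG
      exact ⟨hGM, R.sN _ hF.2 _ (R.pmono hk hGM hF.1 hG)⟩
    · exact fun v hv => R.fm v hv.1
    · intro v hv
      have h1 := R.gm v hv
      exact ⟨h1, R.pm h1 (by rw [dim_toFace]; omega)⟩
    · exact fun v hv => R.gf v hv.1
    · exact fun F hF _ => ⟨ph f F, hF.2, R.pv hk hF.1⟩
    · exact fun G hG _ => ⟨ph g G, ⟨hback G hG, by rw [S.pp hk hG]; exact hG⟩, S.pv hk hG⟩
  have S' := R'.symm
  have cCh' := S'.tr_Ch hmk (fund_Ch N m) (V := {F | F ∈ M ∧ ph f F ∈ N}) fun G hG _ _ => hG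
  have cCh : Ch M m (tr {F | F ∈ M ∧ ph f F ∈ N} m f (fund N m)) := cCh'.mono fun _ h => h.1
  have cz : ∀ E ∈ M, bd (tr {F | F ∈ M ∧ ph f F ∈ N} m f (fund N m)) E = 0 := by
    intro E hE
    by_cases hE' : ph f E ∈ N
    · rw [S'.tr_bd hmk le_rfl (fund_Ch N m) (G := E) ⟨hE, hE'⟩]
      exact hN.cyc _ hE'
    · by_contra h
      obtain ⟨E', h1, h2, h3⟩ := bd_ne h
      have := (cCh' E' h3).1
      exact hE' (R'.sM E' this E h1).2
  have top : ∀ F ∈ M, dim F = m → ph f F ∈ N := by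
    intro F hF hFd
    obtain ⟨v, hv⟩ : ∃ v, v ∈ verts F := ⟨_, getD_mem_verts F false⟩
    have hvM : toFace v ∈ M := R.vM hF hv
    have hst : Up M (st M (toFace v)) :=
      ⟨fun _ h => h.1, fun E hE E' hE' h => ⟨hE', hE.2.trans h⟩⟩
    have hfv := R.fm v hvM
    obtain ⟨G, hG, hle, hGd⟩ := hN.pure _ hfv
    have hGM := hback G hG
    have hvG : toFace v ≤ ph g G := by
      have : v ∈ verts (ph g G) := by
        rw [S.pv hk hG]
        exact ⟨f v, hle, R.gf v hvM⟩
      exact this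
    have hone : tr {F | F ∈ M ∧ ph f F ∈ N} m f (fund N m) (ph g G) = 1 := by
      rw [tr_of (show ph g G ∈ {F | F ∈ M ∧ ph f F ∈ N} from ⟨hGM, by rw [S.pp hk hG]; exact hG⟩)
        (by rw [S.pd hk hG]; omega), S.pp hk hG]
      exact if_pos ⟨hG, hGd⟩
    rcases hM.one _ hvM _ (cCh.res (st M (toFace v)))
      (fun E hE => by rw [bd_res hst cCh hE]; exact cz E hE.1) with h | h
    · have := congrFun h (ph g G)
      rw [res_of (show ph g G ∈ st M (toFace v) from ⟨hGM, hvG⟩), hone] at this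
      exact absurd this one_ne_zero
    · have hFs : F ∈ st M (toFace v) := ⟨hF, hv⟩
      have := h F hFs
      rw [res_of hFs, show fund M m F = 1 from if_pos ⟨hF, hFd⟩] at this
      have hne : tr {F | F ∈ M ∧ ph f F ∈ N} m f (fund N m) F ≠ 0 := by
        rw [this]; exact one_ne_zero
      have h5 := tr_ne hne
      exact h5.1.2
  intro F hF
  obtain ⟨F', hF', hle, hd⟩ := hM.pure F hF
  exact R.sN _ (top F' hF' hd) _ (R.pmono hk hF hF' hle)

lemma cvert_skel (K : Set (CubeFace a)) (k : ℕ) : cvert (skel k K) = cvert K := by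
  ext v
  exact ⟨fun h => h.1, fun h => ⟨h, by rw [dim_toFace]; exact Nat.zero_le _⟩⟩

lemma rel_of_iso (hM : IsSubcomplex M) (hN : IsSubcomplex N) (h : Iso (skel k M) (skel k N)) :
    ∃ f g, Rel M N k f g := by
  obtain ⟨f, hf, hW⟩ := h
  rw [cvert_skel, cvert_skel] at hf
  rw [cvert_skel] at hW
  have hinv := hf.invOn_invFunOn
  have hm := hf.surjOn.mapsTo_invFunOn
  refine ⟨f, Function.invFunOn f (cvert M), hM.2, hN.2, hf.mapsTo, hm, hinv.1, hinv.2, ?_, ?_⟩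
  · intro F hF hd
    obtain ⟨G, hG, h⟩ := (hW (verts F) fun v hv => hM.2 F hF _ hv).1 ⟨F, ⟨hF, hd⟩, rfl⟩
    exact ⟨G, hG.1, h⟩
  · intro G hG hd
    have hGv : verts G ⊆ cvert N := fun v hv => hN.2 G hG _ hv
    have e : f '' (Function.invFunOn f (cvert M) '' verts G) = verts G := by
      ext v
      constructor
      · rintro ⟨_, ⟨w, hw, rfl⟩, rfl⟩
        rwa [hinv.2 (hGv hw)]
      · exact fun hv => ⟨_, ⟨v, hv, rfl⟩, hinv.2 (hGv hv)⟩
    obtain ⟨F, hF, h⟩ := (hW (Function.invFunOn f (cvert M) '' verts G) (by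
      rintro _ ⟨w, hw, rfl⟩
      exact hm (hGv hw))).2 ⟨G, ⟨hG, hd⟩, e.symm⟩
    exact ⟨F, hF.1, h⟩

lemma Rel.iso (R : Rel M N k f g) (hk : 2 ≤ k) (h1 : ∀ F ∈ M, ph f F ∈ N)
    (h2 : ∀ G ∈ N, ph g G ∈ M) : Iso M N := by
  refine ⟨f, ⟨R.fm, ?_, ?_⟩, ?_⟩
  · intro v hv w hw h
    rw [← R.gf v hv, ← R.gf w hw, h]
  · exact fun v hv => ⟨g v, R.gm v hv, R.fg v hv⟩
  · intro W hW
    constructor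
    · rintro ⟨F, hF, rfl⟩
      exact ⟨ph f F, h1 F hF, R.pv hk hF⟩
    · rintro ⟨G, hG, h⟩
      exact ⟨ph g G, h2 G hG, by rw [R.symm.pv hk hG, h, R.gfi hW]⟩

end final

end CM

open CubeFace in
/-- let `M ⊆ I^a`, `N ⊆ I^b` be cubical manifolds of dimensions
`m ≥ n ≥ 3` with `m = 2k` even and `H_k(|M|; ℤ/2) = 0`. If the `k`-skeletons of `M`
and `N` are isomorphic, then `M ≅ N`. -/
theorem middle_skeleton_determines_manifolds_of_different_dimensions
    {a b m n k : ℕ} (hnm : n ≤ m) (hn : 3 ≤ n) (hm : m = 2 * k)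
    (M : Set (CubeFace a)) (hM : IsSubcomplex M) (hMd : HasDim M m)
    (hmanM : IsCompactManifold (↥(real M)) m)
    (hmid : Subsingleton (sHomology (ZMod 2) (↥(real M)) k))
    (N : Set (CubeFace b)) (hN : IsSubcomplex N) (hNd : HasDim N n)
    (hmanN : IsCompactManifold (↥(real N)) n)
    (hskel : Iso (skel k M) (skel k N)) :
    Iso M N := by
  subst hm
  have hk : 2 ≤ k := by omega
  have cM := CM.cman_of hM hMd.1 hmanM
  have cN := CM.cman_of hN hNd.1 hmanN
  obtain ⟨f, g, R⟩ := CM.rel_of_iso hM hN hskel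
  rcases Nat.lt_or_ge n (2 * k) with h | h
  · exact (R.lt_false hk cM cN h).elim
  · obtain rfl : n = 2 * k := le_antisymm hnm h
    have hv : CM.HV M k := by
      obtain ⟨p, rfl⟩ : ∃ p, k = p + 1 := ⟨k - 1, by omega⟩
      exact CM.cub_exact hM hmid
    have h2 := R.eq_back hk cM cN hv
    exact R.iso hk (R.eq_fwd hk cM cN (by omega) h2) h2
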